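/- arXiv:2201.02108 — 2 statements merged into one kernel-verified Lean document; each statement's English description precedes it below -/
import Mathlib

section
/- Assume the Riemann Hypothesis. Then for T ≤ X ≤ T^4 one has ∫_T^{2T} |Σ_{n≤X} Λ(n) n^{−1/2−it} (1 − log n/log X)|² dt ≍ T·(log T)², i.e. there are absolute positive constants c₁, c₂ such that for all sufficiently large T the integral lies between c₁·T·(log T)² and c₂·T·(log T)². -/
open MeasureTheory Filter Finset

/-- The Dirichlet polynomial `∑_{n ≤ X} Λ(n) n^{-1/2-it} (1 - log n / log X)`. -/
noncomputable def Dlog (X : ℝ) (t : ℝ) : ℂ :=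
  ∑ n ∈ Finset.Icc 1 ⌊X⌋₊,
    ((ArithmeticFunction.vonMangoldt n : ℝ) : ℂ) * (n : ℂ) ^ (-(1 / 2 : ℂ) - t * Complex.I) *
      ((1 - Real.log n / Real.log X : ℝ) : ℂ)

/-- Borel–Carathéodory on a ball with arbitrary centre. -/
theorem norm_le_of_re_le_of_mem_ball {f : ℂ → ℂ} {c z : ℂ} {M R : ℝ} (hM : 0 < M) (hR : 0 < R)
    (hf : DifferentiableOn ℂ f (Metric.ball c R)) (hre : ∀ w ∈ Metric.ball c R, (f w).re ≤ M)
    (hz : z ∈ Metric.ball c R) :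
    ‖f z‖ ≤ 2 * M * ‖z - c‖ / (R - ‖z - c‖) + ‖f c‖ * (R + ‖z - c‖) / (R - ‖z - c‖) := by
  have hmem : ∀ w ∈ Metric.ball (0 : ℂ) R, c + w ∈ Metric.ball c R := by
    intro w hw
    simpa [dist_eq_norm] using hw
  have h := Complex.borelCaratheodory (f := fun w => f (c + w)) (z := z - c) hM
    (hf.comp (by fun_prop) hmem) (fun w hw => hre _ (hmem w hw)) hR
    (by simpa [dist_eq_norm] using hz)
  simpa using h

/-- A nonvanishing holomorphic function on a ball has a holomorphic logarithm, which is controlled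
by an upper bound for the function. -/
theorem exists_log_on_ball {f : ℂ → ℂ} {c : ℂ} {M R : ℝ} (hM : 0 < M) (hR : 0 < R)
    (hf : DifferentiableOn ℂ f (Metric.ball c R)) (hne : ∀ w ∈ Metric.ball c R, f w ≠ 0)
    (hb : ∀ w ∈ Metric.ball c R, ‖f w‖ ≤ Real.exp M * ‖f c‖) :
    ∃ g : ℂ → ℂ, (∀ w ∈ Metric.ball c R, HasDerivAt g (logDeriv f w) w) ∧
      (∀ w ∈ Metric.ball c R, f w = f c * Complex.exp (g w)) ∧
      ∀ w ∈ Metric.ball c R, ‖g w‖ ≤ 2 * M * ‖w - c‖ / (R - ‖w - c‖) := by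
  have hc : c ∈ Metric.ball c R := Metric.mem_ball_self hR
  have hld : DifferentiableOn ℂ (logDeriv f) (Metric.ball c R) :=
    (hf.deriv Metric.isOpen_ball).div hf hne
  obtain ⟨g, hgc, hg⟩ := hld.isExactOn_ball.with_val_at c 0
  have hfd : ∀ w ∈ Metric.ball c R, HasDerivAt f (deriv f w) w := fun w hw =>
    (hf.differentiableAt (Metric.isOpen_ball.mem_nhds hw)).hasDerivAt
  have hexp : ∀ w ∈ Metric.ball c R, f w = f c * Complex.exp (g w) := by
    intro w hw
    have hconst : ∀ u ∈ Metric.ball c R,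
        HasDerivAt (fun u => f u * Complex.exp (-g u)) 0 u := by
      intro u hu
      have h : HasDerivAt (fun u => f u * Complex.exp (-g u)) _ u :=
        (hfd u hu).mul ((hg u hu).neg.cexp)
      refine h.congr_deriv ?_
      have := hne u hu
      simp only [Pi.neg_apply]
      rw [logDeriv_apply]
      field_simp
      ring
    have := Metric.isOpen_ball.is_const_of_deriv_eq_zero (𝕜 := ℂ) (convex_ball c R).isPreconnected
      (fun u hu => (hconst u hu).differentiableAt.differentiableWithinAt)
      (fun u hu => (hconst u hu).deriv) hw hc
    simp only [hgc, neg_zero, Complex.exp_zero, mul_one] at this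
    rw [← this, mul_assoc, ← Complex.exp_add]
    simp
  refine ⟨g, hg, hexp, fun w hw => ?_⟩
  have hre : ∀ u ∈ Metric.ball c R, (g u).re ≤ M := by
    intro u hu
    have h := hb u hu
    rw [hexp u hu, norm_mul, Complex.norm_exp, mul_comm] at h
    have h2 := le_of_mul_le_mul_right h (norm_pos_iff.2 (hne c hc))
    exact Real.exp_le_exp.1 h2
  have h := norm_le_of_re_le_of_mem_ball hM hR
    (fun u hu => (hg u hu).differentiableAt.differentiableWithinAt) hre hw
  simpa [hgc] using h

theorem norm_ge_of_nonvanishing_on_ball {f : ℂ → ℂ} {c z : ℂ} {M R : ℝ} (hM : 0 < M) (hR : 0 < R)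
    (hf : DifferentiableOn ℂ f (Metric.ball c R)) (hne : ∀ w ∈ Metric.ball c R, f w ≠ 0)
    (hb : ∀ w ∈ Metric.ball c R, ‖f w‖ ≤ Real.exp M * ‖f c‖) (hz : z ∈ Metric.ball c R) :
    ‖f c‖ * Real.exp (-(2 * M * ‖z - c‖ / (R - ‖z - c‖))) ≤ ‖f z‖ := by
  obtain ⟨g, -, hexp, hg⟩ := exists_log_on_ball hM hR hf hne hb
  rw [hexp z hz, norm_mul, Complex.norm_exp]
  gcongr
  have := hg z hz
  have h2 := Complex.abs_re_le_norm (g z)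
  have := neg_abs_le (g z).re
  linarith

theorem norm_logDeriv_le_of_nonvanishing_on_ball {f : ℂ → ℂ} {c : ℂ} {M R : ℝ} (hM : 0 < M)
    (hR : 0 < R) (hf : DifferentiableOn ℂ f (Metric.ball c R))
    (hne : ∀ w ∈ Metric.ball c R, f w ≠ 0)
    (hb : ∀ w ∈ Metric.ball c R, ‖f w‖ ≤ Real.exp M * ‖f c‖) :
    ‖logDeriv f c‖ ≤ 4 * M / R := by
  obtain ⟨g, hgd, -, hg⟩ := exists_log_on_ball hM hR hf hne hb
  rw [← (hgd c (Metric.mem_ball_self hR)).deriv]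
  have hd : DifferentiableOn ℂ g (Metric.ball c R) :=
    fun u hu => (hgd u hu).differentiableAt.differentiableWithinAt
  have hsub : Metric.closedBall c (R / 2) ⊆ Metric.ball c R :=
    Metric.closedBall_subset_ball (by linarith)
  have h := Complex.norm_deriv_le_of_forall_mem_sphere_norm_le (c := c) (R := R / 2) (C := 2 * M)
    (f := g) (by positivity) (DifferentiableOn.diffContOnCl (by
      rw [closure_ball c (by positivity)]
      exact hd.mono hsub)) (fun w hw => by
      have h1 := hg w (hsub (Metric.sphere_subset_closedBall hw))
      rw [mem_sphere_iff_norm] at hw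
      rw [hw] at h1
      convert h1 using 1
      field_simp
      ring)
  calc _ ≤ _ := h
    _ = _ := by field_simp; ring

theorem norm_Gamma_mul_le {u v : ℂ} (hu : 0 < u.re) (hv : 0 < v.re) :
    ‖Complex.Gamma u‖ * ‖Complex.Gamma v‖ * Real.Gamma (u.re + v.re) ≤
      ‖Complex.Gamma (u + v)‖ * (Real.Gamma u.re * Real.Gamma v.re) := by
  have hB : ‖Complex.betaIntegral u v‖ ≤ ‖Complex.betaIntegral u.re v.re‖ := by
    have hreal : Complex.betaIntegral u.re v.re =
        ((∫ x : ℝ in (0 : ℝ)..1, x ^ (u.re - 1) * (1 - x) ^ (v.re - 1) : ℝ) : ℂ) := by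
      rw [Complex.betaIntegral, ← intervalIntegral.integral_ofReal]
      refine intervalIntegral.integral_congr fun x hx => ?_
      rw [Set.uIcc_of_le zero_le_one] at hx
      rw [Complex.ofReal_mul, Complex.ofReal_cpow hx.1, Complex.ofReal_cpow (by linarith [hx.2])]
      push_cast
      rfl
    have hle : ‖Complex.betaIntegral u v‖ ≤
        ∫ x : ℝ in (0 : ℝ)..1, x ^ (u.re - 1) * (1 - x) ^ (v.re - 1) := by
      rw [Complex.betaIntegral]
      refine (intervalIntegral.norm_integral_le_integral_norm zero_le_one).trans (le_of_eq ?_)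
      refine intervalIntegral.integral_congr_ae ?_
      have h1 : ∀ᵐ x : ℝ, x ≠ 1 := by simp [ae_iff]
      filter_upwards [h1] with x hx1 hx
      rw [Set.uIoc_of_le zero_le_one] at hx
      have h2 : 0 < 1 - x := by
        have := lt_of_le_of_ne hx.2 hx1
        linarith
      rw [norm_mul, Complex.norm_cpow_eq_rpow_re_of_pos hx.1]
      have : (1 : ℂ) - x = ((1 - x : ℝ) : ℂ) := by push_cast; rfl
      rw [this, Complex.norm_cpow_eq_rpow_re_of_pos h2]
      simp
    rw [hreal, Complex.norm_real]
    exact hle.trans (le_abs_self _)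
  have e1 := Complex.Gamma_mul_Gamma_eq_betaIntegral hu hv
  have e2 := Complex.Gamma_mul_Gamma_eq_betaIntegral (s := (u.re : ℂ)) (t := (v.re : ℂ))
    (by simpa using hu) (by simpa using hv)
  have e1' := congrArg norm e1
  have e2' := congrArg norm e2
  rw [← Complex.ofReal_add] at e2'
  simp only [norm_mul, Complex.Gamma_ofReal, Complex.norm_real, Real.norm_eq_abs] at e1' e2'
  rw [abs_of_pos (Real.Gamma_pos_of_pos hu), abs_of_pos (Real.Gamma_pos_of_pos hv),
    abs_of_pos (Real.Gamma_pos_of_pos (add_pos hu hv))] at e2'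
  rw [e1', e2']
  have h0 := (Real.Gamma_pos_of_pos (add_pos hu hv)).le
  calc _ ≤ ‖Complex.Gamma (u + v)‖ * ‖Complex.betaIntegral u.re v.re‖ *
        Real.Gamma (u.re + v.re) := by
        gcongr
    _ = _ := by ring

/-- The Riemann xi function `s (s - 1) π^(-s/2) Γ(s/2) ζ(s)`. -/
noncomputable def riemannXi (s : ℂ) : ℂ := s * (s - 1) * completedRiemannZeta₀ s + 1

theorem differentiable_riemannXi : Differentiable ℂ riemannXi := by
  unfold riemannXi
  have := differentiable_completedZeta₀
  fun_prop

theorem riemannXi_one_sub (s : ℂ) : riemannXi (1 - s) = riemannXi s := by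
  rw [riemannXi, riemannXi, completedRiemannZeta₀_one_sub]
  ring

theorem completedRiemannZeta₀_eq_mellin (s : ℂ) : completedRiemannZeta₀ s =
    mellin (HurwitzZeta.hurwitzEvenFEPair 0).f_modif (s / 2) / 2 := rfl

theorem conj_hurwitzEvenFEPair_f_modif (x : ℝ) :
    starRingEnd ℂ ((HurwitzZeta.hurwitzEvenFEPair 0).f_modif x) =
      (HurwitzZeta.hurwitzEvenFEPair 0).f_modif x := by
  unfold WeakFEPair.f_modif
  simp only [Pi.add_apply, map_add, Set.indicator_apply, HurwitzZeta.hurwitzEvenFEPair]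
  split_ifs <;> simp

theorem conj_completedRiemannZeta₀ (s : ℂ) :
    completedRiemannZeta₀ (starRingEnd ℂ s) = starRingEnd ℂ (completedRiemannZeta₀ s) := by
  rw [completedRiemannZeta₀_eq_mellin, completedRiemannZeta₀_eq_mellin, map_div₀, mellin, mellin,
    ← integral_conj]
  congr 1
  · refine setIntegral_congr_fun measurableSet_Ioi fun x (hx : 0 < x) => ?_
    simp only [smul_eq_mul, map_mul, conj_hurwitzEvenFEPair_f_modif]
    congr 1
    have harg : (x : ℂ).arg ≠ Real.pi := by
      rw [Complex.arg_ofReal_of_nonneg hx.le]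
      exact Real.pi_ne_zero.symm
    have h := Complex.cpow_conj (x : ℂ) (s / 2 - 1) harg
    rw [Complex.conj_ofReal] at h
    rw [← h, map_sub, map_div₀, map_ofNat, map_one]
  · exact (map_ofNat _ 2).symm

theorem riemannXi_conj (s : ℂ) :
    riemannXi (starRingEnd ℂ s) = starRingEnd ℂ (riemannXi s) := by
  simp only [riemannXi, conj_completedRiemannZeta₀, map_add, map_mul, map_sub, map_one]

/-- A Mellin transform is bounded on closed vertical strips. -/
theorem exists_norm_mellin_le {f : ℝ → ℂ} {a b : ℝ} (ha : MellinConvergent f a)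
    (hb : MellinConvergent f b) :
    ∃ C, ∀ s : ℂ, a ≤ s.re → s.re ≤ b → ‖mellin f s‖ ≤ C := by
  refine ⟨∫ t in Set.Ioi (0 : ℝ), ‖(t : ℂ) ^ ((a : ℂ) - 1) • f t‖ + ‖(t : ℂ) ^ ((b : ℂ) - 1) • f t‖,
    fun s h1 h2 => ?_⟩
  refine norm_integral_le_of_norm_le (ha.norm.add hb.norm) ?_
  refine (ae_restrict_iff' measurableSet_Ioi).2 (ae_of_all _ fun t (ht : 0 < t) => ?_)
  simp only [norm_smul, ← add_mul, Complex.norm_cpow_eq_rpow_re_of_pos ht, Complex.sub_re,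
    Complex.ofReal_re, Complex.one_re]
  gcongr
  rcases le_total t 1 with h | h
  · have := Real.rpow_le_rpow_of_exponent_ge ht h (by linarith : a - 1 ≤ s.re - 1)
    have := Real.rpow_nonneg ht.le (b - 1)
    linarith
  · have := Real.rpow_le_rpow_of_exponent_le h (by linarith : s.re - 1 ≤ b - 1)
    have := Real.rpow_nonneg ht.le (a - 1)
    linarith

theorem exists_norm_riemannXi_le :
    ∃ C > 0, ∀ s : ℂ, 0 ≤ s.re → s.re ≤ 8 → ‖riemannXi s‖ ≤ C * (1 + |s.im|) ^ 2 := by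
  have hm : ∀ s, MellinConvergent (HurwitzZeta.hurwitzEvenFEPair 0).f_modif s := fun s =>
    ((HurwitzZeta.hurwitzEvenFEPair 0).isStrongFEPair_toStrongFEPair.hasMellin s).1
  obtain ⟨C, hC⟩ := exists_norm_mellin_le (hm ((0 : ℝ) : ℂ)) (hm ((4 : ℝ) : ℂ))
  refine ⟨81 * |C| + 1, by positivity, fun s h1 h2 => ?_⟩
  have h0 : ‖completedRiemannZeta₀ s‖ ≤ |C| := by
    rw [completedRiemannZeta₀_eq_mellin, norm_div]
    have := hC (s / 2) (by simp; linarith) (by simp; linarith)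
    simp only [Complex.norm_ofNat]
    have := le_abs_self C
    have := norm_nonneg (mellin (HurwitzZeta.hurwitzEvenFEPair 0).f_modif (s / 2))
    linarith
  have hs : ‖s‖ ≤ 9 * (1 + |s.im|) := by
    have := Complex.norm_le_abs_re_add_abs_im s
    rw [abs_of_nonneg h1] at this
    have := abs_nonneg s.im
    linarith
  have hs' : ‖s - 1‖ ≤ 9 * (1 + |s.im|) := by
    have := Complex.norm_le_abs_re_add_abs_im (s - 1)
    simp only [Complex.sub_re, Complex.one_re, Complex.sub_im, Complex.one_im, sub_zero] at this
    have h3 : |s.re - 1| ≤ 9 := abs_le.2 ⟨by linarith, by linarith⟩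
    have := abs_nonneg s.im
    linarith
  have him := abs_nonneg s.im
  calc ‖riemannXi s‖ ≤ ‖s‖ * ‖s - 1‖ * ‖completedRiemannZeta₀ s‖ + 1 := by
        rw [riemannXi]
        refine (norm_add_le _ _).trans ?_
        simp
    _ ≤ 9 * (1 + |s.im|) * (9 * (1 + |s.im|)) * |C| + 1 * (1 + |s.im|) ^ 2 := by
        gcongr
        nlinarith
    _ = _ := by ring

theorem riemannXi_eq {s : ℂ} (hs : 0 < s.re) (hs1 : s ≠ 1) :
    riemannXi s = s * (s - 1) * (Complex.Gammaℝ s * riemannZeta s) := by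
  have h0 : s ≠ 0 := by
    rintro rfl
    simp at hs
  have hG : Complex.Gammaℝ s ≠ 0 := Complex.Gammaℝ_ne_zero_of_re_pos hs
  rw [riemannZeta_def_of_ne_zero h0, completedRiemannZeta_eq, riemannXi]
  have h1 : s - 1 ≠ 0 := sub_ne_zero.2 hs1
  have h2 : 1 - s ≠ 0 := sub_ne_zero.2 hs1.symm
  have h3 : 1 / (1 - s) = - (1 / (s - 1)) := by
    rw [← neg_sub s 1, one_div_neg_eq_neg_one_div]
  rw [h3]
  field_simp
  ring

theorem riemannZeta_ne_zero_of_half_lt_re (hRH : RiemannHypothesis) {s : ℂ} (hs : 1 / 2 < s.re)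
    (hs1 : s ≠ 1) : riemannZeta s ≠ 0 := by
  intro h
  have := hRH s h (by
    rintro ⟨n, rfl⟩
    simp at hs
    have : (0 : ℝ) ≤ n := Nat.cast_nonneg n
    norm_num at hs
    linarith) hs1
  linarith

theorem riemannXi_ne_zero (hRH : RiemannHypothesis) {s : ℂ} (hs : 1 / 2 < s.re) :
    riemannXi s ≠ 0 := by
  by_cases h1 : s = 1
  · simp [h1, riemannXi]
  · rw [riemannXi_eq (by linarith) h1]
    have h0 : s ≠ 0 := by
      rintro rfl
      simp at hs
      linarith
    exact mul_ne_zero (mul_ne_zero h0 (sub_ne_zero.2 h1)) (mul_ne_zero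
      (Complex.Gammaℝ_ne_zero_of_re_pos (by linarith))
      (riemannZeta_ne_zero_of_half_lt_re hRH hs h1))

theorem norm_riemannZeta_sub_one_le {s : ℂ} (hs : 2 ≤ s.re) : ‖riemannZeta s - 1‖ ≤ 3 / 4 := by
  have hs1 : 1 < s.re := by linarith
  have hsum : Summable fun n : ℕ => 1 / ((n : ℂ) + 1) ^ s := by
    have := (Complex.summable_one_div_nat_cpow (p := s)).2 hs1
    have := (summable_nat_add_iff 1).2 this
    simpa using this
  have hsum2 : HasSum (fun n : ℕ => 1 / ((n : ℝ) + 1) ^ 2) (Real.pi ^ 2 / 6) := by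
    have h := hasSum_zeta_two
    rw [← hasSum_nat_add_iff' 1] at h
    simpa using h
  have hsum3 : HasSum (fun n : ℕ => 1 / ((n : ℝ) + 1 + 1) ^ 2) (Real.pi ^ 2 / 6 - 1) := by
    rw [← hasSum_nat_add_iff' 1] at hsum2
    simpa using hsum2
  rw [zeta_eq_tsum_one_div_nat_add_one_cpow hs1, hsum.tsum_eq_zero_add]
  simp only [Nat.cast_zero, zero_add, Complex.one_cpow, div_one, add_sub_cancel_left]
  have : ‖∑' b : ℕ, 1 / (((b + 1 : ℕ) : ℂ) + 1) ^ s‖ ≤ Real.pi ^ 2 / 6 - 1 := by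
    refine tsum_of_norm_bounded hsum3 fun n => ?_
    rw [norm_div, norm_one]
    have : (((n + 1 : ℕ) : ℂ) + 1) = (((n + 1 + 1 : ℕ)) : ℂ) := by push_cast; ring
    rw [this, Complex.norm_natCast_cpow_of_pos (by omega)]
    have h2 : ((n : ℝ) + 1 + 1) ^ 2 = ((n + 1 + 1 : ℕ) : ℝ) ^ (2 : ℝ) := by
      push_cast
      rw [Real.rpow_two]
    rw [h2]
    have h3 : (1 : ℝ) ≤ ((n + 1 + 1 : ℕ) : ℝ) := by
      push_cast
      have : (0 : ℝ) ≤ n := Nat.cast_nonneg n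
      linarith
    gcongr
  refine this.trans ?_
  have := Real.pi_lt_d2
  have := Real.pi_pos
  nlinarith

theorem norm_riemannZeta_le {s : ℂ} (hs : 2 ≤ s.re) : ‖riemannZeta s‖ ≤ 2 := by
  have h := norm_riemannZeta_sub_one_le hs
  have h1 := norm_le_norm_sub_add (riemannZeta s) 1
  rw [norm_one] at h1
  linarith

theorem le_norm_riemannZeta {s : ℂ} (hs : 2 ≤ s.re) : 1 / 4 ≤ ‖riemannZeta s‖ := by
  have h := norm_riemannZeta_sub_one_le hs
  have h1 := norm_le_norm_sub_add 1 (riemannZeta s)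
  rw [norm_one, norm_sub_rev] at h1
  linarith

theorem norm_Gammaℝ (s : ℂ) :
    ‖Complex.Gammaℝ s‖ = Real.pi ^ (-s.re / 2) * ‖Complex.Gamma (s / 2)‖ := by
  rw [Complex.Gammaℝ_def, norm_mul, Complex.norm_cpow_eq_rpow_re_of_pos Real.pi_pos]
  simp

theorem norm_Gammaℝ_sub_le {s : ℂ} {a : ℝ} (hs : 5 ≤ s.re) (ha : 0 < a) (ha' : a ≤ 1 / 4) :
    ‖Complex.Gammaℝ (s - a)‖ ≤ 4 * ‖Complex.Gammaℝ (s + a)‖ := by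
  have hG : ‖Complex.Gamma ((s - a) / 2)‖ ≤ ‖Complex.Gamma ((s + a) / 2)‖ := by
    have hre : ((s - a) / 2).re = (s.re - a) / 2 := by simp
    have h := norm_Gamma_mul_le (u := (s - a) / 2) (v := (a : ℂ)) (by rw [hre]; linarith)
      (by simpa using ha)
    have hadd : (s - a) / 2 + a = (s + a) / 2 := by ring
    rw [hadd, hre, Complex.ofReal_re, Complex.Gamma_ofReal, Complex.norm_real, Real.norm_eq_abs,
      abs_of_pos (Real.Gamma_pos_of_pos ha)] at h
    have hga := Real.Gamma_pos_of_pos ha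
    have hmono : Real.Gamma ((s.re - a) / 2) ≤ Real.Gamma ((s.re - a) / 2 + a) :=
      Real.Gamma_strictMonoOn_Ici.monotoneOn (by simp; linarith) (by simp; linarith) (by linarith)
    have hpos : 0 < Real.Gamma ((s.re - a) / 2) := Real.Gamma_pos_of_pos (by linarith)
    have h1 : ‖Complex.Gamma ((s - a) / 2)‖ * Real.Gamma a * Real.Gamma ((s.re - a) / 2) ≤
        ‖Complex.Gamma ((s + a) / 2)‖ * Real.Gamma a * Real.Gamma ((s.re - a) / 2) := by
      calc _ ≤ ‖Complex.Gamma ((s - a) / 2)‖ * Real.Gamma a *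
            Real.Gamma ((s.re - a) / 2 + a) := by gcongr
        _ ≤ _ := h
        _ = _ := by ring
    exact le_of_mul_le_mul_right (le_of_mul_le_mul_right h1 hpos) hga
  rw [norm_Gammaℝ, norm_Gammaℝ]
  have hpi : Real.pi ^ (-(s - a).re / 2) ≤ 4 * Real.pi ^ (-(s + a).re / 2) := by
    have h1 : -(s - a).re / 2 = a + -(s + a).re / 2 := by
      simp
      ring
    rw [h1, Real.rpow_add Real.pi_pos]
    gcongr
    calc Real.pi ^ a ≤ Real.pi ^ (1 : ℝ) :=
          Real.rpow_le_rpow_of_exponent_le (by linarith [Real.pi_gt_three]) (by linarith)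
      _ ≤ 4 := by rw [Real.rpow_one]; exact Real.pi_le_four
  calc _ ≤ 4 * Real.pi ^ (-(s + a).re / 2) * ‖Complex.Gamma ((s + a) / 2)‖ := by gcongr
    _ = _ := by ring

theorem norm_sub_ofReal_le_norm_add_ofReal {s : ℂ} {a : ℝ} (hs : 0 ≤ s.re) (ha : 0 ≤ a) :
    ‖s - a‖ ≤ ‖s + a‖ := by
  rw [← sq_le_sq₀ (norm_nonneg _) (norm_nonneg _), Complex.sq_norm, Complex.sq_norm,
    Complex.normSq_apply, Complex.normSq_apply]
  simp
  nlinarith [mul_nonneg hs ha]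

theorem norm_riemannXi_sub_le_of_five_le {s : ℂ} {a : ℝ} (hs : 5 ≤ s.re) (ha : 0 < a)
    (ha' : a ≤ 1 / 4) : ‖riemannXi (s - a)‖ ≤ 32 * ‖riemannXi (s + a)‖ := by
  have h1 : s - a ≠ 1 := by
    intro h
    have := congrArg Complex.re h
    simp at this
    linarith
  have h2 : s + a ≠ 1 := by
    intro h
    have := congrArg Complex.re h
    simp at this
    linarith
  rw [riemannXi_eq (by simp; linarith) h1, riemannXi_eq (by simp; linarith) h2]
  simp only [norm_mul]
  have e1 := norm_sub_ofReal_le_norm_add_ofReal (s := s) (by linarith) ha.le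
  have e2 : ‖s - a - 1‖ ≤ ‖s + a - 1‖ := by
    have := norm_sub_ofReal_le_norm_add_ofReal (s := s - 1) (a := a) (by simp; linarith) ha.le
    convert this using 2 <;> ring
  have e3 := norm_Gammaℝ_sub_le hs ha ha'
  have e4 : ‖riemannZeta (s - a)‖ ≤ 8 * ‖riemannZeta (s + a)‖ := by
    have := norm_riemannZeta_le (s := s - a) (by simp; linarith)
    have := le_norm_riemannZeta (s := s + a) (by simp; linarith)
    linarith
  calc _ ≤ ‖s + a‖ * ‖s + a - 1‖ *
        (4 * ‖Complex.Gammaℝ (s + a)‖ * (8 * ‖riemannZeta (s + a)‖)) := by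
        gcongr
    _ = _ := by ring

theorem norm_sin_le_exp_abs_im (w : ℂ) : ‖Complex.sin w‖ ≤ Real.exp |w.im| := by
  rw [Complex.sin, norm_div, norm_mul, Complex.norm_I, mul_one, Complex.norm_ofNat]
  have h := norm_sub_le (Complex.exp (-w * Complex.I)) (Complex.exp (w * Complex.I))
  rw [Complex.norm_exp, Complex.norm_exp] at h
  have h1 : Real.exp (-w * Complex.I).re ≤ Real.exp |w.im| := by
    apply Real.exp_le_exp.2
    simpa using le_abs_self w.im
  have h2 : Real.exp (w * Complex.I).re ≤ Real.exp |w.im| := by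
    apply Real.exp_le_exp.2
    simpa using neg_le_abs w.im
  linarith

theorem exp_le_norm_Gamma_half_add (y : ℝ) :
    Real.exp (-(Real.pi * |y|)) ≤ ‖Complex.Gamma (1 / 2 + y * Complex.I)‖ := by
  set z : ℂ := 1 / 2 + y * Complex.I with hz
  have hconj : 1 - z = starRingEnd ℂ z := by
    apply Complex.ext <;> simp [hz]
    norm_num
  have h := congrArg norm (Complex.Gamma_mul_Gamma_one_sub z)
  rw [hconj, Complex.Gamma_conj, norm_mul, RCLike.norm_conj, norm_div, Complex.norm_real,
    Real.norm_eq_abs, abs_of_pos Real.pi_pos] at h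
  have hs := norm_sin_le_exp_abs_im (Real.pi * z)
  have him : (Real.pi * z).im = Real.pi * y := by simp [hz]
  rw [him, abs_mul, abs_of_pos Real.pi_pos] at hs
  have hspos : 0 < ‖Complex.sin (Real.pi * z)‖ := by
    by_contra hcon
    have : ‖Complex.sin (Real.pi * z)‖ = 0 := le_antisymm (not_lt.1 hcon) (norm_nonneg _)
    rw [this, div_zero] at h
    have hG : Complex.Gamma z ≠ 0 := Complex.Gamma_ne_zero_of_re_pos (by simp [hz])
    have := norm_pos_iff.2 hG
    nlinarith
  have h2 : Real.exp (-(Real.pi * |y|)) ≤ ‖Complex.Gamma z‖ * ‖Complex.Gamma z‖ := by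
    rw [h, le_div_iff₀ hspos]
    calc _ ≤ Real.exp (-(Real.pi * |y|)) * Real.exp (Real.pi * |y|) := by gcongr
      _ = 1 := by rw [← Real.exp_add]; simp
      _ ≤ Real.pi := by linarith [Real.pi_gt_three]
  have h3 : Real.exp (-(Real.pi * |y|)) ≤ 1 := by
    rw [Real.exp_le_one_iff]
    have := Real.pi_pos
    have := abs_nonneg y
    simp only [Left.neg_nonpos_iff]
    positivity
  by_contra hcon
  push Not at hcon
  have := norm_nonneg (Complex.Gamma z)
  nlinarith

theorem exp_le_norm_riemannXi_three_add (t : ℝ) :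
    1 / 16 * Real.exp (-(4 * |t|)) ≤ ‖riemannXi (3 + t * Complex.I)‖ := by
  set s : ℂ := 3 + t * Complex.I with hs
  have hre : s.re = 3 := by simp [hs]
  have h1 : s ≠ 1 := by
    intro h
    rw [h] at hre
    norm_num at hre
  rw [riemannXi_eq (by rw [hre]; norm_num) h1, norm_mul, norm_mul, norm_mul, norm_Gammaℝ, hre]
  have e1 : 3 ≤ ‖s‖ := by
    have := Complex.re_le_norm s
    linarith
  have e2 : 2 ≤ ‖s - 1‖ := by
    have := Complex.re_le_norm (s - 1)
    simp only [Complex.sub_re, hre, Complex.one_re] at this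
    linarith
  have e3 : 1 / 8 ≤ Real.pi ^ (-3 / 2 : ℝ) := by
    have : (1 / 8 : ℝ) = 4 ^ (-3 / 2 : ℝ) := by
      rw [show (4 : ℝ) = 2 ^ (2 : ℝ) by norm_num, ← Real.rpow_mul (by norm_num)]
      norm_num
    rw [this]
    exact Real.rpow_le_rpow_of_nonpos Real.pi_pos Real.pi_le_four (by norm_num)
  have e4 : 1 / 2 * Real.exp (-(4 * |t|)) ≤ ‖Complex.Gamma (s / 2)‖ := by
    have hs2 : s / 2 = (1 / 2 + ((t / 2 : ℝ) : ℂ) * Complex.I) + 1 := by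
      rw [hs]
      push_cast
      ring
    have hne : (1 / 2 + ((t / 2 : ℝ) : ℂ) * Complex.I) ≠ 0 := by
      intro h
      have := congrArg Complex.re h
      simp at this
    rw [hs2, Complex.Gamma_add_one _ hne, norm_mul]
    have h3 := exp_le_norm_Gamma_half_add (t / 2)
    have h4 : 1 / 2 ≤ ‖(1 / 2 + ((t / 2 : ℝ) : ℂ) * Complex.I)‖ := by
      have := Complex.re_le_norm (1 / 2 + ((t / 2 : ℝ) : ℂ) * Complex.I)
      simpa using this
    have h5 : Real.exp (-(4 * |t|)) ≤ Real.exp (-(Real.pi * |t / 2|)) := by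
      apply Real.exp_le_exp.2
      rw [abs_div, abs_two]
      have := Real.pi_le_four
      have := abs_nonneg t
      nlinarith
    gcongr
    exact h5.trans h3
  have e5 := le_norm_riemannZeta (s := s) (by rw [hre]; norm_num)
  calc 1 / 16 * Real.exp (-(4 * |t|)) ≤
      3 * 2 * (1 / 8 * (1 / 2 * Real.exp (-(4 * |t|))) * (1 / 4)) := by
        have := Real.exp_pos (-(4 * |t|))
        linarith
    _ ≤ _ := by gcongr

theorem exists_norm_riemannXi_div_le (hRH : RiemannHypothesis) {a : ℝ} (ha : 0 < a)
    (ha' : a ≤ 1 / 4) : ∃ B > 0, ∀ s : ℂ, 1 / 2 ≤ s.re →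
      ‖riemannXi (s - a) / riemannXi (s + a)‖ ≤ Real.exp (B * (1 + |s.im|)) := by
  obtain ⟨C, hC, hxi⟩ := exists_norm_riemannXi_le
  set K : ℝ := 256 * C + 6 with hK
  have hK0 : 0 < K := by positivity
  have hexp : ∀ t : ℝ, C * (4 * (1 + |t|)) ^ 2 ≤
      Real.exp (K * (1 + |t|)) * (1 / 16 * Real.exp (-(4 * |t|))) := by
    intro t
    have ht := abs_nonneg t
    have h1 : 256 * C ≤ Real.exp (256 * C) := by
      have := Real.add_one_le_exp (256 * C)
      linarith
    have h2 : 1 + |t| ≤ Real.exp |t| := by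
      have := Real.add_one_le_exp |t|
      linarith
    calc C * (4 * (1 + |t|)) ^ 2 = (256 * C) * (1 + |t|) ^ 2 * (1 / 16) := by ring
      _ ≤ Real.exp (256 * C) * Real.exp |t| ^ 2 * (1 / 16) := by gcongr
      _ = Real.exp (256 * C + 6 * |t|) * (1 / 16 * Real.exp (-(4 * |t|))) := by
        rw [← Real.exp_nat_mul, ← Real.exp_add]
        have : Real.exp (256 * C + 6 * |t|) * (1 / 16 * Real.exp (-(4 * |t|))) =
          1 / 16 * (Real.exp (256 * C + 6 * |t|) * Real.exp (-(4 * |t|))) := by ring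
        rw [this, ← Real.exp_add, mul_comm]
        congr 2
        push_cast
        ring
      _ ≤ _ := by
        gcongr
        nlinarith [mul_nonneg hC.le ht]
  refine ⟨32 + K + 2 * K * (5 / 2 / a) , by positivity, fun s hs => ?_⟩
  have ht := abs_nonneg s.im
  have hne : riemannXi (s + a) ≠ 0 := riemannXi_ne_zero hRH (by simp; linarith)
  rw [norm_div, div_le_iff₀ (norm_pos_iff.2 hne)]
  rcases le_total 5 s.re with h5 | h5
  · refine (norm_riemannXi_sub_le_of_five_le h5 ha ha').trans ?_
    gcongr
    have h1 := Real.add_one_le_exp ((32 + K + 2 * K * (5 / 2 / a)) * (1 + |s.im|))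
    have h2 : 0 < K + 2 * K * (5 / 2 / a) := by positivity
    nlinarith
  · set c : ℂ := 3 + s.im * Complex.I with hc
    have hcre : c.re = 3 := by simp [hc]
    have hcim : c.im = s.im := by simp [hc]
    have hball : ∀ w ∈ Metric.ball c (5 / 2), 1 / 2 < w.re ∧ w.re < 11 / 2 ∧
        |w.im| ≤ |s.im| + 5 / 2 := by
      intro w hw
      rw [Metric.mem_ball, dist_eq_norm] at hw
      have h1 := Complex.abs_re_le_norm (w - c)
      have h2 := Complex.abs_im_le_norm (w - c)
      rw [Complex.sub_re, hcre] at h1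
      rw [Complex.sub_im, hcim] at h2
      have h3 := abs_le.1 (h1.trans hw.le)
      have h4 := abs_sub_abs_le_abs_sub w.im s.im
      have h5 := abs_lt.1 (h1.trans_lt hw)
      exact ⟨by linarith, by linarith, by linarith⟩
    have hlow := exp_le_norm_riemannXi_three_add s.im
    rw [← hc] at hlow
    have hb : ∀ w ∈ Metric.ball c (5 / 2),
        ‖riemannXi w‖ ≤ Real.exp (K * (1 + |s.im|)) * ‖riemannXi c‖ := by
      intro w hw
      obtain ⟨h1, h2, h3⟩ := hball w hw
      calc ‖riemannXi w‖ ≤ C * (1 + |w.im|) ^ 2 := hxi w (by linarith) (by linarith)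
        _ ≤ C * (4 * (1 + |s.im|)) ^ 2 := by
          gcongr
          linarith
        _ ≤ _ := hexp s.im
        _ ≤ _ := by gcongr
    have hdist : ‖s + a - c‖ ≤ 5 / 2 - a := by
      have : s + a - c = ((s.re + a - 3 : ℝ) : ℂ) := by
        apply Complex.ext <;> simp [hc]
      rw [this, Complex.norm_real, Real.norm_eq_abs]
      exact abs_le.2 ⟨by linarith, by linarith⟩
    have hmem : s + a ∈ Metric.ball c (5 / 2) := by
      rw [Metric.mem_ball, dist_eq_norm]
      linarith
    have hge := norm_ge_of_nonvanishing_on_ball (f := riemannXi) (c := c) (R := 5 / 2)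
      (M := K * (1 + |s.im|)) (by positivity) (by norm_num)
      differentiable_riemannXi.differentiableOn
      (fun w hw => riemannXi_ne_zero hRH (hball w hw).1) hb hmem
    have hfrac : 2 * (K * (1 + |s.im|)) * ‖s + a - c‖ / (5 / 2 - ‖s + a - c‖) ≤
        2 * K * (5 / 2 / a) * (1 + |s.im|) := by
      have h1 : ‖s + a - c‖ / (5 / 2 - ‖s + a - c‖) ≤ 5 / 2 / a := by
        gcongr
        · linarith
        · linarith
      calc _ = 2 * (K * (1 + |s.im|)) * (‖s + a - c‖ / (5 / 2 - ‖s + a - c‖)) := by ring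
        _ ≤ 2 * (K * (1 + |s.im|)) * (5 / 2 / a) := by gcongr
        _ = _ := by ring
    have hnum : ‖riemannXi (s - a)‖ ≤ Real.exp (K * (1 + |s.im|)) * ‖riemannXi c‖ := by
      calc ‖riemannXi (s - a)‖ ≤ C * (1 + |(s - a).im|) ^ 2 :=
            hxi _ (by simp; linarith) (by simp; linarith)
        _ ≤ C * (4 * (1 + |s.im|)) ^ 2 := by
          simp only [Complex.sub_im, Complex.ofReal_im, sub_zero]
          gcongr
          linarith
        _ ≤ _ := hexp s.im
        _ ≤ _ := by gcongr
    calc ‖riemannXi (s - a)‖ ≤ Real.exp (K * (1 + |s.im|)) * ‖riemannXi c‖ := hnum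
      _ = Real.exp (K * (1 + |s.im|) + 2 * K * (5 / 2 / a) * (1 + |s.im|)) *
          (‖riemannXi c‖ * Real.exp (-(2 * K * (5 / 2 / a) * (1 + |s.im|)))) := by
        rw [Real.exp_add, Real.exp_neg]
        field_simp
      _ ≤ Real.exp ((32 + K + 2 * K * (5 / 2 / a)) * (1 + |s.im|)) *
          (‖riemannXi c‖ * Real.exp (-(2 * (K * (1 + |s.im|)) * ‖s + a - c‖ /
            (5 / 2 - ‖s + a - c‖)))) := by
        gcongr
        linarith
      _ ≤ _ := by gcongr

/-- Under RH, `|ξ|` increases as one moves to the right of the critical line. -/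
theorem norm_riemannXi_sub_le (hRH : RiemannHypothesis) {a : ℝ} (ha : 0 < a) (ha' : a ≤ 1 / 4)
    {s : ℂ} (hs : 1 / 2 ≤ s.re) : ‖riemannXi (s - a)‖ ≤ ‖riemannXi (s + a)‖ := by
  obtain ⟨B, hB, hbound⟩ := exists_norm_riemannXi_div_le hRH ha ha'
  set f : ℂ → ℂ := fun z => riemannXi (z + 1 / 2 - a) / riemannXi (z + 1 / 2 + a) with hf
  have hne : ∀ z : ℂ, 0 ≤ z.re → riemannXi (z + 1 / 2 + a) ≠ 0 := fun z hz =>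
    riemannXi_ne_zero hRH (by simp; linarith)
  have hdiff : DiffContOnCl ℂ f {z | 0 < z.re} := by
    refine DifferentiableOn.diffContOnCl fun z hz => DifferentiableAt.differentiableWithinAt ?_
    have hz0 : 0 ≤ z.re := by
      have hcl : IsClosed {z : ℂ | 0 ≤ z.re} := isClosed_le continuous_const Complex.continuous_re
      have hsub : {z : ℂ | 0 < z.re} ⊆ {z | 0 ≤ z.re} := by
        intro w hw
        simp only [Set.mem_ofPred_eq] at hw ⊢
        exact hw.le
      exact closure_minimal hsub hcl hz
    have hd := differentiable_riemannXi
    exact DifferentiableAt.div (by fun_prop) (by fun_prop) (hne z hz0)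
  have hfb : ∀ z : ℂ, 0 ≤ z.re → ‖f z‖ ≤ Real.exp (B * (1 + |z.im|)) := by
    intro z hz
    have := hbound (z + 1 / 2) (by simp; linarith)
    simpa [hf] using this
  have hPL := PhragmenLindelof.right_half_plane_of_bounded_on_real (f := f) (C := 1)
    (z := s - 1 / 2) hdiff ?_ ?_ ?_ (by simp; linarith)
  · simp only [hf, sub_add_cancel, norm_div] at hPL
    have h0 := hne (s - 1 / 2) (by simp; linarith)
    rw [sub_add_cancel] at h0
    rwa [div_le_one (norm_pos_iff.2 h0)] at hPL
  · refine ⟨1, by norm_num, B, ?_⟩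
    refine Asymptotics.IsBigO.of_bound (Real.exp B) ?_
    refine eventually_inf_principal.2 (Eventually.of_forall fun z (hz : 0 < z.re) => ?_)
    refine (hfb z hz.le).trans ?_
    rw [Real.norm_eq_abs, abs_of_pos (Real.exp_pos _), ← Real.exp_add, Real.rpow_one]
    have := Complex.abs_im_le_norm z
    gcongr
    nlinarith
  · refine Filter.isBoundedUnder_of_eventually_le (a := Real.exp B) ?_
    filter_upwards [eventually_ge_atTop 0] with x hx
    have := hfb x (by simpa using hx)
    simpa using this
  · intro x
    simp only [hf, norm_div]
    have h : riemannXi (x * Complex.I + 1 / 2 - a) =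
        starRingEnd ℂ (riemannXi (x * Complex.I + 1 / 2 + a)) := by
      rw [← riemannXi_conj, ← riemannXi_one_sub]
      congr 1
      apply Complex.ext <;> simp
      ring
    rw [h, RCLike.norm_conj]
    exact div_self_le_one _

theorem re_logDeriv_riemannXi_nonneg (hRH : RiemannHypothesis) {s : ℂ} (hs : 1 / 2 < s.re) :
    0 ≤ (logDeriv riemannXi s).re := by
  have hx : HasDerivAt riemannXi (deriv riemannXi s) s := (differentiable_riemannXi s).hasDerivAt
  have hp : HasDerivAt (fun a : ℝ => riemannXi (s + a)) (deriv riemannXi s) 0 := by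
    have h1 : HasDerivAt (fun z : ℂ => riemannXi (s + z)) (deriv riemannXi s) ((0 : ℝ) : ℂ) := by
      have h2 : HasDerivAt riemannXi (deriv riemannXi s) (s + ((0 : ℝ) : ℂ)) := by simpa using hx
      exact HasDerivAt.comp_const_add s _ h2
    exact h1.comp_ofReal
  have hm : HasDerivAt (fun a : ℝ => riemannXi (s - a)) (-deriv riemannXi s) 0 := by
    have h1 : HasDerivAt (fun z : ℂ => riemannXi (s - z)) (-deriv riemannXi s) ((0 : ℝ) : ℂ) := by
      have h2 : HasDerivAt riemannXi (deriv riemannXi s) (s - ((0 : ℝ) : ℂ)) := by simpa using hx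
      exact HasDerivAt.comp_const_sub s _ h2
    exact h1.comp_ofReal
  have hd := hp.norm_sq.sub hm.norm_sq
  simp only [Complex.ofReal_zero, add_zero, sub_zero, Complex.inner] at hd
  have ht := (hasDerivAt_iff_tendsto_slope.1 hd).mono_left
    (nhdsWithin_mono (0 : ℝ) (fun x (hx : x ∈ Set.Ioi (0 : ℝ)) => (ne_of_gt hx)))
  have hnn := ge_of_tendsto (b := 0) ht (by
    filter_upwards [Ioc_mem_nhdsGT (show (0 : ℝ) < 1 / 4 by norm_num)] with a ha
    have h := norm_riemannXi_sub_le hRH ha.1 ha.2 hs.le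
    rw [slope_def_field]
    simp only [Pi.sub_apply, Complex.ofReal_zero, add_zero, sub_zero, sub_self]
    have h2 : ‖riemannXi (s - a)‖ ^ 2 ≤ ‖riemannXi (s + a)‖ ^ 2 := by gcongr
    exact div_nonneg (by linarith) ha.1.le)
  have hne := riemannXi_ne_zero hRH hs
  rw [logDeriv_apply, Complex.div_re, ← add_div]
  refine div_nonneg ?_ (Complex.normSq_nonneg _)
  simp at hnn
  nlinarith

theorem differentiableAt_Gamma_of_re_pos {s : ℂ} (hs : 0 < s.re) :
    DifferentiableAt ℂ Complex.Gamma s := by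
  refine Complex.differentiableAt_Gamma s fun m h => ?_
  rw [h] at hs
  have : (0 : ℝ) ≤ m := m.cast_nonneg
  simp at hs
  linarith

theorem exists_norm_Gamma_le_near : ∃ K ≥ 1, ∀ z w : ℂ, 1 / 4 ≤ z.re → z.re ≤ 7 / 4 →
    w ∈ Metric.ball z (1 / 8) → ‖Complex.Gamma w‖ ≤ K * ‖z‖ * ‖Complex.Gamma z‖ := by
  have hc : ContinuousOn Real.Gamma (Set.Icc (1 / 8) 3) := fun x hx =>
    (Real.differentiableAt_Gamma fun m h => by
      have := m.cast_nonneg (α := ℝ)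
      linarith [hx.1]).continuousAt.continuousWithinAt
  have hpos : ∀ x ∈ Set.Icc (1 / 8 : ℝ) 3, 0 < Real.Gamma x := fun x hx =>
    Real.Gamma_pos_of_pos (by linarith [hx.1])
  obtain ⟨A, hA⟩ := isCompact_Icc.exists_bound_of_continuousOn hc
  obtain ⟨B, hB⟩ := isCompact_Icc.exists_bound_of_continuousOn
    (hc.inv₀ fun x hx => (hpos x hx).ne')
  obtain ⟨D, hD⟩ := (isCompact_closedBall (1 : ℂ) (1 / 8)).exists_bound_of_continuousOn
    Complex.differentiable_one_div_Gamma.continuous.continuousOn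
  have hA0 : 0 ≤ A := (norm_nonneg _).trans (hA 1 (by norm_num))
  have hB0 : 0 ≤ B := (norm_nonneg _).trans (hB 1 (by norm_num))
  have hD0 : 0 ≤ D := (norm_nonneg _).trans (hD 1 (by simp))
  refine ⟨A * A * B * D + 1, by
    have : 0 ≤ A * A * B * D := by positivity
    show (1 : ℝ) ≤ _
    linarith, fun z w hz hz' hw => ?_⟩
  have hwn : ‖z - w‖ < 1 / 8 := by
    rw [← dist_eq_norm, dist_comm]; exact hw
  have hre := (Complex.abs_re_le_norm (z - w)).trans hwn.le
  rw [Complex.sub_re, abs_le] at hre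
  set v : ℂ := z + 1 - w with hv
  have hvre : v.re = z.re + 1 - w.re := by simp [hv]
  have hvmem : v ∈ Metric.closedBall (1 : ℂ) (1 / 8) := by
    rw [mem_closedBall_iff_norm]
    have : v - 1 = z - w := by rw [hv]; ring
    rw [this]; exact hwn.le
  have hv0 : 0 < v.re := by rw [hvre]; linarith
  have h := norm_Gamma_mul_le (u := w) (v := v) (by linarith) hv0
  have huv : w + v = z + 1 := by rw [hv]; ring
  have hz0 : z ≠ 0 := by
    rintro rfl
    norm_num at hz
  rw [huv, Complex.Gamma_add_one z hz0, norm_mul] at h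
  have hre2 : w.re + v.re = z.re + 1 := by rw [hvre]; ring
  rw [hre2] at h
  have m1 : z.re + 1 ∈ Set.Icc (1 / 8 : ℝ) 3 := ⟨by linarith, by linarith⟩
  have m2 : w.re ∈ Set.Icc (1 / 8 : ℝ) 3 := ⟨by linarith, by linarith⟩
  have m3 : v.re ∈ Set.Icc (1 / 8 : ℝ) 3 := ⟨by linarith, by linarith⟩
  have b1 := (le_abs_self _).trans (hB _ m1)
  have b2 := (le_abs_self _).trans (hA _ m2)
  have b3 := (le_abs_self _).trans (hA _ m3)
  have b4 := hD _ hvmem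
  have p1 := hpos _ m1
  have p2 := hpos _ m2
  have p3 := hpos _ m3
  have hvG : 0 < ‖Complex.Gamma v‖ := norm_pos_iff.2 (Complex.Gamma_ne_zero_of_re_pos hv0)
  rw [norm_inv] at b4
  rw [Pi.inv_apply] at b1
  have e1 : ‖Complex.Gamma w‖ = ‖Complex.Gamma w‖ * ‖Complex.Gamma v‖ * Real.Gamma (z.re + 1) *
      (Real.Gamma (z.re + 1))⁻¹ * ‖Complex.Gamma v‖⁻¹ := by
    field_simp
  calc ‖Complex.Gamma w‖ ≤ (‖z‖ * ‖Complex.Gamma z‖ * (A * A)) * B * D := by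
        have h' : ‖Complex.Gamma w‖ * ‖Complex.Gamma v‖ * Real.Gamma (z.re + 1) ≤
            ‖z‖ * ‖Complex.Gamma z‖ * (A * A) := h.trans (by gcongr)
        rw [e1]
        exact mul_le_mul (mul_le_mul h' b1 (by positivity) (by positivity)) b4 (by positivity)
          (by positivity)
    _ = (A * A * B * D) * (‖z‖ * ‖Complex.Gamma z‖) := by ring
    _ ≤ (A * A * B * D + 1) * (‖z‖ * ‖Complex.Gamma z‖) := by
        gcongr
        linarith
    _ = _ := by ring

theorem exists_norm_logDeriv_Gamma_le : ∃ K ≥ 1, ∀ z : ℂ, 1 / 4 ≤ z.re → z.re ≤ 7 / 4 →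
    ‖logDeriv Complex.Gamma z‖ ≤ 32 * Real.log (K * (‖z‖ + 2)) := by
  obtain ⟨K, hK, h⟩ := exists_norm_Gamma_le_near
  refine ⟨K, hK, fun z hz hz' => ?_⟩
  have hre : ∀ w ∈ Metric.ball z (1 / 8 : ℝ), 0 < w.re := fun w hw => by
    have := (Complex.abs_re_le_norm (w - z)).trans (mem_ball_iff_norm.1 hw).le
    rw [Complex.sub_re, abs_le] at this
    linarith
  have hn := norm_nonneg z
  have h1 : 1 < K * (‖z‖ + 2) := by nlinarith [show (1 : ℝ) ≤ K from hK]
  have := norm_logDeriv_le_of_nonvanishing_on_ball (f := Complex.Gamma) (c := z)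
    (Real.log_pos h1) (show (0 : ℝ) < 1 / 8 by norm_num)
    (fun w hw => (differentiableAt_Gamma_of_re_pos (hre w hw)).differentiableWithinAt)
    (fun w hw => Complex.Gamma_ne_zero_of_re_pos (hre w hw)) (fun w hw => by
      rw [Real.exp_log (by linarith)]
      refine (h z w hz hz' hw).trans ?_
      gcongr
      linarith)
  refine this.trans (le_of_eq (by ring))

theorem exists_norm_logDeriv_Gammaℝ_le : ∃ C > 0, ∀ w : ℂ, 1 / 2 ≤ w.re → w.re ≤ 7 / 2 →
    ‖logDeriv Complex.Gammaℝ w‖ ≤ C * Real.log (|w.im| + 4) := by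
  obtain ⟨K, hK, h⟩ := exists_norm_logDeriv_Gamma_le
  have hK' : (1 : ℝ) ≤ K := hK
  refine ⟨‖(-1 / 2 : ℂ) * Complex.log Real.pi‖ + 16 * (Real.log K + 1), by
    have := Real.log_nonneg hK'
    positivity, fun w hw hw' => ?_⟩
  have hre : (w / 2).re = w.re / 2 := by simp
  have hpi : (Real.pi : ℂ) ≠ 0 := by exact_mod_cast Real.pi_ne_zero
  have h1 : logDeriv Complex.Gammaℝ w =
      (-1 / 2 : ℂ) * Complex.log Real.pi + 1 / 2 * logDeriv Complex.Gamma (w / 2) := by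
    have hG : HasDerivAt Complex.Gamma (deriv Complex.Gamma (w / 2)) (w / 2) :=
      (differentiableAt_Gamma_of_re_pos (by rw [hre]; linarith)).hasDerivAt
    have hG2 : HasDerivAt (fun s : ℂ => Complex.Gamma (s / 2))
        (deriv Complex.Gamma (w / 2) * (1 / 2)) w :=
      HasDerivAt.comp (h₂ := Complex.Gamma) w hG ((hasDerivAt_id w).div_const 2)
    have hP : HasDerivAt (fun s : ℂ => (Real.pi : ℂ) ^ (-s / 2))
        ((Real.pi : ℂ) ^ (-w / 2) * Complex.log Real.pi * (-1 / 2)) w :=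
      ((hasDerivAt_id w).neg.div_const 2).const_cpow (Or.inl hpi)
    have hd := hP.mul hG2
    have hne : (Real.pi : ℂ) ^ (-w / 2) ≠ 0 := by simp [Complex.cpow_eq_zero_iff, hpi]
    have hne2 : Complex.Gamma (w / 2) ≠ 0 :=
      Complex.Gamma_ne_zero_of_re_pos (by rw [hre]; linarith)
    have hfun : Complex.Gammaℝ =
        (fun s : ℂ => (Real.pi : ℂ) ^ (-s / 2)) * fun s => Complex.Gamma (s / 2) := by
      ext s; rfl
    rw [logDeriv_apply, logDeriv_apply, hfun, hd.deriv]
    simp only [Pi.mul_apply]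
    field_simp
  have hlog1 : 1 ≤ Real.log (|w.im| + 4) := by
    rw [Real.le_log_iff_exp_le (by positivity)]
    have := Real.exp_one_lt_d9
    have := abs_nonneg w.im
    linarith
  have h2 := h (w / 2) (by rw [hre]; linarith) (by rw [hre]; linarith)
  have hn : ‖w / 2‖ + 2 ≤ |w.im| + 4 := by
    have := Complex.norm_le_abs_re_add_abs_im w
    rw [abs_of_nonneg (by linarith : 0 ≤ w.re)] at this
    rw [norm_div, Complex.norm_ofNat]
    have := abs_nonneg w.im
    linarith
  have h3 : Real.log (K * (‖w / 2‖ + 2)) ≤ (Real.log K + 1) * Real.log (|w.im| + 4) := by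
    rw [Real.log_mul (by linarith) (by positivity)]
    have : Real.log (‖w / 2‖ + 2) ≤ Real.log (|w.im| + 4) :=
      Real.log_le_log (by positivity) hn
    have := Real.log_nonneg hK'
    nlinarith
  rw [h1]
  refine (norm_add_le _ _).trans ?_
  rw [norm_mul (1 / 2 : ℂ)]
  have h4 : ‖(1 / 2 : ℂ)‖ = 1 / 2 := by simp
  rw [h4]
  have := norm_nonneg ((-1 / 2 : ℂ) * Complex.log Real.pi)
  nlinarith

/-- The function `- deriv ζ w / ζ w - 1 / (w - 1)`, continued across `w = 1`. -/
noncomputable def negLogDerivZeta (w : ℂ) : ℂ :=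
  1 / w + logDeriv Complex.Gammaℝ w - logDeriv riemannXi w

theorem differentiableAt_Gammaℝ {w : ℂ} (hw : 0 < w.re) :
    DifferentiableAt ℂ Complex.Gammaℝ w := by
  have h := Complex.differentiable_Gammaℝ_inv w
  have h2 := h.inv (inv_ne_zero (Complex.Gammaℝ_ne_zero_of_re_pos hw))
  have h3 : (fun s => s.Gammaℝ⁻¹)⁻¹ = Complex.Gammaℝ := by
    ext s
    simp
  rwa [h3] at h2

theorem differentiableAt_negLogDerivZeta (hRH : RiemannHypothesis) {w : ℂ} (hw : 1 / 2 < w.re) :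
    DifferentiableAt ℂ negLogDerivZeta w := by
  have hw0 : w ≠ 0 := by rintro rfl; norm_num at hw
  have hG : DifferentiableAt ℂ (deriv Complex.Gammaℝ) w := by
    have : DifferentiableOn ℂ Complex.Gammaℝ {z | 0 < z.re} := fun z hz =>
      (differentiableAt_Gammaℝ hz).differentiableWithinAt
    have ho : IsOpen {z : ℂ | 0 < z.re} := isOpen_lt continuous_const Complex.continuous_re
    exact (this.deriv ho).differentiableAt (ho.mem_nhds (show 0 < w.re by linarith))
  have hX : DifferentiableAt ℂ (deriv riemannXi) w :=
    (differentiable_riemannXi.contDiff (n := 2)).differentiable_deriv_two w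
  unfold negLogDerivZeta
  simp only [logDeriv_apply]
  exact (((differentiableAt_const 1).div differentiableAt_fun_id hw0).add
    (hG.div (differentiableAt_Gammaℝ (by linarith))
    (Complex.Gammaℝ_ne_zero_of_re_pos (by linarith)))).sub
    (hX.div (differentiable_riemannXi w) (riemannXi_ne_zero hRH hw))

theorem exists_re_negLogDerivZeta_le (hRH : RiemannHypothesis) : ∃ C > 0, ∀ w : ℂ,
    1 / 2 < w.re → w.re ≤ 7 / 2 → (negLogDerivZeta w).re ≤ C * Real.log (|w.im| + 4) := by
  obtain ⟨C, hC, h⟩ := exists_norm_logDeriv_Gammaℝ_le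
  refine ⟨C + 2, by linarith, fun w hw hw' => ?_⟩
  have h1 := (Complex.re_le_norm _).trans (h w hw.le hw')
  have h2 := re_logDeriv_riemannXi_nonneg hRH hw
  have h3 : (1 / w).re ≤ 2 := by
    refine (Complex.re_le_norm _).trans ?_
    rw [norm_div, norm_one, div_le_iff₀ (norm_pos_iff.2 (by rintro rfl; norm_num at hw))]
    have := Complex.re_le_norm w
    linarith
  have hlog1 : 1 ≤ Real.log (|w.im| + 4) := by
    rw [Real.le_log_iff_exp_le (by positivity)]
    have := Real.exp_one_lt_d9
    have := abs_nonneg w.im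
    linarith
  simp only [negLogDerivZeta, Complex.sub_re, Complex.add_re]
  nlinarith

theorem negLogDerivZeta_eq {w : ℂ} (hw : 1 < w.re) :
    negLogDerivZeta w =
      LSeries (fun n => (ArithmeticFunction.vonMangoldt n : ℂ)) w - 1 / (w - 1) := by
  have hw0 : w ≠ 0 := by rintro rfl; norm_num at hw
  have hw1 : w ≠ 1 := by rintro rfl; norm_num at hw
  have hw1' : w - 1 ≠ 0 := sub_ne_zero.2 hw1
  have hz : riemannZeta w ≠ 0 := riemannZeta_ne_zero_of_one_lt_re hw
  have hg : Complex.Gammaℝ w ≠ 0 := Complex.Gammaℝ_ne_zero_of_re_pos (by linarith)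
  have hdg := (differentiableAt_Gammaℝ (w := w) (by linarith))
  have hdz := differentiableAt_riemannZeta hw1
  have he : riemannXi =ᶠ[nhds w]
      fun s => s * (s - 1) * (Complex.Gammaℝ s * riemannZeta s) := by
    have ho : IsOpen {z : ℂ | 1 < z.re} := isOpen_lt continuous_const Complex.continuous_re
    filter_upwards [ho.mem_nhds (show 1 < w.re from hw)] with s hs
    have hs' : 1 < s.re := hs
    exact riemannXi_eq (by linarith) (by rintro rfl; norm_num at hs')
  have h1 : logDeriv riemannXi w = 1 / w + 1 / (w - 1) + (logDeriv Complex.Gammaℝ w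
      + logDeriv riemannZeta w) := by
    have hl : logDeriv riemannXi w =
        logDeriv (fun s => s * (s - 1) * (Complex.Gammaℝ s * riemannZeta s)) w := by
      rw [logDeriv_apply, logDeriv_apply, he.deriv_eq, he.eq_of_nhds]
    rw [hl, logDeriv_mul (f := fun s => s * (s - 1))
        (g := fun s => Complex.Gammaℝ s * riemannZeta s) w (mul_ne_zero hw0 hw1')
        (mul_ne_zero hg hz)
        (by fun_prop) (hdg.mul hdz), logDeriv_mul w hg hz hdg hdz,
      logDeriv_mul (f := fun s : ℂ => s) (g := fun s => s - 1) w hw0 hw1' (by fun_prop)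
        (by fun_prop)]
    simp [logDeriv_apply]
  rw [negLogDerivZeta, h1, ArithmeticFunction.LSeries_vonMangoldt_eq_deriv_riemannZeta_div hw,
    logDeriv_apply riemannZeta]
  ring

theorem exists_norm_negLogDerivZeta_le_of_two_le : ∃ C > 0, ∀ w : ℂ, 2 ≤ w.re →
    ‖negLogDerivZeta w‖ ≤ C := by
  have hs : LSeriesSummable (fun n => (ArithmeticFunction.vonMangoldt n : ℂ)) 2 :=
    ArithmeticFunction.LSeriesSummable_vonMangoldt (by norm_num)
  refine ⟨∑' n, ‖LSeries.term (fun n => (ArithmeticFunction.vonMangoldt n : ℂ)) 2 n‖ + 1, by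
    positivity, fun w hw => ?_⟩
  rw [negLogDerivZeta_eq (by linarith)]
  refine (norm_sub_le _ _).trans (add_le_add ?_ ?_)
  · have hle : ∀ n, ‖LSeries.term (fun n => (ArithmeticFunction.vonMangoldt n : ℂ)) w n‖ ≤
        ‖LSeries.term (fun n => (ArithmeticFunction.vonMangoldt n : ℂ)) 2 n‖ := fun n =>
      LSeries.norm_term_le_of_re_le_re _ (by simpa using hw) n
    have hsw := Summable.of_nonneg_of_le (fun n => norm_nonneg _) hle hs.norm
    exact (norm_tsum_le_tsum_norm hsw).trans (hsw.tsum_le_tsum hle hs.norm)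
  · have h := Complex.re_le_norm (w - 1)
    rw [Complex.sub_re, Complex.one_re] at h
    rw [norm_div, norm_one, div_le_one (by linarith)]
    linarith

theorem exists_norm_negLogDerivZeta_le (hRH : RiemannHypothesis) {δ : ℝ} (hδ : 0 < δ) :
    ∃ C > 0, ∀ w : ℂ, 1 / 2 + δ ≤ w.re → ‖negLogDerivZeta w‖ ≤ C * Real.log (|w.im| + 4) := by
  obtain ⟨C, hC, h⟩ := exists_re_negLogDerivZeta_le hRH
  obtain ⟨D, hD, hD'⟩ := exists_norm_negLogDerivZeta_le_of_two_le
  refine ⟨D + (6 * C + 3 * D) / δ, by positivity, fun w hw => ?_⟩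
  have hlog1 : 1 ≤ Real.log (|w.im| + 4) := by
    rw [Real.le_log_iff_exp_le (by positivity)]
    have := Real.exp_one_lt_d9
    have := abs_nonneg w.im
    linarith
  rcases le_or_gt 2 w.re with h2 | h2
  · have : 0 ≤ (6 * C + 3 * D) / δ := by positivity
    nlinarith [hD' w h2]
  set c : ℂ := 2 + w.im * Complex.I with hc
  have hwc : ‖w - c‖ = 2 - w.re := by
    have : w - c = ((w.re - 2 : ℝ) : ℂ) := by
      apply Complex.ext <;> simp [hc]
    rw [this, Complex.norm_real, Real.norm_eq_abs, abs_of_neg (by linarith)]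
    ring
  set M := 2 * C * Real.log (|w.im| + 4) with hM
  have hM0 : 0 < M := by positivity
  have hball : ∀ z ∈ Metric.ball c (3 / 2 : ℝ), 1 / 2 < z.re ∧ z.re ≤ 7 / 2 ∧
      |z.im| ≤ |w.im| + 3 / 2 := by
    intro z hz
    rw [mem_ball_iff_norm] at hz
    have h1 := (Complex.abs_re_le_norm (z - c)).trans_lt hz
    have h2 := (Complex.abs_im_le_norm (z - c)).trans_lt hz
    simp [hc, abs_lt] at h1 h2
    refine ⟨by linarith, by linarith, ?_⟩
    rw [abs_le]
    have := le_abs_self w.im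
    have := neg_abs_le w.im
    constructor <;> linarith
  have hb := norm_le_of_re_le_of_mem_ball (f := negLogDerivZeta) (c := c) (z := w) (M := M)
    (R := 3 / 2) hM0 (by norm_num)
    (fun z hz => (differentiableAt_negLogDerivZeta hRH (hball z hz).1).differentiableWithinAt)
    (fun z hz => by
      obtain ⟨a1, a2, a3⟩ := hball z hz
      refine (h z a1 a2).trans ?_
      have h5 : Real.log (|z.im| + 4) ≤ 2 * Real.log (|w.im| + 4) := by
        rw [← Real.log_rpow (by positivity)]
        refine Real.log_le_log (by positivity) ?_
        have := abs_nonneg w.im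
        norm_num
        nlinarith
      rw [hM]
      nlinarith)
    (by rw [mem_ball_iff_norm, hwc]; linarith)
  have hDc := hD' c (by simp [hc])
  rw [hwc, ← add_div] at hb
  have h7 : δ ≤ 3 / 2 - (2 - w.re) := by linarith
  have h8 : 2 * M * (2 - w.re) + ‖negLogDerivZeta c‖ * (3 / 2 + (2 - w.re)) ≤
      (6 * C + 3 * D) * Real.log (|w.im| + 4) := by
    have e1 : 2 * M * (2 - w.re) ≤ 2 * M * (3 / 2) := by
      gcongr; linarith
    have e2 : ‖negLogDerivZeta c‖ * (3 / 2 + (2 - w.re)) ≤ D * 3 := by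
      gcongr
      linarith
    have e3 : D * 3 ≤ 3 * D * Real.log (|w.im| + 4) := by nlinarith
    rw [hM] at e1
    linarith
  have h9 : 0 ≤ (6 * C + 3 * D) * Real.log (|w.im| + 4) := by positivity
  calc ‖negLogDerivZeta w‖ ≤ _ := hb
    _ ≤ (6 * C + 3 * D) * Real.log (|w.im| + 4) / δ := by gcongr
    _ ≤ D * Real.log (|w.im| + 4) + (6 * C + 3 * D) * Real.log (|w.im| + 4) / δ := by
        have : 0 ≤ D * Real.log (|w.im| + 4) := by positivity
        linarith
    _ = _ := by ring

/-- The (unnormalised) Fejér kernel `(sin (L y / 2) / (y / 2)) ^ 2`. -/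
noncomputable def fejer (L y : ℝ) : ℝ := L ^ 2 * Real.sinc (L * y / 2) ^ 2

theorem fejer_nonneg (L y : ℝ) : 0 ≤ fejer L y := by unfold fejer; positivity

@[fun_prop]
theorem continuous_fejer (L : ℝ) : Continuous (fejer L) := by
  have := Real.continuous_sinc
  unfold fejer
  fun_prop

theorem fejer_of_ne_zero {L y : ℝ} (hL : L ≠ 0) (hy : y ≠ 0) :
    fejer L y = 4 * Real.sin (L * y / 2) ^ 2 / y ^ 2 := by
  rw [fejer, Real.sinc_of_ne_zero (by positivity)]
  field_simp
  ring

theorem fejer_le_sq (L y : ℝ) : fejer L y ≤ L ^ 2 := by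
  have h := Real.abs_sinc_le_one (L * y / 2)
  have h2 : Real.sinc (L * y / 2) ^ 2 ≤ 1 := by
    rw [← sq_abs]; exact pow_le_one₀ (abs_nonneg _) h
  unfold fejer
  nlinarith [sq_nonneg L]

theorem fejer_mul_sq_le {L : ℝ} (hL : L ≠ 0) (y : ℝ) : fejer L y * y ^ 2 ≤ 4 := by
  rcases eq_or_ne y 0 with rfl | hy
  · simp
  · rw [fejer_of_ne_zero hL hy, div_mul_cancel₀ _ (by positivity)]
    nlinarith [Real.sin_sq_le_one (L * y / 2)]

theorem fejer_le {L : ℝ} (hL : L ≠ 0) (y : ℝ) : fejer L y ≤ (L ^ 2 + 4) * (1 + y ^ 2)⁻¹ := by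
  rw [← div_eq_mul_inv, le_div_iff₀ (by positivity)]
  nlinarith [fejer_le_sq L y, fejer_mul_sq_le hL y]

theorem integrable_fejer {L : ℝ} (hL : L ≠ 0) : Integrable (fejer L) := by
  refine (integrable_inv_one_add_sq.const_mul (L ^ 2 + 4)).mono'
    (continuous_fejer L).aestronglyMeasurable (Eventually.of_forall fun y => ?_)
  rw [Real.norm_eq_abs, abs_of_nonneg (fejer_nonneg L y)]
  exact fejer_le hL y

theorem one_le_log_abs_add_four (t : ℝ) : 1 ≤ Real.log (|t| + 4) := by
  rw [Real.le_log_iff_exp_le (by positivity)]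
  have := Real.exp_one_lt_d9
  have := abs_nonneg t
  linarith

theorem log_abs_add_add_four_le (t y : ℝ) :
    Real.log (|t + y| + 4) ≤ Real.log (|t| + 4) + Real.log (|y| + 4) := by
  rw [← Real.log_mul (by positivity) (by positivity)]
  refine Real.log_le_log (by positivity) ?_
  nlinarith [abs_add_le t y, abs_nonneg t, abs_nonneg y]

@[fun_prop]
theorem continuous_log_abs_add_four : Continuous fun y : ℝ => Real.log (|y| + 4) :=
  Continuous.log (by fun_prop) fun y => by positivity

theorem log_abs_add_four_mul_inv_le (y : ℝ) :
    Real.log (|y| + 4) * (1 + y ^ 2)⁻¹ ≤ 8 * (1 + ‖y‖) ^ (-(3 / 2) : ℝ) := by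
  rw [Real.norm_eq_abs]
  have h0 := abs_nonneg y
  have h1 : Real.log (|y| + 4) ≤ 4 * (1 + |y|) ^ (1 / 2 : ℝ) := by
    have e1 : Real.log (|y| + 4) ≤ Real.log (4 * (1 + |y|)) :=
      Real.log_le_log (by positivity) (by linarith)
    rw [Real.log_mul (by norm_num) (by positivity)] at e1
    have e2 : Real.log 4 ≤ 2 := by
      rw [show (4 : ℝ) = 2 ^ 2 by norm_num, Real.log_pow]
      have := Real.log_two_lt_d9
      norm_num
      linarith
    have e3 := Real.log_le_rpow_div (show 0 ≤ 1 + |y| by positivity)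
      (show (0 : ℝ) < 1 / 2 by norm_num)
    have e4 : (1 : ℝ) ≤ (1 + |y|) ^ (1 / 2 : ℝ) :=
      Real.one_le_rpow (by linarith) (by norm_num)
    linarith
  have h2 : (1 + |y|) ^ 2 / 2 ≤ 1 + y ^ 2 := by
    rw [← sq_abs y]
    nlinarith [sq_nonneg (|y| - 1)]
  have h3 : (1 + |y|) ^ (-(3 / 2) : ℝ) = (1 + |y|) ^ (1 / 2 : ℝ) * ((1 + |y|) ^ 2)⁻¹ := by
    rw [← Real.rpow_natCast (1 + |y|) 2, ← Real.rpow_neg (by positivity),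
      ← Real.rpow_add (by positivity)]
    norm_num
  rw [h3]
  have h4 : (1 + y ^ 2)⁻¹ ≤ 2 * ((1 + |y|) ^ 2)⁻¹ := by
    rw [show 2 * ((1 + |y|) ^ 2)⁻¹ = ((1 + |y|) ^ 2 / 2)⁻¹ by field_simp]
    exact inv_anti₀ (by positivity) h2
  calc Real.log (|y| + 4) * (1 + y ^ 2)⁻¹
      ≤ (4 * (1 + |y|) ^ (1 / 2 : ℝ)) * (2 * ((1 + |y|) ^ 2)⁻¹) := by gcongr
    _ = _ := by ring

theorem integrable_log_mul_inv :
    Integrable fun y : ℝ => Real.log (|y| + 4) * (1 + y ^ 2)⁻¹ := by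
  refine ((integrable_one_add_norm (E := ℝ) (r := 3 / 2) (by norm_num)).const_mul 8).mono' ?_
    (Eventually.of_forall fun y => ?_)
  · refine Continuous.aestronglyMeasurable ?_
    refine Continuous.mul (by fun_prop) (Continuous.inv₀ (by fun_prop) fun y => by positivity)
  · rw [Real.norm_eq_abs, abs_of_nonneg]
    · exact log_abs_add_four_mul_inv_le y
    · have := one_le_log_abs_add_four y
      positivity

theorem integrable_log_mul_fejer {L : ℝ} (hL : L ≠ 0) :
    Integrable fun y : ℝ => Real.log (|y| + 4) * fejer L y := by
  refine (integrable_log_mul_inv.const_mul (L ^ 2 + 4)).mono'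
    (Continuous.aestronglyMeasurable (by fun_prop)) (Eventually.of_forall fun y => ?_)
  have := one_le_log_abs_add_four y
  have := fejer_nonneg L y
  rw [Real.norm_eq_abs, abs_of_nonneg (by positivity)]
  calc _ ≤ Real.log (|y| + 4) * ((L ^ 2 + 4) * (1 + y ^ 2)⁻¹) := by
        gcongr
        exact fejer_le hL y
    _ = _ := by ring

theorem integral_exp_mul_mul_sub (L : ℝ) {α : ℂ} (hα : α ≠ 0) :
    ∫ v in (0 : ℝ)..L, Complex.exp (α * v) * (L - v) =
      (Complex.exp (α * L) - α * L - 1) / α ^ 2 := by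
  have hd : ∀ v : ℝ, HasDerivAt
      (fun v : ℝ => Complex.exp (α * v) * (L - v) / α + Complex.exp (α * v) / α ^ 2)
      (Complex.exp (α * v) * (L - v)) v := by
    intro v
    have h1 : HasDerivAt (fun z : ℂ => Complex.exp (α * z)) (Complex.exp (α * v) * α) v := by
      have := ((hasDerivAt_id (v : ℂ)).const_mul α).cexp
      simpa using this
    have h2 : HasDerivAt (fun z : ℂ => (L : ℂ) - z) (-1) v := (hasDerivAt_id _).const_sub _
    have h3 := (((h1.mul h2).div_const α).add (h1.div_const (α ^ 2))).comp_ofReal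
    refine h3.congr_deriv ?_
    field_simp
    ring
  rw [intervalIntegral.integral_eq_sub_of_hasDerivAt (fun v _ => hd v)
    (Continuous.intervalIntegrable (by fun_prop) _ _)]
  simp
  field_simp
  ring

/-- The triangle function. -/
noncomputable def tent (L v : ℝ) : ℂ := ((max (L - |v|) 0 : ℝ) : ℂ)

theorem continuous_tent (L : ℝ) : Continuous (tent L) := by
  unfold tent; fun_prop

theorem hasCompactSupport_tent (L : ℝ) : HasCompactSupport (tent L) := by
  refine HasCompactSupport.intro (isCompact_Icc (a := -L) (b := L)) fun v hv => ?_
  have : L < |v| := by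
    by_contra h
    push Not at h
    exact hv ⟨(abs_le.1 h).1, (abs_le.1 h).2⟩
  simp [tent, this.le]

theorem integral_Ioi_exp_mul_tent {L : ℝ} (hL : 0 < L) (α : ℂ) :
    ∫ v in Set.Ioi (0 : ℝ), Complex.exp (α * v) * tent L v =
      ∫ v in (0 : ℝ)..L, Complex.exp (α * v) * (L - v) := by
  rw [intervalIntegral.integral_of_le hL.le]
  rw [setIntegral_eq_of_subset_of_forall_sdiff_eq_zero (s := Set.Ioc 0 L) (t := Set.Ioi 0)
    (f := fun v : ℝ => Complex.exp (α * v) * tent L v)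
    measurableSet_Ioi (fun v hv => hv.1)]
  · refine setIntegral_congr_fun measurableSet_Ioc fun v hv => ?_
    simp only [tent]
    rw [abs_of_pos hv.1, max_eq_left (by linarith [hv.2])]
    push_cast
    rfl
  · intro v hv
    have h1 : 0 < v := hv.1
    have h2 : L < v := by
      by_contra h
      push Not at h
      exact hv.2 ⟨h1, h⟩
    simp [tent, abs_of_pos h1, h2.le]

theorem integral_exp_mul_tent {L y : ℝ} (hL : 0 < L) (hy : y ≠ 0) :
    ∫ v : ℝ, Complex.exp (((-(y * v) : ℝ) : ℂ) * Complex.I) * tent L v = fejer L y := by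
  have hc : Continuous fun v : ℝ =>
      Complex.exp (((-(y * v) : ℝ) : ℂ) * Complex.I) * tent L v :=
    Continuous.mul (by fun_prop) (continuous_tent L)
  have hi : Integrable fun v : ℝ =>
      Complex.exp (((-(y * v) : ℝ) : ℂ) * Complex.I) * tent L v :=
    hc.integrable_of_hasCompactSupport (hasCompactSupport_tent L).mul_left
  have hhalf : ∀ z : ℝ, ∫ v in Set.Ioi (0 : ℝ),
      Complex.exp (((-(z * v) : ℝ) : ℂ) * Complex.I) * tent L v =
      ∫ v in (0 : ℝ)..L, Complex.exp ((-(z * Complex.I)) * v) * (L - v) := by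
    intro z
    rw [← integral_Ioi_exp_mul_tent hL]
    congr 1
    ext v
    congr 2
    push_cast
    ring
  have hneg0 := integral_comp_neg_Ioi (0 : ℝ)
    (fun v : ℝ => Complex.exp (((-(y * v) : ℝ) : ℂ) * Complex.I) * tent L v)
  rw [neg_zero] at hneg0
  rw [← intervalIntegral.integral_Iic_add_Ioi (b := 0) hi.integrableOn hi.integrableOn, ← hneg0]
  have hneg : ∀ v : ℝ, Complex.exp (((-(y * -v) : ℝ) : ℂ) * Complex.I) * tent L (-v) =
      Complex.exp (((-((-y) * v) : ℝ) : ℂ) * Complex.I) * tent L v := by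
    intro v
    simp [tent]
  simp_rw [hneg]
  have hyC : (y : ℂ) ≠ 0 := by exact_mod_cast hy
  rw [hhalf, hhalf, integral_exp_mul_mul_sub _ (by simpa using hy),
    integral_exp_mul_mul_sub _ (by simpa using hy), fejer_of_ne_zero hL.ne' hy]
  have hcos : (4 * Real.sin (L * y / 2) ^ 2 : ℝ) = 2 - 2 * Real.cos (L * y) := by
    rw [Real.sin_sq, Real.cos_sq, show 2 * (L * y / 2) = L * y by ring]
    ring
  rw [hcos]
  push_cast
  rw [Complex.cos]
  simp only [mul_pow, neg_sq, Complex.I_sq]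
  rw [show -(-(y : ℂ) * Complex.I) * L = L * y * Complex.I by ring,
    show -((y : ℂ) * Complex.I) * L = -(L * y) * Complex.I by ring]
  field_simp
  ring

theorem integral_fejer_mul_exp {L : ℝ} (hL : 0 < L) (u : ℝ) :
    ∫ y : ℝ, (fejer L y : ℂ) * Complex.exp (-((y * u : ℝ) : ℂ) * Complex.I) =
      2 * Real.pi * tent L u := by
  have hF : ∀ w : ℝ, w ≠ 0 →
      FourierTransform.fourier (tent L) w = (fejer L (2 * Real.pi * w) : ℂ) := by
    intro w hw
    rw [Real.fourier_real_eq_integral_exp_smul,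
      ← integral_exp_mul_tent hL (by have := Real.pi_ne_zero; positivity)]
    congr 1
    ext v
    rw [smul_eq_mul]
    congr 4
    ring
  have hF' : FourierTransform.fourier (tent L) =ᵐ[volume]
      fun w : ℝ => (fejer L (2 * Real.pi * w) : ℂ) := by
    filter_upwards [compl_mem_ae_iff.2 (measure_singleton (0 : ℝ))] with w hw
    exact hF w hw
  have hi : Integrable (FourierTransform.fourier (tent L)) := by
    refine (Integrable.congr ?_ hF'.symm)
    exact ((integrable_fejer hL.ne').comp_mul_left' (by positivity)).ofReal
  have hinv := congrFun ((continuous_tent L).fourierInv_fourier_eq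
    ((continuous_tent L).integrable_of_hasCompactSupport (hasCompactSupport_tent L)) hi) (-u)
  rw [Real.fourierInv_eq', integral_congr_ae (g := fun w : ℝ =>
    (fun y : ℝ => (fejer L y : ℂ) * Complex.exp (-((y * u : ℝ) : ℂ) * Complex.I))
      (2 * Real.pi * w)) ?_, Measure.integral_comp_mul_left
    (fun y : ℝ => (fejer L y : ℂ) * Complex.exp (-((y * u : ℝ) : ℂ) * Complex.I))] at hinv
  · have htent : tent L (-u) = tent L u := by simp [tent]
    rw [htent] at hinv
    rw [← hinv, abs_of_pos (by positivity)]
    rw [Complex.real_smul]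
    have hpi : (2 * Real.pi : ℂ) ≠ 0 := by simp [Real.pi_ne_zero]
    push_cast
    rw [← mul_assoc, mul_inv_cancel₀ hpi, one_mul]
  · filter_upwards [hF'] with w hw
    rw [hw, smul_eq_mul, mul_comm]
    congr 2
    simp
    ring

/-- The sum `∑_{n ≤ X} Λ(n) n^{-s} (log X - log n)`. -/
noncomputable def mangoldtSum (X : ℝ) (s : ℂ) : ℂ :=
  ∑ n ∈ Finset.Icc 1 ⌊X⌋₊, ((ArithmeticFunction.vonMangoldt n : ℝ) : ℂ) * (n : ℂ) ^ (-s) *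
    ((Real.log X - Real.log n : ℝ) : ℂ)

theorem differentiable_mangoldtSum (X : ℝ) : Differentiable ℂ (mangoldtSum X) := by
  unfold mangoldtSum
  refine Differentiable.fun_sum fun n hn => ?_
  have hn0 : (n : ℂ) ≠ 0 := by
    have := (Finset.mem_Icc.1 hn).1
    exact_mod_cast (by omega : n ≠ 0)
  intro s
  exact ((differentiableAt_id.neg.const_cpow (Or.inl hn0)).const_mul _).mul_const _

theorem norm_negLogDerivZeta_shift_le {C δ : ℝ}
    (h : ∀ w : ℂ, 1 / 2 + δ ≤ w.re → ‖negLogDerivZeta w‖ ≤ C * Real.log (|w.im| + 4)) (hC : 0 < C)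
    {s : ℂ} (hs : 1 / 2 + δ ≤ s.re) {t : ℝ} (ht : |s.im| ≤ t) (y : ℝ) :
    ‖negLogDerivZeta (s + y * Complex.I)‖ ≤ 2 * C * Real.log (t + 4) * Real.log (|y| + 4) := by
  refine (h _ (by simpa using hs)).trans ?_
  have h1 : (s + y * Complex.I).im = s.im + y := by simp
  rw [h1]
  have h2 := log_abs_add_add_four_le s.im y
  have h3 := one_le_log_abs_add_four s.im
  have h4 := one_le_log_abs_add_four y
  have h5 : Real.log (|s.im| + 4) ≤ Real.log (t + 4) :=
    Real.log_le_log (by positivity) (by linarith)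
  have h6 : Real.log (|s.im + y| + 4) ≤ 2 * (Real.log (t + 4) * Real.log (|y| + 4)) := by
    nlinarith
  nlinarith

theorem continuous_negLogDerivZeta_shift (hRH : RiemannHypothesis) {s : ℂ} (hs : 1 / 2 < s.re) :
    Continuous fun y : ℝ => negLogDerivZeta (s + y * Complex.I) := by
  rw [continuous_iff_continuousAt]
  intro y
  have h1 : ContinuousAt negLogDerivZeta (s + y * Complex.I) :=
    (differentiableAt_negLogDerivZeta hRH (by simpa using hs)).continuousAt
  have h2 : ContinuousAt (fun y : ℝ => s + y * Complex.I) y := by fun_prop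
  exact ContinuousAt.comp (f := fun y : ℝ => s + y * Complex.I) h1 h2

theorem integrable_negLogDerivZeta_mul_fejer (hRH : RiemannHypothesis) {L : ℝ} (hL : 0 < L)
    {s : ℂ} (hs : 1 / 2 < s.re) :
    Integrable fun y : ℝ => negLogDerivZeta (s + y * Complex.I) * fejer L y := by
  obtain ⟨C, hC, h⟩ := exists_norm_negLogDerivZeta_le hRH (δ := s.re - 1 / 2) (by linarith)
  refine ((integrable_log_mul_fejer hL.ne').const_mul
    (2 * C * Real.log (|s.im| + 4))).mono' ?_ (Eventually.of_forall fun y => ?_)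
  · exact ((continuous_negLogDerivZeta_shift hRH hs).mul (by fun_prop)).aestronglyMeasurable
  · rw [norm_mul, Complex.norm_real, Real.norm_eq_abs, abs_of_nonneg (fejer_nonneg L y),
      ← mul_assoc]
    exact mul_le_mul_of_nonneg_right (norm_negLogDerivZeta_shift_le h hC (by linarith) le_rfl y)
      (fejer_nonneg L y)

theorem integral_fejer_div {L : ℝ} (hL : 0 < L) {β : ℂ} (hβ : 0 < β.re) :
    ∫ y : ℝ, (fejer L y : ℂ) / (β + y * Complex.I) =
      2 * Real.pi * ((Complex.exp (-β * L) + β * L - 1) / β ^ 2) := by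
  have hβ0 : β ≠ 0 := by rintro rfl; simp at hβ
  have h1 : ∀ y : ℝ, (fejer L y : ℂ) / (β + y * Complex.I) =
      ∫ v in Set.Ioi (0 : ℝ), (fejer L y : ℂ) * Complex.exp (-(β + y * Complex.I) * v) := by
    intro y
    rw [integral_const_mul, integral_exp_mul_complex_Ioi (by simpa using hβ)]
    rw [Complex.ofReal_zero, mul_zero, Complex.exp_zero, neg_div_neg_eq, mul_one_div]
  simp_rw [h1]
  rw [integral_integral_swap]
  · have h2 : ∀ v : ℝ, ∫ y : ℝ, (fejer L y : ℂ) * Complex.exp (-(β + y * Complex.I) * v) =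
        2 * Real.pi * (Complex.exp (-β * v) * tent L v) := by
      intro v
      rw [mul_left_comm, ← integral_fejer_mul_exp hL v, ← integral_const_mul]
      congr 1
      ext y
      rw [mul_left_comm, ← Complex.exp_add]
      congr 2
      push_cast
      ring
    simp_rw [h2]
    rw [integral_const_mul, integral_Ioi_exp_mul_tent hL,
      integral_exp_mul_mul_sub _ (neg_ne_zero.2 hβ0)]
    congr 2
    · ring
    · ring
  · have hexp : Integrable (fun v : ℝ => Real.exp (-β.re * v)) (volume.restrict (Set.Ioi 0)) := by
      have := exp_neg_integrableOn_Ioi 0 hβ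
      exact this
    refine ((integrable_fejer hL.ne').mul_prod hexp).mono' ?_ (Eventually.of_forall fun p => ?_)
    · refine Continuous.aestronglyMeasurable ?_
      simp only [Function.uncurry_def]
      have := continuous_fejer L
      fun_prop
    · simp only [Function.uncurry_def]
      rw [norm_mul, Complex.norm_real, Real.norm_eq_abs, abs_of_nonneg (fejer_nonneg _ _),
        Complex.norm_exp]
      simp

theorem integral_LSeries_mul_fejer {X : ℝ} (hX : 1 < X) {s : ℂ} (hs : 1 < s.re) :
    ∫ y : ℝ, LSeries (fun n => (ArithmeticFunction.vonMangoldt n : ℂ)) (s + y * Complex.I) *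
      fejer (Real.log X) y = 2 * Real.pi * mangoldtSum X s := by
  have hL : 0 < Real.log X := Real.log_pos hX
  set a : ℕ → ℂ := fun n => (ArithmeticFunction.vonMangoldt n : ℂ) with ha
  have ha0 : a 0 = 0 := by simp [ha]
  have hterm : ∀ (n : ℕ) (y : ℝ), LSeries.term a (s + y * Complex.I) n * fejer (Real.log X) y =
      LSeries.term a s n * ((fejer (Real.log X) y : ℂ) *
        Complex.exp (-((y * Real.log n : ℝ) : ℂ) * Complex.I)) := by
    intro n y
    rcases eq_or_ne n 0 with rfl | hn
    · simp
    have hnC : (n : ℂ) ≠ 0 := by exact_mod_cast hn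
    rw [LSeries.term_of_ne_zero hn, LSeries.term_of_ne_zero hn, Complex.cpow_add _ _ hnC]
    rw [Complex.cpow_def_of_ne_zero hnC (y * Complex.I), ← Complex.ofReal_natCast,
      ← Complex.ofReal_log (Nat.cast_nonneg n), neg_mul, Complex.exp_neg]
    push_cast
    rw [show Complex.log n * (y * Complex.I) = y * Complex.log n * Complex.I by ring]
    field_simp
  have hInt : ∀ n, ∫ y : ℝ, LSeries.term a (s + y * Complex.I) n * fejer (Real.log X) y =
      LSeries.term a s n * (2 * Real.pi * tent (Real.log X) (Real.log n)) := by
    intro n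
    simp_rw [hterm]
    rw [integral_const_mul, integral_fejer_mul_exp hL]
  have hsum : LSeriesSummable a s := ArithmeticFunction.LSeriesSummable_vonMangoldt hs
  have hnorm : ∀ (n : ℕ) (y : ℝ), ‖LSeries.term a (s + y * Complex.I) n * fejer (Real.log X) y‖ =
      ‖LSeries.term a s n‖ * fejer (Real.log X) y := by
    intro n y
    rw [hterm, norm_mul, norm_mul, Complex.norm_real, Real.norm_eq_abs,
      abs_of_nonneg (fejer_nonneg _ _), ← Complex.ofReal_neg, Complex.norm_exp_ofReal_mul_I,
      mul_one]
  have hS := hasSum_integral_of_summable_integral_norm (μ := volume)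
    (F := fun (n : ℕ) (y : ℝ) => LSeries.term a (s + y * Complex.I) n * fejer (Real.log X) y)
    (fun n => by
      simp_rw [hterm]
      refine Integrable.const_mul ?_ _
      refine (integrable_fejer hL.ne').mono' (Continuous.aestronglyMeasurable (by fun_prop))
        (Eventually.of_forall fun y => ?_)
      rw [norm_mul, Complex.norm_real, Real.norm_eq_abs,
        abs_of_nonneg (fejer_nonneg _ _), ← Complex.ofReal_neg, Complex.norm_exp_ofReal_mul_I,
        mul_one])
    (by
      simp_rw [hnorm, integral_const_mul]
      exact hsum.norm.mul_right _)
  simp_rw [hInt, tsum_mul_right] at hS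
  have hF := hasSum_sum_of_ne_finset_zero (L := SummationFilter.unconditional ℕ)
    (s := Finset.Icc 1 ⌊X⌋₊)
    (f := fun n => LSeries.term a s n * (2 * Real.pi * tent (Real.log X) (Real.log n))) (by
      intro n hn
      rcases eq_or_ne n 0 with rfl | hn0
      · simp
      have h1 : X < n := by
        rw [Finset.mem_Icc] at hn
        push Not at hn
        exact Nat.lt_of_floor_lt (hn (by omega))
      have h2 : Real.log X < Real.log n := Real.log_lt_log (by linarith) h1
      simp only [tent]
      rw [max_eq_right (by linarith [le_abs_self (Real.log n)])]
      simp)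
  refine (hS.unique hF).trans ?_
  rw [mangoldtSum, Finset.mul_sum]
  refine Finset.sum_congr rfl fun n hn => ?_
  rw [Finset.mem_Icc] at hn
  have hn1 : (1 : ℝ) ≤ n := by exact_mod_cast hn.1
  have h2 : Real.log n ≤ Real.log X := Real.log_le_log (by linarith)
    ((Nat.le_floor_iff (by linarith)).1 hn.2)
  rw [LSeries.term_of_ne_zero (by omega), tent, abs_of_nonneg (Real.log_nonneg hn1),
    max_eq_left (by linarith), Complex.cpow_neg]
  simp only [ha]
  ring

theorem integral_negLogDerivZeta_of_one_lt (hRH : RiemannHypothesis) {X : ℝ} (hX : 1 < X) {s : ℂ}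
    (hs : 1 < s.re) :
    ∫ y : ℝ, negLogDerivZeta (s + y * Complex.I) * fejer (Real.log X) y =
      2 * Real.pi * (mangoldtSum X s -
        (Complex.exp ((1 - s) * Real.log X) - (1 - s) * Real.log X - 1) / (1 - s) ^ 2) := by
  have hL : 0 < Real.log X := Real.log_pos hX
  have hβ : 0 < (s - 1).re := by simpa using hs
  have h1 := integral_LSeries_mul_fejer hX hs
  have h2 := integral_fejer_div hL hβ
  have hi : Integrable fun y : ℝ => (fejer (Real.log X) y : ℂ) / (s - 1 + y * Complex.I) := by
    refine ((integrable_fejer hL.ne').mul_const ((s - 1).re⁻¹)).mono' ?_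
      (Eventually.of_forall fun y => ?_)
    · refine Continuous.aestronglyMeasurable (Continuous.div (by fun_prop) (by fun_prop) ?_)
      intro y h
      have := congrArg Complex.re h
      simp at this
      linarith
    · rw [norm_div, Complex.norm_real, Real.norm_eq_abs, abs_of_nonneg (fejer_nonneg _ _),
        div_eq_mul_inv]
      have h3 := Complex.re_le_norm (s - 1 + y * Complex.I)
      have h4 : (s - 1 + y * Complex.I).re = (s - 1).re := by simp
      rw [h4] at h3
      have := fejer_nonneg (Real.log X) y
      gcongr
  have h3 : ∀ y : ℝ, LSeries (fun n => (ArithmeticFunction.vonMangoldt n : ℂ))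
      (s + y * Complex.I) * fejer (Real.log X) y =
      negLogDerivZeta (s + y * Complex.I) * fejer (Real.log X) y +
        (fejer (Real.log X) y : ℂ) / (s - 1 + y * Complex.I) := by
    intro y
    rw [negLogDerivZeta_eq (by simpa using hs),
      show s + y * Complex.I - 1 = s - 1 + y * Complex.I by ring]
    ring
  simp_rw [h3] at h1
  rw [integral_add (integrable_negLogDerivZeta_mul_fejer hRH hL (by linarith)) hi, h2] at h1
  rw [eq_sub_of_add_eq h1]
  rw [show -(s - 1) = 1 - s by ring, show (s - 1) ^ 2 = (1 - s) ^ 2 by ring]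
  ring

theorem differentiableAt_integral_negLogDerivZeta (hRH : RiemannHypothesis) {L : ℝ} (hL : 0 < L)
    {s : ℂ} (hs : 1 / 2 < s.re) :
    DifferentiableAt ℂ (fun z : ℂ => ∫ y : ℝ, negLogDerivZeta (z + y * Complex.I) * fejer L y)
      s := by
  set δ : ℝ := (s.re - 1 / 2) / 3 with hδ
  have hδ0 : 0 < δ := by rw [hδ]; linarith
  obtain ⟨C, hC, h⟩ := exists_norm_negLogDerivZeta_le hRH hδ0
  have hball : ∀ z ∈ Metric.ball s δ, 1 / 2 + 2 * δ ≤ z.re ∧ |z.im| ≤ |s.im| + δ := by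
    intro z hz
    rw [mem_ball_iff_norm] at hz
    have h1 := (Complex.abs_re_le_norm (z - s)).trans hz.le
    have h2 := (Complex.abs_im_le_norm (z - s)).trans hz.le
    rw [Complex.sub_re, abs_le] at h1
    rw [Complex.sub_im] at h2
    refine ⟨by linarith [h1.1], ?_⟩
    have := abs_sub_abs_le_abs_sub z.im s.im
    linarith
  have hder : ∀ z ∈ Metric.ball s δ, ∀ y : ℝ, HasDerivAt
      (fun z : ℂ => negLogDerivZeta (z + y * Complex.I) * fejer L y)
      (deriv negLogDerivZeta (z + y * Complex.I) * fejer L y) z := by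
    intro z hz y
    have h1 : HasDerivAt negLogDerivZeta (deriv negLogDerivZeta (z + y * Complex.I))
        (z + y * Complex.I) :=
      (differentiableAt_negLogDerivZeta hRH (by
        have := (hball z hz).1
        simp
        linarith)).hasDerivAt
    exact (HasDerivAt.comp_add_const z _ h1).mul_const _
  refine (hasDerivAt_integral_of_dominated_loc_of_deriv_le (𝕜 := ℂ)
    (s := Metric.ball s δ) (bound := fun y => 2 * C * Real.log (|s.im| + 2 * δ + 4) / δ *
      (Real.log (|y| + 4) * fejer L y))
    (F' := fun z y => deriv negLogDerivZeta (z + y * Complex.I) * fejer L y)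
    (Metric.ball_mem_nhds s hδ0) ?_ (integrable_negLogDerivZeta_mul_fejer hRH hL hs) ?_
    (Eventually.of_forall fun y z hz => ?_) ((integrable_log_mul_fejer hL.ne').const_mul _)
    (Eventually.of_forall fun y z hz => hder z hz y)).2.differentiableAt
  · filter_upwards [Metric.ball_mem_nhds s hδ0] with z hz
    have := (hball z hz).1
    exact (integrable_negLogDerivZeta_mul_fejer hRH hL (by linarith)).aestronglyMeasurable
  · have hm : Measurable fun y : ℝ => deriv negLogDerivZeta (s + y * Complex.I) * fejer L y := by
      have := measurable_deriv negLogDerivZeta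
      have h2 := continuous_fejer L
      fun_prop
    exact hm.aestronglyMeasurable
  · rw [norm_mul, Complex.norm_real, Real.norm_eq_abs, abs_of_nonneg (fejer_nonneg L y),
      ← mul_assoc]
    refine mul_le_mul_of_nonneg_right ?_ (fejer_nonneg L y)
    have hz' := hball z hz
    have hd := Complex.norm_deriv_le_of_forall_mem_sphere_norm_le (f := negLogDerivZeta)
      (c := z + y * Complex.I) (R := δ)
      (C := 2 * C * Real.log (|s.im| + 2 * δ + 4) * Real.log (|y| + 4)) hδ0 ?_ ?_
    · refine hd.trans (le_of_eq (by ring))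
    · refine DifferentiableOn.diffContOnCl fun w hw => ?_
      rw [closure_ball _ hδ0.ne', mem_closedBall_iff_norm] at hw
      have h1 := (Complex.abs_re_le_norm _).trans hw
      rw [abs_le] at h1
      simp at h1
      exact (differentiableAt_negLogDerivZeta hRH (by linarith [h1.1])).differentiableWithinAt
    · intro w hw
      rw [mem_sphere_iff_norm] at hw
      have h1 := (Complex.abs_re_le_norm _).trans hw.le
      have h2 := (Complex.abs_im_le_norm _).trans hw.le
      rw [abs_le] at h1
      simp at h1 h2
      have hw2 : w = (w - y * Complex.I) + y * Complex.I := by ring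
      rw [hw2]
      refine norm_negLogDerivZeta_shift_le h hC (by simp; linarith [h1.1]) ?_ y
      have e1 : (w - y * Complex.I).im = (w.im - (z.im + y)) + z.im := by
        simp
        ring
      rw [e1]
      have := abs_add_le (w.im - (z.im + y)) z.im
      linarith [hz'.2]

theorem integral_negLogDerivZeta_mul_fejer (hRH : RiemannHypothesis) {X : ℝ} (hX : 1 < X) {s : ℂ}
    (hs : 1 / 2 < s.re) (hs1 : s ≠ 1) :
    ∫ y : ℝ, negLogDerivZeta (s + y * Complex.I) * fejer (Real.log X) y =
      2 * Real.pi * (mangoldtSum X s -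
        (Complex.exp ((1 - s) * Real.log X) - (1 - s) * Real.log X - 1) / (1 - s) ^ 2) := by
  have hL : 0 < Real.log X := Real.log_pos hX
  set f : ℂ → ℂ := fun s => (1 - s) ^ 2 *
    ∫ y : ℝ, negLogDerivZeta (s + y * Complex.I) * fejer (Real.log X) y with hf
  set g : ℂ → ℂ := fun s => 2 * Real.pi * ((1 - s) ^ 2 * mangoldtSum X s -
        (Complex.exp ((1 - s) * Real.log X) - (1 - s) * Real.log X - 1)) with hg
  have ho : IsOpen {z : ℂ | 1 / 2 < z.re} := isOpen_lt continuous_const Complex.continuous_re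
  have hfa : AnalyticOnNhd ℂ f {z : ℂ | 1 / 2 < z.re} := by
    refine DifferentiableOn.analyticOnNhd (fun z hz => ?_) ho
    exact (DifferentiableAt.mul (by fun_prop)
      (differentiableAt_integral_negLogDerivZeta hRH hL hz)).differentiableWithinAt
  have hga : AnalyticOnNhd ℂ g {z : ℂ | 1 / 2 < z.re} := by
    refine DifferentiableOn.analyticOnNhd (Differentiable.differentiableOn ?_) ho
    have := differentiable_mangoldtSum X
    fun_prop
  have hpre : IsPreconnected {z : ℂ | 1 / 2 < z.re} :=
    (convex_halfSpace_re_gt (1 / 2)).isPreconnected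
  have hev : f =ᶠ[nhds 2] g := by
    have ho1 : IsOpen {z : ℂ | 1 < z.re} := isOpen_lt continuous_const Complex.continuous_re
    filter_upwards [ho1.mem_nhds (show (1 : ℝ) < (2 : ℂ).re by norm_num)] with z hz
    have hz' : 1 < z.re := hz
    have hz1 : 1 - z ≠ 0 := by
      intro h
      have := congrArg Complex.re h
      simp at this
      linarith
    simp only [hf, hg]
    rw [integral_negLogDerivZeta_of_one_lt hRH hX hz']
    field_simp
  have heq := hfa.eqOn_of_preconnected_of_eventuallyEq hga hpre
    (show (1 / 2 : ℝ) < (2 : ℂ).re by norm_num) hev hs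
  simp only [hf, hg] at heq
  have h1s : 1 - s ≠ 0 := sub_ne_zero.2 hs1.symm
  rw [← mul_right_inj' (pow_ne_zero 2 h1s), heq]
  field_simp

theorem fejer_eq_scale (L y : ℝ) : fejer L y = L ^ 2 * fejer 1 (L * y) := by
  simp [fejer]

theorem integral_log_mul_fejer_le {L : ℝ} (hL : 1 ≤ L) :
    ∫ y : ℝ, Real.log (|y| + 4) * fejer L y ≤
      L * ∫ y : ℝ, Real.log (|y| + 4) * fejer 1 y := by
  have hL0 : 0 < L := by linarith
  have hi := integrable_log_mul_fejer (L := 1) one_ne_zero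
  have h1 : ∫ y : ℝ, Real.log (|L * y| + 4) * fejer 1 (L * y) =
      L⁻¹ * ∫ y : ℝ, Real.log (|y| + 4) * fejer 1 y := by
    rw [Measure.integral_comp_mul_left (fun y : ℝ => Real.log (|y| + 4) * fejer 1 y),
      abs_of_pos (by positivity), smul_eq_mul]
  calc ∫ y : ℝ, Real.log (|y| + 4) * fejer L y
      ≤ ∫ y : ℝ, L ^ 2 * (Real.log (|L * y| + 4) * fejer 1 (L * y)) := by
        refine integral_mono (integrable_log_mul_fejer hL0.ne')
          ((hi.comp_mul_left' hL0.ne').const_mul _) fun y => ?_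
        have h2 : Real.log (|y| + 4) ≤ Real.log (|L * y| + 4) := by
          refine Real.log_le_log (by positivity) ?_
          rw [abs_mul, abs_of_pos hL0]
          nlinarith [abs_nonneg y]
        have := fejer_nonneg 1 (L * y)
        simp only
        rw [fejer_eq_scale L y, mul_left_comm]
        gcongr
    _ = L * ∫ y : ℝ, Real.log (|y| + 4) * fejer 1 y := by
        rw [integral_const_mul, h1]
        field_simp

theorem integrable_log_shift_mul_fejer {L : ℝ} (hL : L ≠ 0) (t : ℝ) :
    Integrable fun y : ℝ => Real.log (|t + y| + 4) * fejer L y := by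
  refine ((integrable_log_mul_fejer hL).const_mul (2 * Real.log (|t| + 4))).mono' ?_
    (Eventually.of_forall fun y => ?_)
  · refine Continuous.aestronglyMeasurable (Continuous.mul ?_ (by fun_prop))
    exact Continuous.log (by fun_prop) fun y => by positivity
  · have h1 := one_le_log_abs_add_four (t + y)
    have h2 := fejer_nonneg L y
    have h3 := log_abs_add_add_four_le t y
    have h4 := one_le_log_abs_add_four t
    have h5 := one_le_log_abs_add_four y
    rw [Real.norm_eq_abs, abs_of_nonneg (by positivity), ← mul_assoc]
    refine mul_le_mul_of_nonneg_right ?_ h2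
    nlinarith

theorem integral_log_shift_mul_fejer_le {L : ℝ} (hL : 1 ≤ L) (t : ℝ) :
    ∫ y : ℝ, Real.log (|t + y| + 4) * fejer L y ≤
      2 * (∫ y : ℝ, Real.log (|y| + 4) * fejer 1 y) * (L * Real.log (|t| + 4)) := by
  have hL0 : L ≠ 0 := by linarith
  have h4 := one_le_log_abs_add_four t
  calc ∫ y : ℝ, Real.log (|t + y| + 4) * fejer L y
      ≤ ∫ y : ℝ, 2 * Real.log (|t| + 4) * (Real.log (|y| + 4) * fejer L y) := by
        refine integral_mono (integrable_log_shift_mul_fejer hL0 t)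
          ((integrable_log_mul_fejer hL0).const_mul _) fun y => ?_
        have h2 := fejer_nonneg L y
        have h3 := log_abs_add_add_four_le t y
        have h5 := one_le_log_abs_add_four y
        simp only
        rw [← mul_assoc]
        refine mul_le_mul_of_nonneg_right ?_ h2
        nlinarith
    _ = 2 * Real.log (|t| + 4) * ∫ y : ℝ, Real.log (|y| + 4) * fejer L y := by
        rw [integral_const_mul]
    _ ≤ 2 * Real.log (|t| + 4) * (L * ∫ y : ℝ, Real.log (|y| + 4) * fejer 1 y) := by
        gcongr
        exact integral_log_mul_fejer_le hL
    _ = _ := by ring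

theorem fejer_le_add_shift {l : ℝ} (hl : 0 < l) {y : ℝ} (hy : y ≠ 0) (hy' : y + Real.pi / l ≠ 0) :
    fejer (16 * l) y ≤ 2560 * (fejer l y + fejer l (y + Real.pi / l)) := by
  set a := Real.pi / l with ha
  have ha0 : 0 < a := by positivity
  have hla : l * a = Real.pi := by rw [ha]; field_simp
  have h1 : 4 / (|y| + a) ^ 2 ≤ fejer l y + fejer l (y + a) := by
    rw [fejer_of_ne_zero hl.ne' hy, fejer_of_ne_zero hl.ne' hy',
      show l * (y + a) / 2 = l * y / 2 + Real.pi / 2 by rw [← hla]; ring, Real.sin_add_pi_div_two]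
    have e1 : y ^ 2 ≤ (|y| + a) ^ 2 := by
      rw [← sq_abs y]
      gcongr
      linarith
    have e2 : (y + a) ^ 2 ≤ (|y| + a) ^ 2 := by
      rw [← sq_abs (y + a)]
      gcongr
      exact (abs_add_le _ _).trans (by rw [abs_of_pos ha0])
    have e3 : 4 / (|y| + a) ^ 2 = 4 * Real.sin (l * y / 2) ^ 2 / (|y| + a) ^ 2 +
        4 * Real.cos (l * y / 2) ^ 2 / (|y| + a) ^ 2 := by
      rw [← add_div, ← mul_add, Real.sin_sq_add_cos_sq, mul_one]
    rw [e3]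
    gcongr
  have h2 : fejer (16 * l) y ≤ 2560 * (4 / (|y| + a) ^ 2) := by
    have hpos : 0 < (|y| + a) ^ 2 := by positivity
    rw [mul_div, le_div_iff₀ hpos]
    rcases le_total |y| a with h | h
    · have e1 := fejer_le_sq (16 * l) y
      have e2 : (|y| + a) ^ 2 ≤ 4 * a ^ 2 := by nlinarith [abs_nonneg y]
      have e3 : (16 * l) ^ 2 * (4 * a ^ 2) = 1024 * Real.pi ^ 2 := by rw [← hla]; ring
      have e4 : Real.pi ^ 2 ≤ 10 := by
        have := Real.pi_lt_d2
        have := Real.pi_pos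
        nlinarith
      calc _ ≤ (16 * l) ^ 2 * (4 * a ^ 2) := by gcongr
        _ ≤ _ := by rw [e3]; linarith
    · have e1 := fejer_mul_sq_le (show 16 * l ≠ 0 by positivity) y
      have e2 : (|y| + a) ^ 2 ≤ 4 * y ^ 2 := by
        rw [← sq_abs y]
        nlinarith [abs_nonneg y]
      have := fejer_nonneg (16 * l) y
      nlinarith
  linarith

theorem norm_pole_term_le {X : ℝ} (hX : 1 < X) {s : ℂ} (hs : 1 / 2 ≤ s.re)
    (him : 1 ≤ |s.im|) (hXs : X ≤ 4096 * |s.im| ^ 4) :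
    ‖(Complex.exp ((1 - s) * Real.log X) - (1 - s) * Real.log X - 1) / (1 - s) ^ 2‖ ≤
      65 + Real.log X := by
  have hL := Real.log_pos hX
  have h1 : |s.im| ≤ ‖1 - s‖ := by
    have := Complex.abs_im_le_norm (1 - s)
    simpa using this
  have hn : 1 ≤ ‖1 - s‖ := him.trans h1
  have h2 : ‖Complex.exp ((1 - s) * Real.log X)‖ ≤ 64 * ‖1 - s‖ ^ 2 := by
    rw [Complex.norm_exp, Complex.re_mul_ofReal]
    have e1 : (1 - s).re * Real.log X ≤ Real.log (64 * |s.im| ^ 2) := by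
      have e2 : Real.log X ≤ 2 * Real.log (64 * |s.im| ^ 2) := by
        have : Real.log X ≤ Real.log ((64 * |s.im| ^ 2) ^ 2) := by
          refine Real.log_le_log (by linarith) (hXs.trans (le_of_eq (by ring)))
        rwa [Real.log_pow] at this
      have e3 : (1 - s).re ≤ 1 / 2 := by simp; linarith
      nlinarith
    calc Real.exp ((1 - s).re * Real.log X) ≤ Real.exp (Real.log (64 * |s.im| ^ 2)) :=
          Real.exp_le_exp.2 e1
      _ = 64 * |s.im| ^ 2 := Real.exp_log (by positivity)
      _ ≤ _ := by gcongr
  rw [norm_div, norm_pow, div_le_iff₀ (by positivity)]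
  have h3 : ‖(1 - s) * (Real.log X : ℂ)‖ = ‖1 - s‖ * Real.log X := by
    rw [norm_mul, Complex.norm_real, Real.norm_eq_abs, abs_of_pos hL]
  have h4 := norm_sub_le (Complex.exp ((1 - s) * Real.log X) - (1 - s) * Real.log X) 1
  have h5 := norm_sub_le (Complex.exp ((1 - s) * Real.log X)) ((1 - s) * Real.log X)
  rw [norm_one] at h4
  have h6 : ‖1 - s‖ ≤ ‖1 - s‖ ^ 2 := by nlinarith
  nlinarith

theorem exists_abs_integral_add_re_mangoldtSum_le (hRH : RiemannHypothesis) (C : ℝ) (hC : 0 < C) :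
    ∃ B > 0, ∀ X : ℝ, 1 < X → 1 ≤ Real.log X → ∀ s : ℂ, 1 / 2 < s.re → 1 ≤ |s.im| →
      X ≤ 4096 * |s.im| ^ 4 →
      |(∫ y : ℝ, (C * Real.log (|s.im + y| + 4) - (negLogDerivZeta (s + y * Complex.I)).re) *
        fejer (Real.log X) y) + 2 * Real.pi * (mangoldtSum X s).re| ≤
        B * (Real.log X * Real.log (|s.im| + 4)) := by
  set A := ∫ y : ℝ, Real.log (|y| + 4) * fejer 1 y with hA
  have hA0 : 0 ≤ A := integral_nonneg fun y => by
    have := one_le_log_abs_add_four y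
    have := fejer_nonneg 1 y
    simp only [Pi.zero_apply]
    positivity
  refine ⟨C * (2 * A) + 2 * Real.pi * 66, by positivity, fun X hX1 hX s hs him hXs => ?_⟩
  have hL : 0 < Real.log X := by linarith
  have hs1 : s ≠ 1 := by
    rintro rfl
    norm_num at him
  have hi1 := (integrable_log_shift_mul_fejer hL.ne' s.im).const_mul C
  have hi2 := integrable_negLogDerivZeta_mul_fejer hRH hL hs
  have h1 : ∫ y : ℝ, (negLogDerivZeta (s + y * Complex.I)).re * fejer (Real.log X) y =
      (2 * Real.pi * (mangoldtSum X s - (Complex.exp ((1 - s) * Real.log X) -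
        (1 - s) * Real.log X - 1) / (1 - s) ^ 2)).re := by
    rw [← integral_negLogDerivZeta_mul_fejer hRH hX1 hs hs1, ← Complex.reCLM_apply,
      ← Complex.reCLM.integral_comp_comm hi2]
    simp
  have hi3 : Integrable fun y : ℝ =>
      (negLogDerivZeta (s + y * Complex.I)).re * fejer (Real.log X) y := by
    have := hi2.re
    simpa [Complex.re_mul_ofReal] using this
  have h2 : ∫ y : ℝ, (C * Real.log (|s.im + y| + 4) - (negLogDerivZeta (s + y * Complex.I)).re) *
        fejer (Real.log X) y = C * (∫ y : ℝ, Real.log (|s.im + y| + 4) * fejer (Real.log X) y) -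
      ∫ y : ℝ, (negLogDerivZeta (s + y * Complex.I)).re * fejer (Real.log X) y := by
    rw [← integral_const_mul, ← integral_sub hi1 hi3]
    congr 1
    ext y
    ring
  have h3 := integral_log_shift_mul_fejer_le hX s.im
  have h3' : 0 ≤ ∫ y : ℝ, Real.log (|s.im + y| + 4) * fejer (Real.log X) y :=
    integral_nonneg fun y => by
      have := one_le_log_abs_add_four (s.im + y)
      have := fejer_nonneg (Real.log X) y
      simp only [Pi.zero_apply]
      positivity
  have h4 := (Complex.abs_re_le_norm _).trans (norm_pole_term_le hX1 hs.le him hXs)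
  set P := (Complex.exp ((1 - s) * Real.log X) - (1 - s) * Real.log X - 1) / (1 - s) ^ 2 with hP
  set V := ∫ y : ℝ, Real.log (|s.im + y| + 4) * fejer (Real.log X) y with hV
  have h5 : (2 * Real.pi * (mangoldtSum X s - P)).re =
      2 * Real.pi * ((mangoldtSum X s).re - P.re) := by
    have : (2 * Real.pi * (mangoldtSum X s - P)) =
        ((2 * Real.pi : ℝ) : ℂ) * (mangoldtSum X s - P) := by push_cast; ring
    rw [this, Complex.re_ofReal_mul, Complex.sub_re]
  rw [h2, h1, h5]
  have h6 : C * V - 2 * Real.pi * ((mangoldtSum X s).re - P.re) +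
      2 * Real.pi * (mangoldtSum X s).re = C * V + 2 * Real.pi * P.re := by ring
  rw [h6]
  refine (abs_add_le _ _).trans ?_
  rw [abs_of_nonneg (by positivity), abs_mul, abs_of_pos (by positivity)]
  have h7 := one_le_log_abs_add_four s.im
  have h8 : 65 + Real.log X ≤ 66 * (Real.log X * Real.log (|s.im| + 4)) := by nlinarith
  have h9 : 2 * Real.pi * |P.re| ≤
      2 * Real.pi * (66 * (Real.log X * Real.log (|s.im| + 4))) := by
    gcongr
    exact h4.trans h8
  have h10 : C * V ≤ C * (2 * A * (Real.log X * Real.log (|s.im| + 4))) := by gcongr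
  linarith

theorem abs_le_of_abs_add_two_pi_mul_le {B Q x y z n₁ n₂ I₁ I₂ I₃ : ℝ} (hB : 0 ≤ B) (hQ : 0 ≤ Q)
    (h₁ : |I₁ + 2 * Real.pi * x| ≤ B * (16 * Q)) (h₂ : |I₂ + 2 * Real.pi * y| ≤ B * Q)
    (h₃ : |I₃ + 2 * Real.pi * z| ≤ 4 * (B * Q)) (hy : |y| ≤ n₁) (hz : |z| ≤ n₂) (hI : 0 ≤ I₁)
    (hI' : I₁ ≤ 2560 * (I₂ + I₃)) : |x| ≤ 20000 * (B + 1) * (16 * Q + n₁ + n₂) := by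
  have hn₁ : 0 ≤ n₁ := (abs_nonneg y).trans hy
  have hn₂ : 0 ≤ n₂ := (abs_nonneg z).trans hz
  have hpi := Real.pi_gt_three
  have hpi4 := Real.pi_le_four
  have hBQ : 0 ≤ B * Q := mul_nonneg hB hQ
  have hBn₁ : 0 ≤ B * n₁ := mul_nonneg hB hn₁
  have hBn₂ : 0 ≤ B * n₂ := mul_nonneg hB hn₂
  rw [abs_le] at h₁ h₂ h₃ hy hz
  have p₁ : 2 * Real.pi * -y ≤ 8 * n₁ := by nlinarith [hy.1]
  have p₂ : 2 * Real.pi * -z ≤ 8 * n₂ := by nlinarith [hz.1]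
  have u : 2 * Real.pi * |x| ≤ 16 * (B * Q) + 2560 * (5 * (B * Q) + 8 * n₁ + 8 * n₂) := by
    rcases abs_cases x with h | h
    · rw [h.1]
      linarith [h₁.2]
    · rw [h.1]
      linarith [h₁.1, h₂.2, h₃.2]
  have u' : 6 * |x| ≤ 2 * Real.pi * |x| := by nlinarith [abs_nonneg x]
  have e : 20000 * (B + 1) * (16 * Q + n₁ + n₂) = 320000 * (B * Q) + 320000 * Q +
      20000 * (B * n₁) + 20000 * (B * n₂) + 20000 * n₁ + 20000 * n₂ := by ring
  rw [e]
  linarith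

theorem exists_abs_re_mangoldtSum_le_of_half_lt (hRH : RiemannHypothesis) :
    ∃ B > 0, ∀ X : ℝ, 1 < X → 16 ≤ Real.log X → ∀ s : ℂ, 1 / 2 < s.re → s.re ≤ 7 / 2 →
      8 ≤ |s.im| → X ≤ 256 * |s.im| ^ 4 →
      |(mangoldtSum X s).re| ≤ B * (Real.log X * Real.log (|s.im| + 4) +
        ‖mangoldtSum (X ^ (1 / 16 : ℝ)) s‖ +
        ‖mangoldtSum (X ^ (1 / 16 : ℝ)) (s - (16 * Real.pi / Real.log X : ℝ) * Complex.I)‖) := by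
  obtain ⟨C, hC, hG⟩ := exists_re_negLogDerivZeta_le hRH
  obtain ⟨B, hB, hmain⟩ := exists_abs_integral_add_re_mangoldtSum_le hRH C hC
  refine ⟨20000 * (B + 1), by positivity, fun X hX1 hX s hs hs' him hXs => ?_⟩
  have hX0 : 0 < X := by linarith
  set Y := X ^ (1 / 16 : ℝ) with hY
  set l := Real.log Y with hl
  have hlX : Real.log X = 16 * l := by
    rw [hl, hY, Real.log_rpow hX0]
    ring
  have hl1 : 1 ≤ l := by linarith
  have hl0 : 0 < l := by linarith
  set a := Real.pi / l with ha
  have ha' : (16 * Real.pi / Real.log X : ℝ) = a := by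
    rw [hlX, ha]
    field_simp
  rw [ha']
  have ha0 : 0 < a := by positivity
  have ha4 : a ≤ 4 := by
    rw [ha, div_le_iff₀ hl0]
    have := Real.pi_lt_d2
    linarith
  have hYX : Y ≤ X := by
    rw [hY]
    exact (Real.rpow_le_rpow_of_exponent_le hX1.le (by norm_num : (1 / 16 : ℝ) ≤ 1)).trans
      (Real.rpow_one X).le
  have hY1 : 1 < Y := Real.one_lt_rpow hX1 (by norm_num)
  set s' : ℂ := s - a * Complex.I with hs'def
  have hs're : s'.re = s.re := by simp [hs'def]
  have hs'im : s'.im = s.im - a := by simp [hs'def]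
  have him' : |s.im| / 2 ≤ |s'.im| := by
    rw [hs'im]
    have := abs_sub_abs_le_abs_sub s.im a
    rw [abs_of_pos ha0] at this
    linarith
  set F : ℝ → ℝ := fun y =>
    C * Real.log (|s.im + y| + 4) - (negLogDerivZeta (s + y * Complex.I)).re with hF
  have hF0 : ∀ y, 0 ≤ F y := fun y => by
    have := hG (s + y * Complex.I) (by simpa using hs) (by simpa using hs')
    simp only [hF]
    have e : (s + y * Complex.I).im = s.im + y := by simp
    rw [e] at this
    linarith
  have hInt : ∀ z : ℂ, 1 / 2 < z.re → ∀ M : ℝ, 0 < M → Integrable fun y : ℝ =>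
      (C * Real.log (|z.im + y| + 4) - (negLogDerivZeta (z + y * Complex.I)).re) * fejer M y := by
    intro z hz M hM
    have i1 := (integrable_log_shift_mul_fejer hM.ne' z.im).const_mul C
    have i2 := (integrable_negLogDerivZeta_mul_fejer hRH hM hz).re
    refine (i1.sub i2).congr (Eventually.of_forall fun y => ?_)
    simp
    ring
  have m1 := hmain X hX1 (by linarith) s hs (by linarith)
    (by nlinarith [pow_nonneg (abs_nonneg s.im) 4])
  have m2 := hmain Y hY1 hl1 s hs (by linarith) (by nlinarith [pow_nonneg (abs_nonneg s.im) 4])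
  have m3 := hmain Y hY1 hl1 s' (by rw [hs're]; exact hs) (by linarith) (by
    have : (|s.im| / 2) ^ 4 ≤ |s'.im| ^ 4 := by gcongr
    have e : (|s.im| / 2) ^ 4 = |s.im| ^ 4 / 16 := by ring
    linarith)
  have hshift : ∫ y : ℝ, (C * Real.log (|s'.im + y| + 4) -
      (negLogDerivZeta (s' + y * Complex.I)).re) * fejer l y = ∫ y : ℝ, F y * fejer l (y + a) := by
    rw [← integral_add_right_eq_self _ a]
    refine integral_congr_ae (Eventually.of_forall fun y => ?_)
    have e1 : s.im - a + (y + a) = s.im + y := by ring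
    have e2 : s' + ((y + a : ℝ) : ℂ) * Complex.I = s + y * Complex.I := by
      rw [hs'def]
      push_cast
      ring
    simp only [hF]
    rw [hs'im, e1, e2]
  have hi3 : Integrable fun y : ℝ => F y * fejer l (y + a) := by
    have := (hInt s' (by rw [hs're]; exact hs) l hl0).comp_add_right a
    refine this.congr (Eventually.of_forall fun y => ?_)
    have e1 : s.im - a + (y + a) = s.im + y := by ring
    have e2 : s' + ((y + a : ℝ) : ℂ) * Complex.I = s + y * Complex.I := by
      rw [hs'def]
      push_cast
      ring
    simp only [hF]
    rw [hs'im, e1, e2]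
  rw [hshift] at m3
  have hi1 := hInt s hs (Real.log X) (by linarith)
  have hi2 := hInt s hs l hl0
  have k0 : 0 ≤ ∫ y : ℝ, F y * fejer (Real.log X) y :=
    integral_nonneg fun y => mul_nonneg (hF0 y) (fejer_nonneg _ _)
  have k1 : ∫ y : ℝ, F y * fejer (Real.log X) y ≤
      2560 * ((∫ y : ℝ, F y * fejer l y) + ∫ y : ℝ, F y * fejer l (y + a)) := by
    rw [← integral_add hi2 hi3, ← integral_const_mul]
    refine integral_mono_ae hi1 ((hi2.add hi3).const_mul _) ?_
    filter_upwards [compl_mem_ae_iff.2 (measure_singleton (0 : ℝ)),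
      compl_mem_ae_iff.2 (measure_singleton (-a : ℝ))] with y hy hy'
    have hy2 : y + a ≠ 0 := fun h => hy' (eq_neg_of_add_eq_zero_left h)
    have := mul_le_mul_of_nonneg_left (fejer_le_add_shift hl0 hy hy2) (hF0 y)
    rw [hlX]
    simp only [hF] at this ⊢
    linarith
  have hlog' : Real.log (|s'.im| + 4) ≤ 4 * Real.log (|s.im| + 4) := by
    have e1 := log_abs_add_add_four_le s.im (-a)
    rw [← sub_eq_add_neg, ← hs'im, abs_neg, abs_of_pos ha0] at e1
    have e2 : Real.log (a + 4) ≤ 3 := by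
      have : Real.log (a + 4) ≤ Real.log (2 ^ 3) := Real.log_le_log (by positivity) (by linarith)
      rw [Real.log_pow] at this
      have := Real.log_two_lt_d9
      norm_num at *
      linarith
    have := one_le_log_abs_add_four s.im
    linarith
  have hlog1 := one_le_log_abs_add_four s.im
  rw [hlX] at m1 k1 k0 ⊢
  have hq : 16 * l * Real.log (|s.im| + 4) = 16 * (l * Real.log (|s.im| + 4)) := by ring
  rw [hq] at m1 ⊢
  refine abs_le_of_abs_add_two_pi_mul_le hB.le (by positivity) m1 m2 (m3.trans ?_)
    (Complex.abs_re_le_norm _) (Complex.abs_re_le_norm _) k0 k1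
  have : B * (l * Real.log (|s'.im| + 4)) ≤ B * (l * (4 * Real.log (|s.im| + 4))) := by gcongr
  linarith

theorem exists_abs_re_mangoldtSum_le (hRH : RiemannHypothesis) :
    ∃ B > 0, ∀ X : ℝ, 1 < X → 16 ≤ Real.log X → ∀ t : ℝ, 8 ≤ t → X ≤ 256 * t ^ 4 →
      |(mangoldtSum X (1 / 2 + t * Complex.I)).re| ≤ B * (Real.log X * Real.log (t + 4) +
        ‖mangoldtSum (X ^ (1 / 16 : ℝ)) (1 / 2 + t * Complex.I)‖ +
        ‖mangoldtSum (X ^ (1 / 16 : ℝ))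
          (1 / 2 + (t - 16 * Real.pi / Real.log X : ℝ) * Complex.I)‖) := by
  obtain ⟨B, hB, h⟩ := exists_abs_re_mangoldtSum_le_of_half_lt hRH
  refine ⟨B, hB, fun X hX1 hX t ht hXt => ?_⟩
  set a := 16 * Real.pi / Real.log X with ha
  have habs : |t| = t := abs_of_nonneg (by linarith)
  have c1 := (differentiable_mangoldtSum X).continuous
  have c2 := (differentiable_mangoldtSum (X ^ (1 / 16 : ℝ))).continuous
  have hev : ∀ᶠ δ : ℝ in nhdsWithin 0 (Set.Ioi 0),
      |(mangoldtSum X (1 / 2 + δ + t * Complex.I)).re| ≤ B * (Real.log X * Real.log (t + 4) +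
        ‖mangoldtSum (X ^ (1 / 16 : ℝ)) (1 / 2 + δ + t * Complex.I)‖ +
        ‖mangoldtSum (X ^ (1 / 16 : ℝ)) (1 / 2 + δ + t * Complex.I - a * Complex.I)‖) := by
    filter_upwards [Ioc_mem_nhdsGT (show (0 : ℝ) < 1 by norm_num)] with δ hδ
    have him : (1 / 2 + (δ : ℂ) + t * Complex.I).im = t := by simp
    have hre : (1 / 2 + (δ : ℂ) + t * Complex.I).re = 1 / 2 + δ := by simp
    have := h X hX1 hX (1 / 2 + δ + t * Complex.I) (by rw [hre]; linarith [hδ.1])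
      (by rw [hre]; linarith [hδ.2]) (by rwa [him, habs])
      (by rwa [him, habs])
    rwa [him, habs] at this
  have l1 : Tendsto (fun δ : ℝ => |(mangoldtSum X (1 / 2 + δ + t * Complex.I)).re|)
      (nhdsWithin 0 (Set.Ioi 0)) (nhds |(mangoldtSum X (1 / 2 + (0 : ℝ) + t * Complex.I)).re|) :=
    (Continuous.tendsto (by fun_prop) 0).mono_left nhdsWithin_le_nhds
  have l2 : Tendsto (fun δ : ℝ => B * (Real.log X * Real.log (t + 4) +
        ‖mangoldtSum (X ^ (1 / 16 : ℝ)) (1 / 2 + δ + t * Complex.I)‖ +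
        ‖mangoldtSum (X ^ (1 / 16 : ℝ)) (1 / 2 + δ + t * Complex.I - a * Complex.I)‖))
      (nhdsWithin 0 (Set.Ioi 0)) (nhds (B * (Real.log X * Real.log (t + 4) +
        ‖mangoldtSum (X ^ (1 / 16 : ℝ)) (1 / 2 + (0 : ℝ) + t * Complex.I)‖ +
        ‖mangoldtSum (X ^ (1 / 16 : ℝ)) (1 / 2 + (0 : ℝ) + t * Complex.I - a * Complex.I)‖))) :=
    (Continuous.tendsto (by fun_prop) 0).mono_left nhdsWithin_le_nhds
  have := le_of_tendsto_of_tendsto l1 l2 hev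
  rw [Complex.ofReal_zero, add_zero] at this
  refine this.trans (le_of_eq ?_)
  congr 4
  push_cast
  ring

theorem sum_vonMangoldt_mul_div (N : ℕ) :
    ∑ n ∈ Icc 1 N, ArithmeticFunction.vonMangoldt n * ((N / n : ℕ) : ℝ) =
      Real.log (N.factorial : ℝ) := by
  have h := ArithmeticFunction.sum_Ioc_mul_zeta_eq_sum ArithmeticFunction.vonMangoldt N
  rw [show Icc 1 N = Ioc 0 N from rfl, ← h]
  simp only [ArithmeticFunction.vonMangoldt_mul_zeta, ArithmeticFunction.log_apply]
  clear h
  induction N with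
  | zero => simp
  | succ N ih =>
    rw [Finset.sum_Ioc_succ_top (Nat.zero_le N), ih, Nat.factorial_succ, Nat.cast_mul,
      Real.log_mul (by positivity) (by positivity), add_comm]

theorem sum_vonMangoldt_div_le {Y : ℝ} (hY : 1 ≤ Y) :
    ∑ n ∈ Icc 1 ⌊Y⌋₊, ArithmeticFunction.vonMangoldt n / n ≤ Real.log Y + 6 := by
  set N := ⌊Y⌋₊ with hN
  have hN1 : 1 ≤ N := Nat.one_le_floor_iff _ |>.2 hY
  have hN0 : (0 : ℝ) < N := by positivity
  have hNY : (N : ℝ) ≤ Y := Nat.floor_le (by linarith)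
  have h1 : (N : ℝ) * ∑ n ∈ Icc 1 N, ArithmeticFunction.vonMangoldt n / n ≤
      Real.log (N.factorial : ℝ) + Chebyshev.psi N := by
    rw [← sum_vonMangoldt_mul_div, Chebyshev.psi, Nat.floor_natCast,
      show Ioc 0 N = Icc 1 N from rfl, ← Finset.sum_add_distrib, Finset.mul_sum]
    refine Finset.sum_le_sum fun n hn => ?_
    have hn0 : (0 : ℝ) < n := by
      have := (Finset.mem_Icc.1 hn).1
      positivity
    have h2 : (N : ℝ) / n ≤ ((N / n : ℕ) : ℝ) + 1 := by
      rw [← Nat.floor_div_eq_div (K := ℝ)]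
      exact (Nat.lt_floor_add_one _).le
    have := mul_le_mul_of_nonneg_left h2
      (ArithmeticFunction.vonMangoldt_nonneg (n := n))
    calc _ = ArithmeticFunction.vonMangoldt n * ((N : ℝ) / n) := by ring
      _ ≤ _ := this.trans (le_of_eq (by ring))
  have h2 : Real.log (N.factorial : ℝ) ≤ N * Real.log N := by
    rw [← Real.log_pow]
    exact Real.log_le_log (by positivity) (by exact_mod_cast Nat.factorial_le_pow N)
  have h3 := Chebyshev.psi_le_const_mul_self hN0.le
  have h4 : Real.log 4 ≤ 2 := by
    rw [show (4 : ℝ) = 2 ^ 2 by norm_num, Real.log_pow]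
    have := Real.log_two_lt_d9
    norm_num
    linarith
  have h5 : Real.log N ≤ Real.log Y := Real.log_le_log hN0 hNY
  refine le_of_mul_le_mul_left ?_ hN0
  nlinarith

theorem le_sum_vonMangoldt_div {Y : ℝ} (hY : 1 ≤ Y) :
    Real.log Y - 2 ≤ ∑ n ∈ Icc 1 ⌊Y⌋₊, ArithmeticFunction.vonMangoldt n / n := by
  set N := ⌊Y⌋₊ with hN
  have hN1 : 1 ≤ N := Nat.one_le_floor_iff _ |>.2 hY
  have hN1' : (1 : ℝ) ≤ N := by exact_mod_cast hN1
  have hN0 : (0 : ℝ) < N := by positivity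
  have hNY : Y ≤ N * 2 := by
    have := (Nat.lt_floor_add_one Y).le
    rw [← hN] at this
    linarith
  have h1 : Real.log (N.factorial : ℝ) ≤
      (N : ℝ) * ∑ n ∈ Icc 1 N, ArithmeticFunction.vonMangoldt n / n := by
    rw [← sum_vonMangoldt_mul_div, Finset.mul_sum]
    refine Finset.sum_le_sum fun n hn => ?_
    have h2 : ((N / n : ℕ) : ℝ) ≤ (N : ℝ) / n := Nat.cast_div_le
    have := mul_le_mul_of_nonneg_left h2
      (ArithmeticFunction.vonMangoldt_nonneg (n := n))
    exact this.trans (le_of_eq (by ring))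
  have h2 := Stirling.le_log_factorial_stirling (n := N) (by omega)
  have h3 : 0 ≤ Real.log (2 * Real.pi) :=
    Real.log_nonneg (by nlinarith [Real.pi_gt_three])
  have h4 : 0 ≤ Real.log N := Real.log_nonneg hN1'
  have h5 : Real.log Y ≤ Real.log N + 1 := by
    have : Real.log Y ≤ Real.log (N * 2) := Real.log_le_log (by linarith) hNY
    rw [Real.log_mul hN0.ne' (by norm_num)] at this
    have := Real.log_two_lt_d9
    linarith
  refine le_of_mul_le_mul_left ?_ hN0
  nlinarith

theorem exists_sum_not_prime_vonMangoldt_div_le :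
    ∃ K, ∀ s : Finset ℕ,
      ∑ n ∈ s, (if n.Prime then 0 else ArithmeticFunction.vonMangoldt n) / n ≤ K := by
  have h := ArithmeticFunction.vonMangoldt.summable_residueClass_non_primes_div (q := 1) 0
  refine ⟨_, fun s => (le_of_eq ?_).trans (h.sum_le_tsum s fun n _ => ?_)⟩
  · refine Finset.sum_congr rfl fun n _ => ?_
    simp [ArithmeticFunction.vonMangoldt.residueClass, Subsingleton.elim (n : ZMod 1) 0]
  · have := ArithmeticFunction.vonMangoldt.residueClass_nonneg (0 : ZMod 1) n
    positivity

theorem eventually_le_sum_vonMangoldt_sq_div : ∀ᶠ Z : ℝ in atTop,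
    Real.log Z ^ 2 / 8 ≤ ∑ n ∈ Icc 1 ⌊Z⌋₊, ArithmeticFunction.vonMangoldt n ^ 2 / n := by
  obtain ⟨K, hK⟩ := exists_sum_not_prime_vonMangoldt_div_le
  filter_upwards [eventually_ge_atTop 1, Real.tendsto_log_atTop.eventually_ge_atTop (4 * (K + 8)),
    Real.tendsto_log_atTop.eventually_ge_atTop 0] with Z hZ1 hZ hZ0
  have hW1 : 1 ≤ √Z := Real.one_le_sqrt.2 hZ1
  have hlW : Real.log √Z = Real.log Z / 2 := Real.log_sqrt (by linarith)
  have hlW0 : 0 ≤ Real.log √Z := Real.log_nonneg hW1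
  have h1 := le_sum_vonMangoldt_div hZ1
  have h2 := sum_vonMangoldt_div_le hW1
  have h3 := hK (Icc 1 ⌊Z⌋₊)
  have hsub : Icc 1 ⌊√Z⌋₊ ⊆ Icc 1 ⌊Z⌋₊ :=
    Finset.Icc_subset_Icc_right (Nat.floor_mono (Real.sqrt_le_iff.2 ⟨by linarith, by nlinarith⟩))
  have h4 : Real.log √Z * (∑ n ∈ Icc 1 ⌊Z⌋₊, (ArithmeticFunction.vonMangoldt n / n -
      (if n ∈ Icc 1 ⌊√Z⌋₊ then ArithmeticFunction.vonMangoldt n / n else 0) -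
      (if n.Prime then 0 else ArithmeticFunction.vonMangoldt n) / n)) ≤
      ∑ n ∈ Icc 1 ⌊Z⌋₊, ArithmeticFunction.vonMangoldt n ^ 2 / n := by
    rw [Finset.mul_sum]
    refine Finset.sum_le_sum fun n hn => ?_
    have hn1 := (Finset.mem_Icc.1 hn).1
    have hn0 : (0 : ℝ) < n := by positivity
    have hL0 := ArithmeticFunction.vonMangoldt_nonneg (n := n)
    have hq : 0 ≤ ArithmeticFunction.vonMangoldt n / n := by positivity
    have hq2 : 0 ≤ ArithmeticFunction.vonMangoldt n ^ 2 / n := by positivity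
    by_cases hp : n.Prime
    · by_cases hnW : n ∈ Icc 1 ⌊√Z⌋₊
      · simpa [hp, hnW] using hq2
      · simp only [hp, hnW, if_true, if_false, zero_div, sub_zero]
        have hlt : √Z ≤ n := by
          rw [Finset.mem_Icc, not_and] at hnW
          exact (Nat.lt_of_floor_lt (not_le.1 (hnW hn1))).le
        have : Real.log √Z ≤ ArithmeticFunction.vonMangoldt n := by
          rw [ArithmeticFunction.vonMangoldt_apply_prime hp]
          exact Real.log_le_log (by linarith) hlt
        calc _ ≤ ArithmeticFunction.vonMangoldt n * (ArithmeticFunction.vonMangoldt n / n) := by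
              gcongr
          _ = _ := by ring
    · refine le_trans (mul_nonpos_of_nonneg_of_nonpos hlW0 ?_) hq2
      simp only [hp, if_false]
      split_ifs <;> linarith
  rw [Finset.sum_sub_distrib, Finset.sum_sub_distrib, Finset.sum_ite_mem,
    Finset.inter_eq_right.2 hsub] at h4
  have h5 : Real.log √Z * (Real.log Z / 2 - 8 - K) ≤
    ∑ n ∈ Icc 1 ⌊Z⌋₊, ArithmeticFunction.vonMangoldt n ^ 2 / n := by
    refine le_trans (mul_le_mul_of_nonneg_left ?_ hlW0) h4
    linarith
  rw [hlW] at h5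
  nlinarith

theorem sum_vonMangoldt_sq_div_le {Y : ℝ} (hY : 1 ≤ Y) :
    ∑ n ∈ Icc 1 ⌊Y⌋₊, ArithmeticFunction.vonMangoldt n ^ 2 / n ≤
      Real.log Y * (Real.log Y + 6) := by
  refine le_trans ?_ (mul_le_mul_of_nonneg_left (sum_vonMangoldt_div_le hY) (Real.log_nonneg hY))
  rw [Finset.mul_sum]
  refine Finset.sum_le_sum fun n hn => ?_
  obtain ⟨hn1, hn2⟩ := Finset.mem_Icc.1 hn
  have hn0 : (0 : ℝ) < n := by positivity
  have hL0 := ArithmeticFunction.vonMangoldt_nonneg (n := n)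
  have h1 : ArithmeticFunction.vonMangoldt n ≤ Real.log Y :=
    ArithmeticFunction.vonMangoldt_le_log.trans
      (Real.log_le_log hn0 ((Nat.cast_le.2 hn2).trans (Nat.floor_le (by linarith))))
  calc _ = ArithmeticFunction.vonMangoldt n * (ArithmeticFunction.vonMangoldt n / n) := by ring
    _ ≤ _ := by gcongr

theorem integrable_bump_div_mul {c : ℝ} (φ : ContDiffBump c) {T : ℝ} (hT : 0 < T) {f : ℝ → ℂ}
    (hf : Continuous f) : Integrable fun t : ℝ => (φ (t / T) : ℂ) * f t := by
  have h1 : HasCompactSupport fun t : ℝ => φ (t / T) := by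
    have := φ.hasCompactSupport.comp_smul (inv_ne_zero hT.ne')
    simpa [div_eq_inv_mul] using this
  have h2 : HasCompactSupport fun t : ℝ => (φ (t / T) : ℂ) :=
    h1.comp_left (g := ((↑) : ℝ → ℂ)) Complex.ofReal_zero
  refine Continuous.integrable_of_hasCompactSupport ?_ h2.mul_right
  have := φ.continuous
  fun_prop

theorem integrable_bump_div_mul_real {c : ℝ} (φ : ContDiffBump c) {T : ℝ} (hT : 0 < T) {f : ℝ → ℝ}
    (hf : Continuous f) : Integrable fun t : ℝ => φ (t / T) * f t := by
  have := (integrable_bump_div_mul φ hT (Complex.continuous_ofReal.comp hf)).re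
  refine this.congr (Eventually.of_forall fun t => ?_)
  simp [← Complex.ofReal_mul]

theorem integral_bump_div {c : ℝ} (φ : ContDiffBump c) {T : ℝ} (hT : 0 < T) :
    ∫ t : ℝ, φ (t / T) = T * ∫ u : ℝ, φ u := by
  rw [Measure.integral_comp_div (fun u : ℝ => φ u), abs_of_pos hT, smul_eq_mul]

theorem exists_norm_integral_bump_mul_exp_le {c : ℝ} (φ : ContDiffBump c) (k : ℕ) :
    ∃ C > 0, ∀ T : ℝ, 0 < T → ∀ l : ℝ, l ≠ 0 →
      ‖∫ t : ℝ, (φ (t / T) : ℂ) * Complex.exp (-(l * t * Complex.I))‖ ≤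
        C * (T / (T * |l|) ^ k) := by
  have h1 : HasCompactSupport fun t : ℝ => (φ t : ℂ) :=
    φ.hasCompactSupport.comp_left (g := ((↑) : ℝ → ℂ)) Complex.ofReal_zero
  have h2 : ContDiff ℝ ((⊤ : ℕ∞) : WithTop ℕ∞) fun t : ℝ => (φ t : ℂ) :=
    Complex.ofRealCLM.contDiff.comp φ.contDiff
  obtain ⟨C, hC, h⟩ := (FourierTransform.fourier (h1.toSchwartzMap h2)).decay k 0
  refine ⟨C * (2 * Real.pi) ^ k, by positivity, fun T hT l hl => ?_⟩
  have h3 : ∫ t : ℝ, (φ (t / T) : ℂ) * Complex.exp (-(l * t * Complex.I)) =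
      T * FourierTransform.fourier (h1.toSchwartzMap h2) (T * l / (2 * Real.pi)) := by
    have e : (fun t : ℝ => (φ (t / T) : ℂ) * Complex.exp (-(l * t * Complex.I))) =
        fun t : ℝ => (fun u : ℝ => (φ u : ℂ) * Complex.exp (-(l * (T * u : ℝ) * Complex.I)))
          (t / T) := by
      ext t
      simp only
      rw [mul_div_cancel₀ _ hT.ne']
    rw [e, Measure.integral_comp_div
      (fun u : ℝ => (φ u : ℂ) * Complex.exp (-(l * (T * u : ℝ) * Complex.I))), abs_of_pos hT,
      SchwartzMap.fourier_coe, Real.fourier_real_eq_integral_exp_smul, Complex.real_smul]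
    congr 1
    refine integral_congr_ae (Eventually.of_forall fun u => ?_)
    simp only [smul_eq_mul]
    rw [mul_comm]
    congr 2
    push_cast
    have : (Real.pi : ℂ) ≠ 0 := by exact_mod_cast Real.pi_ne_zero
    field_simp
  have h4 := h (T * l / (2 * Real.pi))
  rw [norm_iteratedFDeriv_zero, Real.norm_eq_abs, abs_div, abs_mul, abs_of_pos hT,
    abs_of_pos Real.two_pi_pos, div_pow, div_mul_eq_mul_div, div_le_iff₀ (by positivity)] at h4
  have hp : 0 < (T * |l|) ^ k := by
    have := abs_pos.2 hl
    positivity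
  rw [h3, norm_mul, Complex.norm_real, Real.norm_eq_abs, abs_of_pos hT, mul_div_assoc',
    le_div_iff₀ hp]
  calc _ = T * ((T * |l|) ^ k * ‖FourierTransform.fourier (h1.toSchwartzMap h2)
        (T * l / (2 * Real.pi))‖) := by ring
    _ ≤ T * (C * (2 * Real.pi) ^ k) := by gcongr
    _ = _ := by ring

theorem exists_norm_integral_bump_mul_sum_sub_le {c : ℝ} (φ : ContDiffBump c) (k : ℕ) :
    ∃ C > 0, ∀ (s : Finset (ℕ × ℕ)) (a : ℕ × ℕ → ℂ) (l : ℕ × ℕ → ℝ) (T δ : ℝ), 0 < T → 0 < δ →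
      (∀ i ∈ s, l i ≠ 0 → δ ≤ |l i|) →
      ‖(∫ t : ℝ, (φ (t / T) : ℂ) * ∑ i ∈ s, a i * Complex.exp (-(l i * t * Complex.I))) -
        (T * ∫ u : ℝ, φ u : ℝ) * ∑ i ∈ s with l i = 0, a i‖ ≤
        C * (T / (T * δ) ^ k) * ∑ i ∈ s, ‖a i‖ := by
  obtain ⟨C, hC, h⟩ := exists_norm_integral_bump_mul_exp_le φ k
  refine ⟨C, hC, fun s a l T δ hT hδ hl => ?_⟩
  have h1 : ∫ t : ℝ, (φ (t / T) : ℂ) * ∑ i ∈ s, a i * Complex.exp (-(l i * t * Complex.I)) =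
      ∑ i ∈ s, a i * ∫ t : ℝ, (φ (t / T) : ℂ) * Complex.exp (-(l i * t * Complex.I)) := by
    simp only [Finset.mul_sum, ← integral_const_mul]
    rw [integral_finsetSum]
    · refine Finset.sum_congr rfl fun i _ => integral_congr_ae (Eventually.of_forall fun t => ?_)
      simp only
      ring
    · exact fun i _ => integrable_bump_div_mul φ hT (by fun_prop)
  rw [h1, Finset.sum_filter, Finset.mul_sum, ← Finset.sum_sub_distrib, Finset.mul_sum]
  refine (norm_sum_le _ _).trans (Finset.sum_le_sum fun i hi => ?_)
  by_cases h0 : l i = 0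
  · have e : ∫ t : ℝ, (φ (t / T) : ℂ) = (T * ∫ u : ℝ, φ u : ℝ) := by
      rw [integral_complex_ofReal, integral_bump_div φ hT]
    simp only [h0, Complex.ofReal_zero, zero_mul, neg_zero, Complex.exp_zero, mul_one, e, if_true]
    rw [mul_comm, sub_self, norm_zero]
    positivity
  · rw [if_neg h0, mul_zero, sub_zero, norm_mul, mul_comm]
    refine mul_le_mul_of_nonneg_right ((h T hT _ h0).trans ?_) (norm_nonneg _)
    have := hl i hi h0
    gcongr

noncomputable def dlogCoeff (X : ℝ) (n : ℕ) : ℝ :=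
  ArithmeticFunction.vonMangoldt n / √n * (1 - Real.log n / Real.log X)

theorem dlogCoeff_one (X : ℝ) : dlogCoeff X 1 = 0 := by simp [dlogCoeff]

theorem dlogCoeff_nonneg {X : ℝ} (hX : 1 < X) {n : ℕ} (hn : n ∈ Icc 1 ⌊X⌋₊) :
    0 ≤ dlogCoeff X n := by
  obtain ⟨hn1, hn2⟩ := Finset.mem_Icc.1 hn
  have h := Real.log_le_log (by positivity : (0 : ℝ) < n)
    ((Nat.cast_le.2 hn2).trans (Nat.floor_le (by linarith)))
  have h' := (div_le_one (Real.log_pos hX)).2 h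
  have := ArithmeticFunction.vonMangoldt_nonneg (n := n)
  exact mul_nonneg (by positivity) (by linarith)

theorem dlogCoeff_le {X : ℝ} (hX : 1 < X) {n : ℕ} (hn : n ∈ Icc 1 ⌊X⌋₊) :
    dlogCoeff X n ≤ ArithmeticFunction.vonMangoldt n / √n := by
  obtain ⟨hn1, hn2⟩ := Finset.mem_Icc.1 hn
  have h : 0 ≤ Real.log n / Real.log X :=
    div_nonneg (Real.log_natCast_nonneg n) (Real.log_pos hX).le
  have := ArithmeticFunction.vonMangoldt_nonneg (n := n)
  exact mul_le_of_le_one_right (by positivity) (by linarith)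

theorem sum_dlogCoeff_le {X : ℝ} (hX : 1 < X) :
    ∑ n ∈ Icc 1 ⌊X⌋₊, dlogCoeff X n ≤ X ^ 2 := by
  have hle : (⌊X⌋₊ : ℝ) ≤ X := Nat.floor_le (by linarith)
  calc _ ≤ ∑ n ∈ Icc 1 ⌊X⌋₊, X := by
        refine Finset.sum_le_sum fun n hn => (dlogCoeff_le hX hn).trans ?_
        obtain ⟨hn1, hn2⟩ := Finset.mem_Icc.1 hn
        have h1 : (1 : ℝ) ≤ √n := Real.one_le_sqrt.2 (by exact_mod_cast hn1)
        have h2 : ArithmeticFunction.vonMangoldt n ≤ X :=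
          ArithmeticFunction.vonMangoldt_le_log.trans ((Real.log_le_self (by positivity)).trans
            ((Nat.cast_le.2 hn2).trans hle))
        exact (div_le_self ArithmeticFunction.vonMangoldt_nonneg h1).trans h2
    _ ≤ X ^ 2 := by
        rw [Finset.sum_const, Nat.card_Icc, nsmul_eq_mul, Nat.add_sub_cancel]
        nlinarith

theorem Dlog_eq_sum (X t : ℝ) : Dlog X t =
    ∑ n ∈ Icc 1 ⌊X⌋₊, (dlogCoeff X n : ℂ) * Complex.exp (-(Real.log n * t * Complex.I)) := by
  refine Finset.sum_congr rfl fun n hn => ?_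
  have hn1 := (Finset.mem_Icc.1 hn).1
  have hn0 : (n : ℂ) ≠ 0 := by
    have : n ≠ 0 := by omega
    exact_mod_cast this
  have h1 : ((√(n : ℝ) : ℝ) : ℂ) = (n : ℂ) ^ (1 / 2 : ℂ) := by
    rw [Real.sqrt_eq_rpow, Complex.ofReal_cpow (by positivity)]
    simp
  have h2 : (n : ℂ) ^ (-(t * Complex.I)) = Complex.exp (-(Real.log n * t * Complex.I)) := by
    rw [Complex.cpow_def_of_ne_zero hn0, ← Complex.natCast_log]
    congr 1
    ring
  rw [dlogCoeff, sub_eq_add_neg, Complex.cpow_add _ _ hn0, Complex.cpow_neg, ← h1, h2]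
  push_cast
  ring

theorem continuous_Dlog (X : ℝ) : Continuous (Dlog X) := by
  have : Dlog X = fun t : ℝ => ∑ n ∈ Icc 1 ⌊X⌋₊,
      (dlogCoeff X n : ℂ) * Complex.exp (-(Real.log n * t * Complex.I)) :=
    funext (Dlog_eq_sum X)
  rw [this]
  fun_prop

theorem mangoldtSum_eq_log_mul_Dlog {X : ℝ} (hX : 1 < X) (t : ℝ) :
    mangoldtSum X (1 / 2 + t * Complex.I) = Real.log X * Dlog X t := by
  have hL : (Real.log X : ℂ) ≠ 0 := by exact_mod_cast (Real.log_pos hX).ne'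
  rw [mangoldtSum, Dlog, Finset.mul_sum]
  refine Finset.sum_congr rfl fun n _ => ?_
  rw [neg_add, ← sub_eq_add_neg]
  push_cast
  field_simp

theorem Dlog_mul_self (X t : ℝ) : Dlog X t * Dlog X t =
    ∑ p ∈ Icc 1 ⌊X⌋₊ ×ˢ Icc 1 ⌊X⌋₊, ((dlogCoeff X p.1 * dlogCoeff X p.2 : ℝ) : ℂ) *
      Complex.exp (-((Real.log p.1 + Real.log p.2 : ℝ) * t * Complex.I)) := by
  rw [Dlog_eq_sum, Finset.sum_mul_sum, Finset.sum_product]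
  refine Finset.sum_congr rfl fun m _ => Finset.sum_congr rfl fun n _ => ?_
  rw [mul_mul_mul_comm, ← Complex.exp_add]
  push_cast
  congr 2
  ring

theorem Dlog_mul_conj (X Y a t : ℝ) : Dlog X (t - a) * starRingEnd ℂ (Dlog Y (t - a)) =
    ∑ p ∈ Icc 1 ⌊X⌋₊ ×ˢ Icc 1 ⌊Y⌋₊, ((dlogCoeff X p.1 * dlogCoeff Y p.2 : ℝ) : ℂ) *
      Complex.exp (((Real.log p.1 - Real.log p.2) * a : ℝ) * Complex.I) *
      Complex.exp (-((Real.log p.1 - Real.log p.2 : ℝ) * t * Complex.I)) := by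
  rw [Dlog_eq_sum, Dlog_eq_sum, map_sum, Finset.sum_mul_sum, Finset.sum_product]
  refine Finset.sum_congr rfl fun m _ => Finset.sum_congr rfl fun n _ => ?_
  rw [map_mul, Complex.conj_ofReal, ← Complex.exp_conj, mul_mul_mul_comm, ← Complex.exp_add,
    mul_assoc (Complex.ofReal (_ * _)), ← Complex.exp_add]
  simp only [map_neg, map_mul, Complex.conj_ofReal, Complex.conj_I]
  push_cast
  congr 2
  ring

theorem le_abs_log_sub_log {R : ℝ} (hR : 1 ≤ R) {m n : ℕ} (hm : 1 ≤ m) (hn : 1 ≤ n)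
    (hnR : (n : ℝ) ≤ R) (hmn : m ≠ n) : 1 / (2 * R) ≤ |Real.log m - Real.log n| := by
  have hm0 : (0 : ℝ) < m := by positivity
  have hn0 : (0 : ℝ) < n := by positivity
  rcases lt_or_gt_of_ne hmn with h | h
  · have h1 : (m : ℝ) + 1 ≤ n := by exact_mod_cast h
    have h2 := Real.one_sub_inv_le_log_of_pos (show 0 < (n : ℝ) / m by positivity)
    rw [Real.log_div hn0.ne' hm0.ne', inv_div] at h2
    rw [abs_sub_comm]
    refine le_trans (le_trans ?_ h2) (le_abs_self _)
    rw [div_le_iff₀ (by positivity), sub_mul, div_mul_eq_mul_div, le_sub_iff_add_le,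
      ← le_sub_iff_add_le', div_le_iff₀ hn0]
    nlinarith
  · have h1 : (n : ℝ) + 1 ≤ m := by exact_mod_cast h
    have h2 := Real.one_sub_inv_le_log_of_pos (show 0 < (m : ℝ) / n by positivity)
    rw [Real.log_div hm0.ne' hn0.ne', inv_div] at h2
    refine le_trans (le_trans ?_ h2) (le_abs_self _)
    rw [div_le_iff₀ (by positivity), sub_mul, div_mul_eq_mul_div, le_sub_iff_add_le,
      ← le_sub_iff_add_le', div_le_iff₀ hm0]
    nlinarith

theorem exists_norm_integral_bump_mul_Dlog_sq_le {c : ℝ} (φ : ContDiffBump c) :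
    ∃ C > 0, ∀ R X : ℝ, 1 ≤ R → 1 < X → X ≤ R ^ 16 →
      ‖∫ t : ℝ, (φ (t / R ^ 4) : ℂ) * (Dlog X t * Dlog X t)‖ ≤ C := by
  obtain ⟨C, hC, h⟩ := exists_norm_integral_bump_mul_sum_sub_le φ 17
  refine ⟨C * 2 ^ 17, by positivity, fun R X hR hX hXR => ?_⟩
  have hR0 : 0 < R := by linarith
  set s := Icc 1 ⌊X⌋₊ ×ˢ Icc 1 ⌊X⌋₊ with hs
  have h1 := h s (fun p => ((dlogCoeff X p.1 * dlogCoeff X p.2 : ℝ) : ℂ))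
    (fun p => Real.log p.1 + Real.log p.2) (R ^ 4) (1 / 2) (by positivity) (by norm_num) ?_
  · have h2 : ∑ p ∈ s with Real.log p.1 + Real.log p.2 = 0,
        ((dlogCoeff X p.1 * dlogCoeff X p.2 : ℝ) : ℂ) = 0 := by
      refine Finset.sum_eq_zero fun p hp => ?_
      obtain ⟨hp1, hp2⟩ := Finset.mem_filter.1 hp
      have e1 := (Finset.mem_Icc.1 (Finset.mem_product.1 hp1).1).1
      have e2 := Real.log_natCast_nonneg p.1
      have e3 := Real.log_natCast_nonneg p.2
      have e4 : Real.log p.1 = 0 := by linarith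
      have e5 : p.1 = 1 := by
        by_contra hne
        have : (1 : ℝ) < p.1 := by exact_mod_cast (by omega : 1 < p.1)
        exact (Real.log_pos this).ne' e4
      rw [e5, dlogCoeff_one, zero_mul, Complex.ofReal_zero]
    have h3 : ∑ p ∈ s, ‖((dlogCoeff X p.1 * dlogCoeff X p.2 : ℝ) : ℂ)‖ ≤ R ^ 64 := by
      calc _ = (∑ n ∈ Icc 1 ⌊X⌋₊, dlogCoeff X n) * ∑ n ∈ Icc 1 ⌊X⌋₊, dlogCoeff X n := by
            rw [Finset.sum_mul_sum, ← Finset.sum_product']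
            refine Finset.sum_congr rfl fun p hp => ?_
            obtain ⟨e1, e2⟩ := Finset.mem_product.1 hp
            rw [Complex.norm_real, Real.norm_eq_abs, abs_of_nonneg
              (mul_nonneg (dlogCoeff_nonneg hX e1) (dlogCoeff_nonneg hX e2))]
        _ ≤ X ^ 2 * X ^ 2 := by
            have := sum_dlogCoeff_le hX
            have e0 : 0 ≤ ∑ n ∈ Icc 1 ⌊X⌋₊, dlogCoeff X n :=
              Finset.sum_nonneg fun n hn => dlogCoeff_nonneg hX hn
            gcongr
        _ ≤ (R ^ 16) ^ 2 * (R ^ 16) ^ 2 := by gcongr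
        _ = _ := by ring
    rw [h2, mul_zero, sub_zero] at h1
    simp only [Dlog_mul_self]
    refine h1.trans ((mul_le_mul_of_nonneg_left h3 (by positivity)).trans (le_of_eq ?_))
    field_simp
  · intro p hp hne
    obtain ⟨e1, e2⟩ := Finset.mem_product.1 hp
    have e3 := (Finset.mem_Icc.1 e1).1
    have e4 := (Finset.mem_Icc.1 e2).1
    have l1 := Real.log_natCast_nonneg p.1
    have l2 := Real.log_natCast_nonneg p.2
    have key : ∀ n : ℕ, 2 ≤ n → (1 / 2 : ℝ) ≤ Real.log n := fun n hn => by
      have : Real.log 2 ≤ Real.log n := Real.log_le_log (by norm_num) (by exact_mod_cast hn)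
      have := Real.log_two_gt_d9
      linarith
    refine le_trans ?_ (le_abs_self _)
    by_cases f1 : 2 ≤ p.1
    · have := key _ f1
      linarith
    by_cases f2 : 2 ≤ p.2
    · have := key _ f2
      linarith
    · refine absurd ?_ hne
      rw [show p.1 = 1 by omega, show p.2 = 1 by omega]
      simp

theorem exists_norm_integral_bump_mul_Dlog_mul_conj_sub_le {c : ℝ} (φ : ContDiffBump c) :
    ∃ C > 0, ∀ R X Y a : ℝ, 1 ≤ R → 1 < Y → Y ≤ X → Y ≤ R → X ≤ R ^ 16 →
      ‖(∫ t : ℝ, (φ (t / R ^ 4) : ℂ) * (Dlog X (t - a) * starRingEnd ℂ (Dlog Y (t - a)))) -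
        ((R ^ 4 * (∫ u : ℝ, φ u) * ∑ n ∈ Icc 1 ⌊Y⌋₊, dlogCoeff X n * dlogCoeff Y n : ℝ) : ℂ)‖ ≤
        C := by
  obtain ⟨C, hC, h⟩ := exists_norm_integral_bump_mul_sum_sub_le φ 17
  refine ⟨C * 2 ^ 17, by positivity, fun R X Y a hR hY hYX hYR hXR => ?_⟩
  have hR0 : 0 < R := by linarith
  have hX : 1 < X := by linarith
  set s := Icc 1 ⌊X⌋₊ ×ˢ Icc 1 ⌊Y⌋₊ with hs
  set b : ℕ × ℕ → ℂ := fun p => ((dlogCoeff X p.1 * dlogCoeff Y p.2 : ℝ) : ℂ) *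
      Complex.exp (((Real.log p.1 - Real.log p.2) * a : ℝ) * Complex.I) with hb
  have hlog : ∀ p ∈ s, p.1 ≠ p.2 → 1 / (2 * R) ≤ |Real.log p.1 - Real.log p.2| := by
    intro p hp hne
    obtain ⟨e1, e2⟩ := Finset.mem_product.1 hp
    refine le_abs_log_sub_log hR (Finset.mem_Icc.1 e1).1 (Finset.mem_Icc.1 e2).1 ?_ hne
    exact (Nat.cast_le.2 (Finset.mem_Icc.1 e2).2).trans ((Nat.floor_le (by linarith)).trans hYR)
  have h1 := h s b (fun p => Real.log p.1 - Real.log p.2) (R ^ 4) (1 / (2 * R)) (by positivity)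
    (by positivity) fun p hp hne => hlog p hp fun he => hne (by simp [he])
  have h2 : ∑ p ∈ s with Real.log p.1 - Real.log p.2 = 0, b p =
      ((∑ n ∈ Icc 1 ⌊Y⌋₊, dlogCoeff X n * dlogCoeff Y n : ℝ) : ℂ) := by
    push_cast
    symm
    refine Finset.sum_bij (fun n _ => (n, n)) ?_ ?_ ?_ ?_
    · intro n hn
      refine Finset.mem_filter.2 ⟨Finset.mem_product.2 ⟨?_, hn⟩, by simp⟩
      exact Finset.Icc_subset_Icc_right (Nat.floor_mono hYX) hn
    · intro m _ n _ hmn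
      exact (Prod.mk.inj hmn).1
    · intro p hp
      obtain ⟨hp1, hp2⟩ := Finset.mem_filter.1 hp
      have e : p.1 = p.2 := by
        by_contra hne
        have := hlog p hp1 hne
        rw [hp2, abs_zero] at this
        have : 0 < 1 / (2 * R) := by positivity
        linarith
      exact ⟨p.2, (Finset.mem_product.1 hp1).2, Prod.ext e.symm rfl⟩
    · intro n _
      simp [hb]
  have h3 : ∑ p ∈ s, ‖b p‖ ≤ R ^ 34 := by
    calc _ = (∑ n ∈ Icc 1 ⌊X⌋₊, dlogCoeff X n) * ∑ n ∈ Icc 1 ⌊Y⌋₊, dlogCoeff Y n := by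
          rw [Finset.sum_mul_sum, ← Finset.sum_product']
          refine Finset.sum_congr rfl fun p hp => ?_
          obtain ⟨e1, e2⟩ := Finset.mem_product.1 hp
          rw [hb, norm_mul, Complex.norm_exp_ofReal_mul_I, mul_one, Complex.norm_real,
            Real.norm_eq_abs, abs_of_nonneg
              (mul_nonneg (dlogCoeff_nonneg hX e1) (dlogCoeff_nonneg hY e2))]
      _ ≤ X ^ 2 * Y ^ 2 := by
          have := sum_dlogCoeff_le hX
          have := sum_dlogCoeff_le hY
          have e0 : 0 ≤ ∑ n ∈ Icc 1 ⌊Y⌋₊, dlogCoeff Y n :=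
            Finset.sum_nonneg fun n hn => dlogCoeff_nonneg hY hn
          gcongr
      _ ≤ (R ^ 16) ^ 2 * R ^ 2 := by gcongr
      _ = _ := by ring
  rw [h2, ← Complex.ofReal_mul] at h1
  simp only [Dlog_mul_conj]
  refine h1.trans ((mul_le_mul_of_nonneg_left h3 (by positivity)).trans ?_)
  have e : C * (R ^ 4 / (R ^ 4 * (1 / (2 * R))) ^ 17) * R ^ 34 = C * 2 ^ 17 / R ^ 13 := by
    field_simp
  rw [e]
  exact div_le_self (by positivity) (one_le_pow₀ hR)

theorem exists_integral_bump_mul_norm_Dlog_sq_le {c : ℝ} (φ : ContDiffBump c) :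
    ∃ C > 0, ∀ R Y a : ℝ, 1 ≤ R → 1 < Y → Y ≤ R →
      ∫ t : ℝ, φ (t / R ^ 4) * ‖Dlog Y (t - a)‖ ^ 2 ≤ C * (R ^ 4 * (Real.log R + 1) ^ 2) := by
  obtain ⟨C, hC, h⟩ := exists_norm_integral_bump_mul_Dlog_mul_conj_sub_le φ
  have hK : 0 ≤ ∫ u : ℝ, φ u := integral_nonneg fun u => φ.nonneg
  refine ⟨6 * (∫ u : ℝ, φ u) + C, by positivity, fun R Y a hR hY hYR => ?_⟩
  have h1 := h R Y Y a hR hY le_rfl hYR (hYR.trans (le_self_pow₀ hR (by norm_num)))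
  have e : ∫ t : ℝ, (φ (t / R ^ 4) : ℂ) * (Dlog Y (t - a) * starRingEnd ℂ (Dlog Y (t - a))) =
      ((∫ t : ℝ, φ (t / R ^ 4) * ‖Dlog Y (t - a)‖ ^ 2 : ℝ) : ℂ) := by
    rw [← integral_complex_ofReal]
    refine integral_congr_ae (Eventually.of_forall fun t => ?_)
    simp only [Complex.mul_conj']
    push_cast
    ring
  rw [e, ← Complex.ofReal_sub, Complex.norm_real, Real.norm_eq_abs] at h1
  have h2 := (abs_le.1 h1).2
  have hlY : Real.log Y ≤ Real.log R := Real.log_le_log (by linarith) hYR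
  have hlY0 : 0 ≤ Real.log Y := Real.log_nonneg hY.le
  have h3 : ∑ n ∈ Icc 1 ⌊Y⌋₊, dlogCoeff Y n * dlogCoeff Y n ≤ 6 * (Real.log R + 1) ^ 2 := by
    calc _ ≤ ∑ n ∈ Icc 1 ⌊Y⌋₊, ArithmeticFunction.vonMangoldt n ^ 2 / n := by
          refine Finset.sum_le_sum fun n hn => ?_
          have e0 := dlogCoeff_nonneg hY hn
          have e1 := dlogCoeff_le hY hn
          calc _ ≤ ArithmeticFunction.vonMangoldt n / √n *
                (ArithmeticFunction.vonMangoldt n / √n) := mul_self_le_mul_self e0 e1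
            _ = _ := by rw [div_mul_div_comm, Real.mul_self_sqrt n.cast_nonneg, sq]
      _ ≤ Real.log Y * (Real.log Y + 6) := sum_vonMangoldt_sq_div_le hY.le
      _ ≤ _ := by nlinarith
  have h4 : 1 ≤ R ^ 4 * (Real.log R + 1) ^ 2 :=
    one_le_mul_of_one_le_of_one_le (one_le_pow₀ hR) (one_le_pow₀ (by linarith))
  have h5 : R ^ 4 * (∫ u : ℝ, φ u) * ∑ n ∈ Icc 1 ⌊Y⌋₊, dlogCoeff Y n * dlogCoeff Y n ≤
      R ^ 4 * (∫ u : ℝ, φ u) * (6 * (Real.log R + 1) ^ 2) := by gcongr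
  have h6 : C ≤ C * (R ^ 4 * (Real.log R + 1) ^ 2) := le_mul_of_one_le_right hC.le h4
  linarith

theorem eventually_le_sum_dlogCoeff_mul : ∀ᶠ R : ℝ in atTop, ∀ X : ℝ, R ^ 4 ≤ X →
    Real.log R ^ 2 / 100 ≤ ∑ n ∈ Icc 1 ⌊R⌋₊, dlogCoeff X n * dlogCoeff R n := by
  filter_upwards [Real.tendsto_sqrt_atTop.eventually eventually_le_sum_vonMangoldt_sq_div,
    eventually_gt_atTop 1] with R hR hR1 X hX
  have hl : 0 < Real.log R := Real.log_pos hR1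
  have hlX : 4 * Real.log R ≤ Real.log X := by
    have := Real.log_le_log (by positivity) hX
    rwa [Real.log_pow, Nat.cast_ofNat] at this
  have hRX : R ≤ X := (le_self_pow₀ hR1.le (by norm_num)).trans hX
  have hls : Real.log √R = Real.log R / 2 := Real.log_sqrt (by linarith)
  have hsub : Icc 1 ⌊√R⌋₊ ⊆ Icc 1 ⌊R⌋₊ :=
    Finset.Icc_subset_Icc_right (Nat.floor_mono (Real.sqrt_le_iff.2 ⟨by linarith, by nlinarith⟩))
  calc Real.log R ^ 2 / 100 ≤ 7 / 16 * (Real.log √R ^ 2 / 8) := by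
        rw [hls]
        nlinarith
    _ ≤ 7 / 16 * ∑ n ∈ Icc 1 ⌊√R⌋₊, ArithmeticFunction.vonMangoldt n ^ 2 / n := by gcongr
    _ ≤ ∑ n ∈ Icc 1 ⌊√R⌋₊, dlogCoeff X n * dlogCoeff R n := by
        rw [Finset.mul_sum]
        refine Finset.sum_le_sum fun n hn => ?_
        obtain ⟨hn1, hn2⟩ := Finset.mem_Icc.1 hn
        have hn0 : (0 : ℝ) < n := by positivity
        have hln : Real.log n ≤ Real.log R / 2 := by
          rw [← hls]
          exact Real.log_le_log hn0 ((Nat.cast_le.2 hn2).trans (Nat.floor_le (by positivity)))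
        have w1 : 7 / 8 ≤ 1 - Real.log n / Real.log X := by
          have : Real.log n / Real.log X ≤ 1 / 8 := by
            rw [div_le_iff₀ (by linarith)]
            linarith
          linarith
        have w2 : 1 / 2 ≤ 1 - Real.log n / Real.log R := by
          have : Real.log n / Real.log R ≤ 1 / 2 := by
            rw [div_le_iff₀ hl]
            linarith
          linarith
        have e : dlogCoeff X n * dlogCoeff R n = ArithmeticFunction.vonMangoldt n ^ 2 / n *
            ((1 - Real.log n / Real.log X) * (1 - Real.log n / Real.log R)) := by
          rw [dlogCoeff, dlogCoeff, mul_mul_mul_comm, div_mul_div_comm,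
            Real.mul_self_sqrt n.cast_nonneg, sq]
        rw [e, mul_comm]
        refine mul_le_mul_of_nonneg_left ?_ (by positivity)
        nlinarith
    _ ≤ _ := Finset.sum_le_sum_of_subset_of_nonneg hsub fun n hn _ =>
        mul_nonneg (dlogCoeff_nonneg (hR1.trans_le hRX)
          (Finset.Icc_subset_Icc_right (Nat.floor_mono hRX) hn)) (dlogCoeff_nonneg hR1 hn)

theorem integral_bump_mul_le_intervalIntegral {c : ℝ} (φ : ContDiffBump c) {T : ℝ} (hT : 0 < T)
    (hc₁ : 1 ≤ c - φ.rOut) (hc₂ : c + φ.rOut ≤ 2) {f : ℝ → ℝ} (hf : Continuous f)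
    (hf0 : ∀ t, 0 ≤ f t) : ∫ t : ℝ, φ (t / T) * f t ≤ ∫ t in T..(2 * T), f t := by
  rw [intervalIntegral.integral_of_le (by linarith), ← integral_indicator measurableSet_Ioc]
  refine integral_mono (integrable_bump_div_mul_real φ hT hf)
    ((integrable_indicator_iff measurableSet_Ioc).2
      (hf.integrableOn_Icc.mono_set Set.Ioc_subset_Icc_self)) fun t => ?_
  by_cases ht : t ∈ Set.Ioc T (2 * T)
  · rw [Set.indicator_of_mem ht]
    exact mul_le_of_le_one_left (hf0 t) φ.le_one
  · rw [Set.indicator_of_notMem ht]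
    simp only
    rw [φ.zero_of_le_dist, zero_mul]
    rw [Real.dist_eq]
    by_contra! hlt
    obtain ⟨h1, h2⟩ := abs_lt.1 hlt
    have h3 : 1 < t / T := by linarith
    have h4 : t / T < 2 := by linarith
    rw [lt_div_iff₀ hT, one_mul] at h3
    rw [div_lt_iff₀ hT] at h4
    exact ht ⟨h3, h4.le⟩

theorem intervalIntegral_le_integral_bump_mul {c : ℝ} (φ : ContDiffBump c) {T : ℝ} (hT : 0 < T)
    (hc₁ : c - φ.rIn ≤ 1) (hc₂ : 2 ≤ c + φ.rIn) {f : ℝ → ℝ} (hf : Continuous f)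
    (hf0 : ∀ t, 0 ≤ f t) : ∫ t in T..(2 * T), f t ≤ ∫ t : ℝ, φ (t / T) * f t := by
  rw [intervalIntegral.integral_of_le (by linarith), ← integral_indicator measurableSet_Ioc]
  refine integral_mono ((integrable_indicator_iff measurableSet_Ioc).2
      (hf.integrableOn_Icc.mono_set Set.Ioc_subset_Icc_self))
    (integrable_bump_div_mul_real φ hT hf) fun t => ?_
  by_cases ht : t ∈ Set.Ioc T (2 * T)
  · rw [Set.indicator_of_mem ht]
    simp only
    rw [φ.one_of_mem_closedBall, one_mul]
    have h3 : 1 ≤ t / T := by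
      rw [le_div_iff₀ hT, one_mul]
      exact ht.1.le
    have h4 : t / T ≤ 2 := by
      rw [div_le_iff₀ hT]
      exact ht.2
    rw [Metric.mem_closedBall, Real.dist_eq, abs_le]
    constructor <;> linarith
  · rw [Set.indicator_of_notMem ht]
    exact mul_nonneg φ.nonneg (hf0 t)

theorem exists_le_integral_norm_Dlog_sq : ∃ c > 0, ∀ᶠ R : ℝ in atTop, ∀ X : ℝ,
    R ^ 4 ≤ X → X ≤ R ^ 16 →
      c * (R ^ 4 * Real.log R ^ 2) ≤ ∫ t in R ^ 4..(2 * R ^ 4), ‖Dlog X t‖ ^ 2 := by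
  set φ : ContDiffBump (3 / 2 : ℝ) := ⟨1 / 4, 1 / 2, by norm_num, by norm_num⟩ with hφ
  obtain ⟨C₁, hC₁, h₁⟩ := exists_norm_integral_bump_mul_Dlog_mul_conj_sub_le φ
  obtain ⟨C₂, hC₂, h₂⟩ := exists_integral_bump_mul_norm_Dlog_sq_le φ
  set K := ∫ u : ℝ, φ u with hK
  have hK0 : 0 < K := φ.integral_pos
  refine ⟨K ^ 2 / (640000 * C₂), by positivity, ?_⟩
  filter_upwards [eventually_le_sum_dlogCoeff_mul, eventually_gt_atTop 1,
    Real.tendsto_log_atTop.eventually_ge_atTop 1,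
    Filter.eventually_ge_atTop (200 * C₁ / K)] with R hR hR1 hlR hRC X hX hXR
  have hRX : R ≤ X := (le_self_pow₀ hR1.le (by norm_num)).trans hX
  have h3 := h₁ R X R 0 hR1.le hR1 hRX le_rfl hXR
  have h4 := h₂ R R 0 hR1.le hR1 le_rfl
  simp only [sub_zero] at h3 h4
  set M := R ^ 4 * Real.log R ^ 2 with hM
  have hM0 : 0 < M := by positivity
  have hRM : R ≤ M := by
    have e1 : R ≤ R ^ 4 := le_self_pow₀ hR1.le (by norm_num)
    have e2 : 1 ≤ Real.log R ^ 2 := one_le_pow₀ hlR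
    exact e1.trans (le_mul_of_one_le_right (by positivity) e2)
  have h5 : C₁ ≤ K * M / 200 := by
    rw [div_le_iff₀ hK0] at hRC
    nlinarith
  have h6 : K * M / 100 ≤
      R ^ 4 * K * ∑ n ∈ Icc 1 ⌊R⌋₊, dlogCoeff X n * dlogCoeff R n := by
    calc _ = R ^ 4 * K * (Real.log R ^ 2 / 100) := by rw [hM]; ring
      _ ≤ _ := mul_le_mul_of_nonneg_left (hR X hX) (by positivity)
  set η := 1600 * C₂ / K with hη
  have hη0 : 0 < η := by positivity
  have hT : 0 < R ^ 4 := by positivity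
  have hcX : Continuous fun t => ‖Dlog X t‖ ^ 2 := (continuous_Dlog X).norm.pow 2
  have hcR : Continuous fun t => ‖Dlog R t‖ ^ 2 := (continuous_Dlog R).norm.pow 2
  have h7 : ‖∫ t : ℝ, (φ (t / R ^ 4) : ℂ) * (Dlog X t * starRingEnd ℂ (Dlog R t))‖ ≤
      η * (∫ t : ℝ, φ (t / R ^ 4) * ‖Dlog X t‖ ^ 2) +
      η⁻¹ * ∫ t : ℝ, φ (t / R ^ 4) * ‖Dlog R t‖ ^ 2 := by
    have i1 := integrable_bump_div_mul_real φ hT hcX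
    have i2 := integrable_bump_div_mul_real φ hT hcR
    rw [← integral_const_mul, ← integral_const_mul,
      ← integral_add (i1.const_mul _) (i2.const_mul _)]
    refine norm_integral_le_of_norm_le ((i1.const_mul _).add (i2.const_mul _))
      (Eventually.of_forall fun t => ?_)
    have e0 := φ.nonneg (x := t / R ^ 4)
    rw [norm_mul, norm_mul, RCLike.norm_conj, Complex.norm_real, Real.norm_eq_abs,
      abs_of_nonneg e0]
    have e1 : ‖Dlog X t‖ * ‖Dlog R t‖ ≤ η * ‖Dlog X t‖ ^ 2 + η⁻¹ * ‖Dlog R t‖ ^ 2 := by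
      have e2 : 0 ≤ η⁻¹ * (η * ‖Dlog X t‖ - ‖Dlog R t‖) ^ 2 := by positivity
      have e3 : η⁻¹ * (η * ‖Dlog X t‖ - ‖Dlog R t‖) ^ 2 =
          η * ‖Dlog X t‖ ^ 2 + η⁻¹ * ‖Dlog R t‖ ^ 2 - 2 * (‖Dlog X t‖ * ‖Dlog R t‖) := by
        field_simp
        ring
      have e4 : 0 ≤ ‖Dlog X t‖ * ‖Dlog R t‖ := by positivity
      linarith
    calc _ ≤ φ (t / R ^ 4) * (η * ‖Dlog X t‖ ^ 2 + η⁻¹ * ‖Dlog R t‖ ^ 2) := by gcongr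
      _ = _ := by ring
  have h8 := integral_bump_mul_le_intervalIntegral φ hT (by norm_num [hφ]) (by norm_num [hφ])
    hcX fun t => by positivity
  set I := ∫ t in R ^ 4..(2 * R ^ 4), ‖Dlog X t‖ ^ 2 with hI
  have h9 : K * M / 200 ≤
      ‖∫ t : ℝ, (φ (t / R ^ 4) : ℂ) * (Dlog X t * starRingEnd ℂ (Dlog R t))‖ := by
    have e1 := norm_sub_norm_le
      ((R ^ 4 * K * ∑ n ∈ Icc 1 ⌊R⌋₊, dlogCoeff X n * dlogCoeff R n : ℝ) : ℂ)
      (∫ t : ℝ, (φ (t / R ^ 4) : ℂ) * (Dlog X t * starRingEnd ℂ (Dlog R t)))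
    rw [norm_sub_rev, Complex.norm_real, Real.norm_eq_abs] at e1
    have e2 := le_abs_self (R ^ 4 * K * ∑ n ∈ Icc 1 ⌊R⌋₊, dlogCoeff X n * dlogCoeff R n)
    linarith
  have h10 : η⁻¹ * ∫ t : ℝ, φ (t / R ^ 4) * ‖Dlog R t‖ ^ 2 ≤ K * M / 400 := by
    have e1 : C₂ * (R ^ 4 * (Real.log R + 1) ^ 2) ≤ C₂ * (4 * M) := by
      refine mul_le_mul_of_nonneg_left ?_ hC₂.le
      have : (Real.log R + 1) ^ 2 ≤ 4 * Real.log R ^ 2 := by nlinarith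
      calc _ ≤ R ^ 4 * (4 * Real.log R ^ 2) := by gcongr
        _ = _ := by ring
    calc _ ≤ η⁻¹ * (C₂ * (4 * M)) := by
          gcongr
          exact h4.trans e1
      _ = _ := by
          rw [hη]
          field_simp
          norm_num
  have h11 : K * M / 400 ≤ η * I := by
    have := mul_le_mul_of_nonneg_left h8 hη0.le
    linarith
  have h12 : K ^ 2 / (640000 * C₂) * M = η⁻¹ * (K * M / 400) := by
    rw [hη]
    field_simp
    norm_num
  rw [h12]
  calc _ ≤ η⁻¹ * (η * I) := by gcongr
    _ = I := by field_simp

theorem exists_abs_re_Dlog_le (hRH : RiemannHypothesis) :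
    ∃ B > 0, ∀ X : ℝ, 1 < X → 16 ≤ Real.log X → ∀ t : ℝ, 8 ≤ t → X ≤ 256 * t ^ 4 →
      |(Dlog X t).re| ≤ B * (Real.log (t + 4) + ‖Dlog (X ^ (1 / 16 : ℝ)) t‖ +
        ‖Dlog (X ^ (1 / 16 : ℝ)) (t - 16 * Real.pi / Real.log X)‖) := by
  obtain ⟨B, hB, h⟩ := exists_abs_re_mangoldtSum_le hRH
  refine ⟨B, hB, fun X hX1 hX t ht hXt => ?_⟩
  have h1 := h X hX1 hX t ht hXt
  have hl : 0 < Real.log X := by linarith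
  have hY1 : 1 < X ^ (1 / 16 : ℝ) := Real.one_lt_rpow hX1 (by norm_num)
  have hlY : Real.log (X ^ (1 / 16 : ℝ)) = Real.log X / 16 := by
    rw [Real.log_rpow (by linarith)]
    ring
  have hl16 : |Real.log X / 16| = Real.log X / 16 := abs_of_pos (by positivity)
  rw [mangoldtSum_eq_log_mul_Dlog hX1, mangoldtSum_eq_log_mul_Dlog hY1,
    mangoldtSum_eq_log_mul_Dlog hY1, Complex.re_ofReal_mul, abs_mul, abs_of_pos hl, norm_mul,
    norm_mul, Complex.norm_real, Real.norm_eq_abs, hlY, hl16] at h1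
  refine le_of_mul_le_mul_left (h1.trans ?_) hl
  rw [mul_left_comm]
  refine mul_le_mul_of_nonneg_left ?_ hB.le
  have e1 := norm_nonneg (Dlog (X ^ (1 / 16 : ℝ)) t)
  have e2 := norm_nonneg (Dlog (X ^ (1 / 16 : ℝ)) (t - 16 * Real.pi / Real.log X))
  nlinarith

theorem exists_integral_norm_Dlog_sq_le (hRH : RiemannHypothesis) :
    ∃ c > 0, ∀ᶠ R : ℝ in atTop, ∀ X : ℝ, R ^ 4 ≤ X → X ≤ R ^ 16 →
      (∫ t in R ^ 4..(2 * R ^ 4), ‖Dlog X t‖ ^ 2) ≤ c * (R ^ 4 * Real.log R ^ 2) := by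
  set φ : ContDiffBump (3 / 2 : ℝ) := ⟨1 / 2, 1, by norm_num, by norm_num⟩ with hφ
  obtain ⟨C₁, hC₁, h₁⟩ := exists_norm_integral_bump_mul_Dlog_sq_le φ
  obtain ⟨C₂, hC₂, h₂⟩ := exists_integral_bump_mul_norm_Dlog_sq_le φ
  obtain ⟨B, hB, hre⟩ := exists_abs_re_Dlog_le hRH
  set K := ∫ u : ℝ, φ u with hK
  have hK0 : 0 < K := φ.integral_pos
  refine ⟨6 * B ^ 2 * (64 * K + 8 * C₂) + C₁, by positivity, ?_⟩
  filter_upwards [eventually_ge_atTop 4, Real.tendsto_log_atTop.eventually_ge_atTop 4]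
    with R hR4 hlR X hX hXR
  have hR1 : 1 < R := by linarith
  have hT : 0 < R ^ 4 := by positivity
  have hT16 : 256 ≤ R ^ 4 := by
    have : (4 : ℝ) ^ 4 ≤ R ^ 4 := by gcongr
    linarith
  have hX1 : 1 < X := by linarith
  have hlX : 16 ≤ Real.log X := by
    have := Real.log_le_log hT hX
    rw [Real.log_pow, Nat.cast_ofNat] at this
    linarith
  set Y := X ^ (1 / 16 : ℝ) with hY
  have hY1 : 1 < Y := Real.one_lt_rpow hX1 (by norm_num)
  have hYR : Y ≤ R := by
    calc Y ≤ (R ^ 16) ^ (1 / 16 : ℝ) := Real.rpow_le_rpow (by linarith) hXR (by norm_num)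
      _ = R := by
        rw [← Real.rpow_natCast, ← Real.rpow_mul (by linarith)]
        norm_num
  set a := 16 * Real.pi / Real.log X with ha
  set M := R ^ 4 * Real.log R ^ 2 with hM
  have hM1 : 1 ≤ M := one_le_mul_of_one_le_of_one_le (by linarith) (one_le_pow₀ (by linarith))
  have hcX := continuous_Dlog X
  have hcY := continuous_Dlog Y
  have hfX : Continuous fun t => ‖Dlog X t‖ ^ 2 := hcX.norm.pow 2
  have hfre : Continuous fun t => (Dlog X t).re ^ 2 := (Complex.continuous_re.comp hcX).pow 2
  have hfY : ∀ b : ℝ, Continuous fun t => ‖Dlog Y (t - b)‖ ^ 2 := fun b =>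
    (hcY.comp (continuous_sub_right b)).norm.pow 2
  have hw : ∀ b : ℝ, ∫ t : ℝ, φ (t / R ^ 4) * ‖Dlog Y (t - b)‖ ^ 2 ≤ 4 * C₂ * M := fun b => by
    have e1 := h₂ R Y b hR1.le hY1 hYR
    have e2 : (Real.log R + 1) ^ 2 ≤ 4 * Real.log R ^ 2 := by nlinarith
    calc _ ≤ _ := e1
      _ ≤ C₂ * (R ^ 4 * (4 * Real.log R ^ 2)) := by gcongr
      _ = _ := by ring
  have hlog : ∀ t : ℝ, t ≤ 5 / 2 * R ^ 4 → 0 < t → Real.log (t + 4) ≤ 8 * Real.log R := by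
    intro t ht ht0
    have : Real.log (t + 4) ≤ Real.log (R ^ 8) := by
      refine Real.log_le_log (by linarith) ?_
      have : R ^ 8 = R ^ 4 * R ^ 4 := by ring
      nlinarith
    rwa [Real.log_pow, Nat.cast_ofNat] at this
  have h3 : ∫ t : ℝ, φ (t / R ^ 4) * (Dlog X t).re ^ 2 ≤
      3 * B ^ 2 * (64 * K + 8 * C₂) * M := by
    have i0 := integrable_bump_div_mul_real φ hT (continuous_const (y := (1 : ℝ)))
    have i1 := integrable_bump_div_mul_real φ hT (hfY 0)
    have i2 := integrable_bump_div_mul_real φ hT (hfY a)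
    have i01 : Integrable fun t : ℝ => 64 * Real.log R ^ 2 * (φ (t / R ^ 4) * 1) +
        φ (t / R ^ 4) * ‖Dlog Y (t - 0)‖ ^ 2 := (i0.const_mul _).add i1
    have e : ∫ t : ℝ, 3 * B ^ 2 * (64 * Real.log R ^ 2 * (φ (t / R ^ 4) * 1) +
        φ (t / R ^ 4) * ‖Dlog Y (t - 0)‖ ^ 2 + φ (t / R ^ 4) * ‖Dlog Y (t - a)‖ ^ 2) =
        3 * B ^ 2 * (64 * Real.log R ^ 2 * (R ^ 4 * K) +
        (∫ t : ℝ, φ (t / R ^ 4) * ‖Dlog Y (t - 0)‖ ^ 2) +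
        ∫ t : ℝ, φ (t / R ^ 4) * ‖Dlog Y (t - a)‖ ^ 2) := by
      rw [integral_const_mul, integral_add i01 i2,
        integral_add (i0.const_mul _) i1, integral_const_mul]
      simp only [mul_one]
      rw [integral_bump_div φ hT]
    calc _ ≤ _ := integral_mono (integrable_bump_div_mul_real φ hT hfre)
            ((i01.add i2).const_mul _) fun t => ?_
      _ = _ := e
      _ ≤ 3 * B ^ 2 * (64 * Real.log R ^ 2 * (R ^ 4 * K) + 4 * C₂ * M + 4 * C₂ * M) := by
          gcongr
          · exact hw 0
          · exact hw a
      _ = _ := by rw [hM]; ring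
    simp only [sub_zero, mul_one, Pi.add_apply]
    have hφ0 := φ.nonneg (x := t / R ^ 4)
    have e0 : ∀ x : ℝ, x ≤ 3 * B ^ 2 * (64 * Real.log R ^ 2 + ‖Dlog Y t‖ ^ 2 +
        ‖Dlog Y (t - a)‖ ^ 2) → φ (t / R ^ 4) * x ≤ 3 * B ^ 2 * (64 * Real.log R ^ 2 *
        φ (t / R ^ 4) + φ (t / R ^ 4) * ‖Dlog Y t‖ ^ 2 +
        φ (t / R ^ 4) * ‖Dlog Y (t - a)‖ ^ 2) := fun x hx =>
      (mul_le_mul_of_nonneg_left hx hφ0).trans (le_of_eq (by ring))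
    by_cases hd : 1 ≤ dist (t / R ^ 4) (3 / 2)
    · rw [φ.zero_of_le_dist hd]
      simp
    · rw [not_le, Real.dist_eq, abs_lt] at hd
      have t1 : 1 / 2 < t / R ^ 4 := by linarith [hd.1]
      have t2 : t / R ^ 4 < 5 / 2 := by linarith [hd.2]
      rw [lt_div_iff₀ hT] at t1
      rw [div_lt_iff₀ hT] at t2
      refine e0 _ ?_
      have hXt : X ≤ 256 * t ^ 4 := by
        calc X ≤ (R ^ 4) ^ 4 := hXR.trans (le_of_eq (by ring))
          _ ≤ (2 * t) ^ 4 := by gcongr; linarith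
          _ ≤ _ := by nlinarith [show 0 ≤ t ^ 4 by positivity]
      have h4 := hre X hX1 hlX t (by linarith) hXt
      have h5 := hlog t t2.le (by linarith)
      have h6 : |(Dlog X t).re| ≤
          B * (8 * Real.log R + ‖Dlog Y t‖ + ‖Dlog Y (t - a)‖) := by
        refine h4.trans (mul_le_mul_of_nonneg_left ?_ hB.le)
        linarith
      calc (Dlog X t).re ^ 2 = |(Dlog X t).re| ^ 2 := (sq_abs _).symm
        _ ≤ (B * (8 * Real.log R + ‖Dlog Y t‖ + ‖Dlog Y (t - a)‖)) ^ 2 := by gcongr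
        _ = B ^ 2 * (8 * Real.log R + ‖Dlog Y t‖ + ‖Dlog Y (t - a)‖) ^ 2 := by ring
        _ ≤ B ^ 2 * (3 * (64 * Real.log R ^ 2 + ‖Dlog Y t‖ ^ 2 + ‖Dlog Y (t - a)‖ ^ 2)) := by
            gcongr
            nlinarith [sq_nonneg (8 * Real.log R - ‖Dlog Y t‖),
              sq_nonneg (8 * Real.log R - ‖Dlog Y (t - a)‖),
              sq_nonneg (‖Dlog Y t‖ - ‖Dlog Y (t - a)‖)]
        _ = _ := by ring
  have h7 : ∫ t : ℝ, φ (t / R ^ 4) * ‖Dlog X t‖ ^ 2 =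
      2 * (∫ t : ℝ, φ (t / R ^ 4) * (Dlog X t).re ^ 2) -
      (∫ t : ℝ, (φ (t / R ^ 4) : ℂ) * (Dlog X t * Dlog X t)).re := by
    have i1 : Integrable fun t : ℝ => (φ (t / R ^ 4) : ℂ) * (Dlog X t * Dlog X t) :=
      integrable_bump_div_mul φ hT (hcX.mul hcX)
    rw [← Complex.reCLM_apply, ← Complex.reCLM.integral_comp_comm i1, ← integral_const_mul,
      ← integral_sub ((integrable_bump_div_mul_real φ hT hfre).const_mul _)
      (Complex.reCLM.integrable_comp i1)]
    refine integral_congr_ae (Eventually.of_forall fun t => ?_)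
    simp only [Complex.reCLM_apply]
    rw [Complex.re_ofReal_mul, Complex.mul_re, Complex.sq_norm, Complex.normSq_apply]
    ring
  have h8 := intervalIntegral_le_integral_bump_mul φ hT (by norm_num [hφ]) (by norm_num [hφ])
    hfX fun t => by positivity
  have h9 := (abs_le.1 ((Complex.abs_re_le_norm _).trans (h₁ R X hR1.le hX1 hXR))).1
  have h10 : C₁ ≤ C₁ * M := le_mul_of_one_le_right hC₁.le hM1
  linarith

theorem statement3 (hRH : RiemannHypothesis) :
    ∃ c₁ > 0, ∃ c₂ > 0, ∀ᶠ T : ℝ in atTop, ∀ X : ℝ, T ≤ X → X ≤ T ^ (4 : ℝ) →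
      c₁ * (T * Real.log T ^ 2) ≤ (∫ t in T..(2 * T), ‖Dlog X t‖ ^ 2) ∧
      (∫ t in T..(2 * T), ‖Dlog X t‖ ^ 2) ≤ c₂ * (T * Real.log T ^ 2) := by
  obtain ⟨c₁, hc₁, h₁⟩ := exists_le_integral_norm_Dlog_sq
  obtain ⟨c₂, hc₂, h₂⟩ := exists_integral_norm_Dlog_sq_le hRH
  refine ⟨c₁ / 16, by positivity, c₂ / 16, by positivity, ?_⟩
  have hR : Tendsto (fun T : ℝ => T ^ (1 / 4 : ℝ)) atTop atTop :=
    tendsto_rpow_atTop (by norm_num)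
  filter_upwards [hR.eventually h₁, hR.eventually h₂, eventually_gt_atTop 0]
    with T hT₁ hT₂ hT X hX hXT
  have e1 : (T ^ (1 / 4 : ℝ)) ^ 4 = T := by
    rw [← Real.rpow_natCast, ← Real.rpow_mul hT.le]
    norm_num
  have e2 : (T ^ (1 / 4 : ℝ)) ^ 16 = T ^ (4 : ℝ) := by
    rw [← Real.rpow_natCast, ← Real.rpow_mul hT.le]
    norm_num
  have e3 : Real.log (T ^ (1 / 4 : ℝ)) ^ 2 = Real.log T ^ 2 / 16 := by
    rw [Real.log_rpow hT]
    ring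
  rw [e1, e2, e3] at hT₁ hT₂
  have h3 := hT₁ X hX hXT
  have h4 := hT₂ X hX hXT
  constructor <;> linarith
end

section
/- For X ≥ 2, T large, and every x ∈ ℝ, ∫_{−log T/log log T}^{log T/log log T} e^{−ixy}·f_X(y) dy = 𝟙_{0<x<log X}·2πi·x·(log(X/e^x)/log X) + O(log log T/log T), where f_X(y) = (X^{iy}(2 − iy·log X) − 2 − iy·log X)/(y³·log X) and 𝟙 denotes the indicator of the stated condition. -/
open MeasureTheory Filter Finset

/-- `f_X(y) = (X^{iy}(2 - iy log X) - 2 - iy log X)/(y³ log X)`. -/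
noncomputable def fX (X : ℝ) (y : ℝ) : ℂ :=
  ((X : ℂ) ^ (Complex.I * (y : ℂ)) * (2 - Complex.I * y * Real.log X) -
      2 - Complex.I * y * Real.log X) / ((y : ℂ) ^ 3 * (Real.log X : ℂ))

open scoped FourierTransform

theorem norm_setIntegral_Ioi_le_of_norm_le_div_sq {h : ℝ → ℂ} {K R : ℝ} (hR : 0 < R)
    (hb : ∀ y, 0 < y → ‖h y‖ ≤ K / y ^ 2) : ‖∫ y in Set.Ioi R, h y‖ ≤ K / R := by
  have hrpow : ∀ y ∈ Set.Ioi R, K * y ^ (-2 : ℝ) = K / y ^ 2 := by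
    intro y hy
    rw [Real.rpow_neg (hR.trans hy).le, div_eq_mul_inv]
    norm_num
  calc ‖∫ y in Set.Ioi R, h y‖ ≤ ∫ y in Set.Ioi R, K * y ^ (-2 : ℝ) := by
        refine norm_integral_le_of_norm_le
          ((integrableOn_Ioi_rpow_of_lt (by norm_num) hR).const_mul K) ?_
        refine (ae_restrict_iff' measurableSet_Ioi).mpr (Eventually.of_forall fun y hy => ?_)
        rw [hrpow y hy]
        exact hb y (hR.trans hy)
    _ = K / R := by
        rw [integral_const_mul, integral_Ioi_rpow_of_lt (by norm_num) hR]
        norm_num [Real.rpow_neg_one]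
        rfl

theorem norm_intervalIntegral_sub_integral_le {h : ℝ → ℂ} {K R : ℝ} (hR : 0 < R)
    (hh : Integrable h) (hb : ∀ y, ‖h y‖ ≤ K / y ^ 2) :
    ‖(∫ y in (-R)..R, h y) - ∫ y, h y‖ ≤ 2 * K / R := by
  have hpos := norm_setIntegral_Ioi_le_of_norm_le_div_sq (h := h) hR fun y _ => hb y
  have hneg : ‖∫ y in Set.Iic (-R), h y‖ ≤ K / R := by
    rw [← integral_comp_neg_Ioi]
    exact norm_setIntegral_Ioi_le_of_norm_le_div_sq hR fun y _ => by simpa using hb (-y)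
  have hsplit : (∫ y in (-R)..R, h y) - ∫ y, h y =
      -((∫ y in Set.Iic (-R), h y) + ∫ y in Set.Ioi R, h y) := by
    rw [← intervalIntegral.integral_Iic_add_Ioi (b := -R) hh.integrableOn hh.integrableOn,
      ← intervalIntegral.integral_interval_add_Ioi (a := -R) (b := R)
        hh.integrableOn hh.integrableOn]
    ring
  rw [hsplit, norm_neg]
  calc _ ≤ _ := norm_add_le _ _
    _ ≤ K / R + K / R := add_le_add hneg hpos
    _ = 2 * K / R := by ring

theorem fX_eq {X : ℝ} (hX : 0 < X) (y : ℝ) :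
    fX X y = (Complex.exp (Complex.I * ((y * Real.log X : ℝ) : ℂ)) *
      (2 - Complex.I * y * Real.log X) - 2 - Complex.I * y * Real.log X) /
        ((y : ℂ) ^ 3 * (Real.log X : ℂ)) := by
  rw [fX, Complex.cpow_def_of_ne_zero (by exact_mod_cast hX.ne'), ← Complex.ofReal_log hX.le]
  congr 5
  push_cast
  ring

theorem norm_fX_le {X : ℝ} (hX : 1 < X) (y : ℝ) : ‖fX X y‖ ≤ 4 / y ^ 2 := by
  rcases eq_or_ne y 0 with rfl | hy
  · simp [fX]
  have hL : 0 < Real.log X := Real.log_pos hX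
  rw [fX_eq (zero_lt_one.trans hX)]
  set L := Real.log X
  have he := Complex.norm_exp_I_mul_ofReal (y * L)
  have he' := Real.norm_exp_I_mul_ofReal_sub_one_le (x := y * L)
  set e := Complex.exp (Complex.I * ((y * L : ℝ) : ℂ))
  have hnum : e * (2 - Complex.I * y * L) - 2 - Complex.I * y * L =
      2 * (e - 1) - Complex.I * ((y * L : ℝ) : ℂ) * (e + 1) := by
    push_cast
    ring
  have hadd : ‖e + 1‖ ≤ 2 := (norm_add_le _ _).trans (by rw [he, norm_one]; norm_num)
  have hbound : ‖e * (2 - Complex.I * y * L) - 2 - Complex.I * y * L‖ ≤ 4 * (|y| * L) := by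
    rw [hnum]
    refine (norm_sub_le _ _).trans ?_
    rw [norm_mul, norm_mul, norm_mul, Complex.norm_I, Complex.norm_real]
    rw [Real.norm_eq_abs, abs_mul, abs_of_pos hL] at he' ⊢
    have : 0 ≤ |y| * L := by positivity
    norm_num
    nlinarith
  have hy' : 0 < |y| := abs_pos.mpr hy
  rw [norm_div, norm_mul, norm_pow, Complex.norm_real, Complex.norm_real, Real.norm_eq_abs,
    Real.norm_eq_abs, abs_of_pos hL, ← sq_abs y, div_le_div_iff₀ (by positivity) (by positivity)]
  calc _ ≤ 4 * (|y| * L) * |y| ^ 2 := by gcongr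
    _ = _ := by ring

/-- The parabolic arch `t (1 - t / L)` on `[0, L]`, extended by zero. -/
noncomputable def parabolicArch (L t : ℝ) : ℂ := ((max 0 (t * (1 - t / L)) : ℝ) : ℂ)

theorem parabolicArch_of_mem {L t : ℝ} (hL : 0 < L) (h₀ : 0 ≤ t) (h₁ : t ≤ L) :
    parabolicArch L t = ((t * (1 - t / L) : ℝ) : ℂ) := by
  have : t / L ≤ 1 := (div_le_one hL).mpr h₁
  rw [parabolicArch, max_eq_right (mul_nonneg h₀ (by linarith))]

theorem parabolicArch_of_notMem {L t : ℝ} (hL : 0 < L) (h : ¬(0 < t ∧ t < L)) :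
    parabolicArch L t = 0 := by
  rw [parabolicArch, max_eq_left, Complex.ofReal_zero]
  by_cases h₀ : 0 < t
  · have : 1 ≤ t / L := (one_le_div hL).mpr (not_lt.mp fun h₁ => h ⟨h₀, h₁⟩)
    exact mul_nonpos_of_nonneg_of_nonpos h₀.le (by linarith)
  · have h₀' := not_lt.mp h₀
    have : t / L ≤ 0 := div_nonpos_of_nonpos_of_nonneg h₀' hL.le
    exact mul_nonpos_of_nonpos_of_nonneg h₀' (by linarith)

theorem continuous_parabolicArch (L : ℝ) : Continuous (parabolicArch L) := by
  unfold parabolicArch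
  fun_prop

theorem integrable_parabolicArch {L : ℝ} (hL : 0 < L) : Integrable (parabolicArch L) := by
  refine (continuous_parabolicArch L).integrable_of_hasCompactSupport
    (HasCompactSupport.intro (isCompact_Icc (a := 0) (b := L)) fun t ht => ?_)
  exact parabolicArch_of_notMem hL fun h => ht ⟨h.1.le, h.2.le⟩

theorem integral_arch_mul_exp {L : ℝ} (hL : L ≠ 0) {c : ℂ} (hc : c ≠ 0) :
    ∫ t in (0 : ℝ)..L, Complex.exp (c * t) * ((t * (1 - t / L) : ℝ) : ℂ) =
      (2 + c * L - Complex.exp (c * L) * (2 - c * L)) / (c ^ 3 * L) := by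
  have hL' : (L : ℂ) ≠ 0 := by exact_mod_cast hL
  have hderiv : ∀ t : ℝ, HasDerivAt (fun s : ℝ => Complex.exp (c * s) *
      ((s * (1 - s / L)) / c - (1 - 2 * s / L) / c ^ 2 - 2 / L / c ^ 3))
      (Complex.exp (c * t) * ((t * (1 - t / L) : ℝ) : ℂ)) t := by
    intro t
    have h₁ : HasDerivAt (fun z : ℂ => Complex.exp (c * z) *
        ((z * (1 - z / L)) / c - (1 - 2 * z / L) / c ^ 2 - 2 / L / c ^ 3)) _ (t : ℂ) :=
      ((hasDerivAt_id (t : ℂ)).const_mul c).cexp.mul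
        (((((hasDerivAt_id (t : ℂ)).mul
          (((hasDerivAt_id (t : ℂ)).div_const (L : ℂ)).const_sub 1)).div_const c).sub
          (((((hasDerivAt_id (t : ℂ)).const_mul 2).div_const (L : ℂ)).const_sub 1).div_const
            (c ^ 2))).sub_const (2 / L / c ^ 3))
    refine h₁.comp_ofReal.congr_deriv ?_
    simp only [id]
    push_cast
    field_simp
    ring
  rw [intervalIntegral.integral_eq_sub_of_hasDerivAt (fun t _ => hderiv t)
    (Continuous.intervalIntegrable (by fun_prop) _ _)]
  push_cast
  simp only [mul_zero, Complex.exp_zero]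
  field_simp
  ring

theorem fourier_parabolicArch {L : ℝ} (hL : 0 < L) (w : ℝ) :
    𝓕 (parabolicArch L) w = ∫ t in (0 : ℝ)..L,
      Complex.exp ((-(2 * Real.pi * w) * Complex.I : ℂ) * t) * ((t * (1 - t / L) : ℝ) : ℂ) := by
  rw [Real.fourier_real_eq_integral_exp_smul, intervalIntegral.integral_of_le hL.le,
    ← setIntegral_eq_integral_of_forall_compl_eq_zero (s := Set.Ioc 0 L)]
  · refine setIntegral_congr_fun measurableSet_Ioc fun t ht => ?_
    simp only [parabolicArch_of_mem hL ht.1.le ht.2, smul_eq_mul]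
    congr 2
    push_cast
    ring
  · intro t ht
    rw [parabolicArch_of_notMem hL fun h => ht ⟨h.1, h.2.le⟩, smul_zero]

theorem fX_eq_fourier {X : ℝ} (hX : 1 < X) {y : ℝ} (hy : y ≠ 0) :
    fX X y = Complex.I * 𝓕 (parabolicArch (Real.log X)) (y / (-(2 * Real.pi))) := by
  have hL : 0 < Real.log X := Real.log_pos hX
  have hc : (-(2 * Real.pi * ((y / (-(2 * Real.pi)) : ℝ) : ℂ)) * Complex.I : ℂ) =
      Complex.I * y := by
    have : (Real.pi : ℂ) ≠ 0 := by exact_mod_cast Real.pi_ne_zero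
    push_cast
    field_simp
  have hy' : (y : ℂ) ≠ 0 := by exact_mod_cast hy
  have hL' : (Real.log X : ℂ) ≠ 0 := by exact_mod_cast hL.ne'
  rw [fourier_parabolicArch hL, hc, integral_arch_mul_exp hL.ne' (by simp [hy]),
    fX_eq (zero_lt_one.trans hX), mul_pow, Complex.I_pow_three]
  push_cast
  rw [mul_assoc Complex.I (y : ℂ)]
  have hI := Complex.I_ne_zero
  field_simp
  ring

theorem integrable_fourier_parabolicArch {X : ℝ} (hX : 1 < X) :
    Integrable (𝓕 (parabolicArch (Real.log X))) := by
  have hg := integrable_parabolicArch (Real.log_pos hX)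
  set g := parabolicArch (Real.log X)
  have hcont : Continuous (𝓕 g) :=
    VectorFourier.fourierIntegral_continuous Real.continuous_fourierChar
      (by exact continuous_inner) hg
  have hπ : -(2 * Real.pi) ≠ 0 := by simp [Real.pi_ne_zero]
  rw [← integrable_comp_div_iff (𝓕 g) hπ]
  refine (integrable_inv_one_add_sq.const_mul ((∫ t, ‖g t‖) + 4)).mono'
    (by fun_prop) (Eventually.of_forall fun y => ?_)
  have hM : ‖𝓕 g (y / (-(2 * Real.pi)))‖ ≤ ∫ t, ‖g t‖ :=
    VectorFourier.norm_fourierIntegral_le_integral_norm _ _ _ _ _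
  have hdecay : ‖𝓕 g (y / (-(2 * Real.pi)))‖ * y ^ 2 ≤ 4 := by
    rcases eq_or_ne y 0 with rfl | hy
    · simp
    · have := norm_fX_le hX y
      rw [fX_eq_fourier hX hy, norm_mul, Complex.norm_I, one_mul] at this
      exact (le_div_iff₀ (by positivity)).mp this
  rw [← div_eq_mul_inv, le_div_iff₀ (by positivity)]
  linarith

/-- The integrand of the Fourier inversion formula at `x` for the parabolic arch on
`[0, log X]`, multiplied by `i`. -/
noncomputable def archInversionIntegrand (X x w : ℝ) : ℂ :=
  Complex.I * (Complex.exp (((2 * Real.pi * (w * x) : ℝ) : ℂ) * Complex.I) *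
    𝓕 (parabolicArch (Real.log X)) w)

theorem integrable_archInversionIntegrand {X : ℝ} (hX : 1 < X) (x : ℝ) :
    Integrable (archInversionIntegrand X x) := by
  refine Integrable.const_mul ?_ Complex.I
  refine (integrable_fourier_parabolicArch hX).bdd_mul (c := 1)
    (Continuous.aestronglyMeasurable (by fun_prop)) (Eventually.of_forall fun w => ?_)
  rw [Complex.norm_exp_ofReal_mul_I]

theorem integral_archInversionIntegrand {X : ℝ} (hX : 1 < X) (x : ℝ) :
    ∫ w, archInversionIntegrand X x w = Complex.I * parabolicArch (Real.log X) x := by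
  have hinv := congrFun ((continuous_parabolicArch (Real.log X)).fourierInv_fourier_eq
    (integrable_parabolicArch (Real.log_pos hX)) (integrable_fourier_parabolicArch hX)) x
  rw [Real.fourierInv_eq'] at hinv
  simp only [archInversionIntegrand]
  rw [integral_const_mul, ← hinv]
  simp [mul_comm x]

theorem exp_mul_fX_ae_eq {X : ℝ} (hX : 1 < X) (x : ℝ) :
    (fun y : ℝ => Complex.exp (-(Complex.I * x * y)) * fX X y) =ᵐ[volume]
      fun y : ℝ => archInversionIntegrand X x (y / (-(2 * Real.pi))) := by
  filter_upwards [Measure.ae_ne volume (0 : ℝ)] with y hy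
  have hexp : (((2 * Real.pi * (y / (-(2 * Real.pi)) * x) : ℝ) : ℂ) * Complex.I) =
      -(Complex.I * x * y) := by
    have : (Real.pi : ℂ) ≠ 0 := by exact_mod_cast Real.pi_ne_zero
    push_cast
    field_simp
  simp only [archInversionIntegrand, hexp, fX_eq_fourier hX hy]
  ring

theorem integrable_exp_mul_fX {X : ℝ} (hX : 1 < X) (x : ℝ) :
    Integrable fun y : ℝ => Complex.exp (-(Complex.I * x * y)) * fX X y :=
  ((integrable_archInversionIntegrand hX x).comp_div (by simp [Real.pi_ne_zero])).congr
    (exp_mul_fX_ae_eq hX x).symm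

theorem integral_exp_mul_fX {X : ℝ} (hX : 1 < X) (x : ℝ) :
    ∫ y : ℝ, Complex.exp (-(Complex.I * x * y)) * fX X y =
      2 * Real.pi * Complex.I * parabolicArch (Real.log X) x := by
  rw [integral_congr_ae (exp_mul_fX_ae_eq hX x), Measure.integral_comp_div,
    integral_archInversionIntegrand hX, abs_neg, abs_of_pos Real.two_pi_pos, Complex.real_smul]
  push_cast
  ring

theorem statement16 :
    ∃ C > 0, ∀ᶠ T : ℝ in atTop, ∀ X : ℝ, 2 ≤ X → ∀ x : ℝ,
      ‖(∫ y in (-(Real.log T / Real.log (Real.log T)))..(Real.log T / Real.log (Real.log T)),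
            Complex.exp (-(Complex.I * (x : ℂ) * (y : ℂ))) * fX X y) -
          (if 0 < x ∧ x < Real.log X then
            2 * Real.pi * Complex.I * (x : ℂ) *
              ((Real.log (X / Real.exp x) / Real.log X : ℝ) : ℂ)
          else 0)‖ ≤
        C * (Real.log (Real.log T) / Real.log T) := by
  refine ⟨8, by norm_num, ?_⟩
  have hlog := Real.tendsto_log_atTop
  filter_upwards [hlog.eventually_gt_atTop 0, (hlog.comp hlog).eventually_gt_atTop 0]
    with T hT hT' X hX2 x
  have hX : 1 < X := by linarith
  have hL : 0 < Real.log X := Real.log_pos hX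
  have hmain : (if 0 < x ∧ x < Real.log X then
        2 * Real.pi * Complex.I * (x : ℂ) *
          ((Real.log (X / Real.exp x) / Real.log X : ℝ) : ℂ) else 0) =
      2 * Real.pi * Complex.I * parabolicArch (Real.log X) x := by
    split_ifs with h
    · rw [parabolicArch_of_mem hL h.1.le h.2.le, Real.log_div (by linarith) (Real.exp_ne_zero x),
        Real.log_exp, sub_div, div_self hL.ne']
      push_cast
      ring
    · rw [parabolicArch_of_notMem hL h, mul_zero]
  rw [hmain, ← integral_exp_mul_fX hX x]
  refine (norm_intervalIntegral_sub_integral_le (K := 4) (div_pos hT hT')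
    (integrable_exp_mul_fX hX x) fun y => ?_).trans_eq ?_
  · have : ‖Complex.exp (-(Complex.I * x * y))‖ = 1 := by
      rw [Complex.norm_exp]
      simp
    rw [norm_mul, this, one_mul]
    exact norm_fX_le hX y
  · field_simp
    norm_num
end
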